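/- arXiv:0707.4007 — 3 statements merged into one kernel-verified Lean document; each statement's English description precedes it below -/
import Mathlib

section
/- Let G = [3^k, ∞^l, 3^m] with k, l, m ≥ 1 and k > 1 or m > 1. Then there is a finite set S of primes such that for every odd prime p ∉ S, the group G^p = [3^k, ∞^l, 3^m]^p is a string C-group. -/
/- Setup: the reduction mod an odd prime `p` of the `3`-infinity Coxeter group
`[3^k, ∞^l, 3^m]`, acting on `V = (ZMod p)^n` with `n = k + l + m + 1`. -/

namespace Statement11

/-- The Gram matrix of the basic system for `[3^k, ∞^l, 3^m]`, reduced mod `p`: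
diagonal entries `1`; the entry for the branch `{i−1, i}` is `−2⁻¹` if the branch is
labelled `3` (i.e. `1 ≤ i ≤ k` or `k+l+1 ≤ i ≤ n−1`) and `−1` if it is labelled `∞`
(i.e. `k+1 ≤ i ≤ k+l`); all other entries `0`. -/
def gram (p k l m : ℕ) : Matrix (Fin (k + l + m + 1)) (Fin (k + l + m + 1)) (ZMod p) :=
  fun i j =>
    if i = j then 1
    else if (j : ℕ) = (i : ℕ) + 1 then
      (if (j : ℕ) ≤ k ∨ k + l + 1 ≤ (j : ℕ) then -(2⁻¹ : ZMod p) else -1)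
    else if (i : ℕ) = (j : ℕ) + 1 then
      (if (i : ℕ) ≤ k ∨ k + l + 1 ≤ (i : ℕ) then -(2⁻¹ : ZMod p) else -1)
    else 0

/-- The corresponding symmetric bilinear form `x·y` on `V`. -/
def form (p k l m : ℕ) (x y : Fin (k + l + m + 1) → ZMod p) : ZMod p :=
  ∑ i, ∑ j, x i * gram p k l m i j * y j

/-- The general linear group of `V`. -/
abbrev GLV (p k l m : ℕ) := (Module.End (ZMod p) (Fin (k + l + m + 1) → ZMod p))ˣ

/-- `r i` is the generating reflection `r_i : x ↦ x − 2(x·b_i) b_i`. -/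
def ReflHyp (p k l m : ℕ) (r : Fin (k + l + m + 1) → GLV p k l m) : Prop :=
  ∀ i x, (r i).1 x =
    x - (2 * form p k l m x (Pi.single i 1)) •
      (Pi.single i 1 : Fin (k + l + m + 1) → ZMod p)

/-- The intersection property (string C-group condition). -/
def IsStringC (p k l m : ℕ) (r : Fin (k + l + m + 1) → GLV p k l m) : Prop :=
  ∀ I J : Set (Fin (k + l + m + 1)),
    Subgroup.closure (r '' I) ⊓ Subgroup.closure (r '' J) = Subgroup.closure (r '' (I ∩ J))

/-- `O₁(V)` (written `Ô₁(V)` when the form on `V` is degenerate): the subgroup of `O(V)`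
generated by all reflections `r_a : x ↦ x − 2((x·a)/(a·a)) a` with `a·a` a nonzero square. -/
def O1 (p k l m : ℕ) : Subgroup (GLV p k l m) :=
  Subgroup.closure {g | ∃ a : Fin (k + l + m + 1) → ZMod p,
    (∃ t : ZMod p, t ≠ 0 ∧ form p k l m a a = t ^ 2) ∧
    ∀ x, g.1 x = x - (2 * form p k l m x a * (form p k l m a a)⁻¹) • a}

section Clifford

variable {F W ι : Type*} [Field F] [AddCommGroup W] [Module F W]

open CliffordAlgebra

/-- The composite, over the indices `i` of a list, of the projections
`x ↦ x - eᵢ * (eᵢ* ⌋ x)` of an exterior algebra. -/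
noncomputable def killIndices (e : Module.Basis ι F W) :
    List ι → CliffordAlgebra (0 : QuadraticForm F W) → CliffordAlgebra (0 : QuadraticForm F W)
  | [], x => x
  | i :: L, x => killIndices e L
      (x - CliffordAlgebra.ι 0 (e i) * contractLeft (e.coord i) x)

theorem killIndices_add (e : Module.Basis ι F W) (L : List ι)
    (x y : CliffordAlgebra (0 : QuadraticForm F W)) :
    killIndices e L (x + y) = killIndices e L x + killIndices e L y := by
  induction L generalizing x y with
  | nil => rfl
  | cons i L ih =>
    simp only [killIndices]
    rw [← ih]
    congr 1
    simp only [map_add, mul_add]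
    abel

theorem killIndices_smul (e : Module.Basis ι F W) (L : List ι) (r : F)
    (x : CliffordAlgebra (0 : QuadraticForm F W)) :
    killIndices e L (r • x) = r • killIndices e L x := by
  induction L generalizing x with
  | nil => rfl
  | cons i L ih =>
    simp only [killIndices]
    rw [← ih]
    congr 1
    simp only [map_smul, mul_smul_comm, smul_sub]

theorem killIndices_algebraMap (e : Module.Basis ι F W) (L : List ι) (r : F) :
    killIndices e L (algebraMap F _ r) = algebraMap F _ r := by
  induction L with
  | nil => rfl
  | cons i L ih => simpa [killIndices] using ih

theorem killIndices_basis_mul (e : Module.Basis ι F W) (L : List ι) (j : ι) (hj : j ∈ L)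
    (x : CliffordAlgebra (0 : QuadraticForm F W)) :
    killIndices e L (CliffordAlgebra.ι 0 (e j) * x) = 0 := by
  classical
  induction L generalizing x with
  | nil => simp at hj
  | cons i L ih =>
    simp only [killIndices, contractLeft_ι_mul, Module.Basis.coord_apply]
    by_cases hij : j = i
    · subst hij
      have h0 : CliffordAlgebra.ι (0 : QuadraticForm F W) (e j) *
          CliffordAlgebra.ι (0 : QuadraticForm F W) (e j) = 0 := by
        simp [CliffordAlgebra.ι_sq_scalar]
      have : CliffordAlgebra.ι (0 : QuadraticForm F W) (e j) * x -
          CliffordAlgebra.ι (0 : QuadraticForm F W) (e j) *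
          ((e.repr (e j)) j • x - CliffordAlgebra.ι (0 : QuadraticForm F W) (e j) *
            contractLeft (e.coord j) x) = (0 : F) • x := by
        simp [mul_sub, ← mul_assoc, h0]
      rw [this, killIndices_smul, zero_smul]
    · have hsw := CliffordAlgebra.ι_mul_ι_add_swap (Q := (0 : QuadraticForm F W)) (e i) (e j)
      have h0 : CliffordAlgebra.ι (0 : QuadraticForm F W) (e i) *
          CliffordAlgebra.ι (0 : QuadraticForm F W) (e j) =
          - (CliffordAlgebra.ι (0 : QuadraticForm F W) (e j) *
          CliffordAlgebra.ι (0 : QuadraticForm F W) (e i)) := by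
        rw [eq_neg_iff_add_eq_zero, hsw]; simp [QuadraticMap.polar]
      have : CliffordAlgebra.ι (0 : QuadraticForm F W) (e j) * x -
          CliffordAlgebra.ι (0 : QuadraticForm F W) (e i) *
          ((e.repr (e j)) i • x - CliffordAlgebra.ι (0 : QuadraticForm F W) (e j) *
            contractLeft (e.coord i) x) =
          CliffordAlgebra.ι (0 : QuadraticForm F W) (e j) *
            (x - CliffordAlgebra.ι (0 : QuadraticForm F W) (e i) *
              contractLeft (e.coord i) x) := by
        simp [mul_sub, ← mul_assoc, h0, hij]
      rw [this]
      exact ih ((List.mem_cons.1 hj).resolve_left hij) _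

theorem killIndices_eq_algebraMap [Fintype ι] (e : Module.Basis ι F W)
    (y : CliffordAlgebra (0 : QuadraticForm F W)) :
    ∃ r : F, killIndices e Finset.univ.toList y = algebraMap F _ r := by
  induction y using CliffordAlgebra.left_induction with
  | algebraMap r => exact ⟨r, killIndices_algebraMap e _ r⟩
  | add x y hx hy =>
    obtain ⟨r, hr⟩ := hx
    obtain ⟨s, hs⟩ := hy
    exact ⟨r + s, by rw [killIndices_add, hr, hs, map_add]⟩
  | ι_mul x m _ =>
    refine ⟨0, ?_⟩
    have key : ∀ s : Finset ι, killIndices e Finset.univ.toList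
        (CliffordAlgebra.ι 0 (∑ i ∈ s, e.repr m i • e i) * x) = 0 := by
      classical
      intro s
      induction s using Finset.induction_on with
      | empty => simpa using killIndices_smul e Finset.univ.toList (0 : F) x
      | insert a s ha ih =>
        rw [Finset.sum_insert ha, map_add, add_mul, killIndices_add, ih, map_smul, smul_mul_assoc,
          killIndices_smul, killIndices_basis_mul e _ a (by simp), smul_zero, add_zero]
    have := key Finset.univ
    rw [e.sum_repr] at this
    rw [this, map_zero]

theorem killIndices_eq_self (e : Module.Basis ι F W) (L : List ι)
    (y : CliffordAlgebra (0 : QuadraticForm F W))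
    (hy : ∀ i, contractLeft (e.coord i) y = 0) : killIndices e L y = y := by
  induction L with
  | nil => rfl
  | cons i L ih => simpa [killIndices, hy] using ih

/-- An element of a Clifford algebra annihilated by all contractions is a scalar. -/
theorem eq_algebraMap_of_contractLeft_eq_zero [Fintype ι] [Invertible (2 : F)]
    (e : Module.Basis ι F W) (Q : QuadraticForm F W) (y : CliffordAlgebra Q)
    (hy : ∀ d : Module.Dual F W, contractLeft d y = 0) :
    ∃ r : F, y = algebraMap F _ r := by
  obtain ⟨r, hr⟩ := killIndices_eq_algebraMap e (equivExterior Q y)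
  rw [killIndices_eq_self e _ _ fun i => ?_] at hr
  · refine ⟨r, (equivExterior Q).injective ?_⟩
    rw [hr]
    exact (changeForm_algebraMap changeForm.associated_neg_proof r).symm
  · exact (changeForm_contractLeft changeForm.associated_neg_proof _ y).symm.trans
      (by rw [hy, map_zero])

theorem ι_mul_sub_involute_mul_ι (Q : QuadraticForm F W) (v : W) (y : CliffordAlgebra Q) :
    CliffordAlgebra.ι Q v * y - involute y * CliffordAlgebra.ι Q v =
      contractLeft (QuadraticMap.polarBilin Q v) y := by
  induction y using CliffordAlgebra.left_induction with
  | algebraMap r => simp [Algebra.commutes]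
  | add x y hx hy =>
    rw [map_add, map_add, ← hx, ← hy]; noncomm_ring
  | ι_mul x m hx =>
    rw [contractLeft_ι_mul, ← hx, map_mul, involute_ι]
    have := CliffordAlgebra.ι_mul_ι_add_swap (Q := Q) v m
    rw [QuadraticMap.polarBilin_apply_apply, Algebra.smul_def, ← this]
    noncomm_ring

end Clifford

section Reflections

variable {F W : Type*} [Field F] [AddCommGroup W] [Module F W]

open Classical in
/-- The reflection in a nonisotropic vector (the identity if the vector is isotropic). -/
noncomputable def refl (B : LinearMap.BilinForm F W) (a : W) : W ≃ₗ[F] W :=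
  if h : B a a ≠ 0 then
    Module.reflection (x := a) (f := (2 * (B a a)⁻¹) • B a)
      (by simp only [LinearMap.smul_apply, smul_eq_mul]; field_simp)
  else 1

variable {B : LinearMap.BilinForm F W}

theorem refl_apply {a : W} (h : B a a ≠ 0) (x : W) :
    refl B a x = x - (2 * (B a a)⁻¹ * B a x) • a := by
  simp [refl, h, Module.reflection_apply]

theorem refl_apply_unit {a : W} (h : B a a = 1) (x : W) :
    refl B a x = x - (2 * B a x) • a := by
  rw [refl_apply (by simp [h]), h, inv_one, mul_one]

theorem refl_refl (a x : W) : refl B a (refl B a x) = x := by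
  by_cases h : B a a ≠ 0
  · unfold refl
    rw [dif_pos h]
    exact Module.involutive_reflection (R := F) _ x
  · simp [refl, h]

theorem refl_mul_self (a : W) : refl B a * refl B a = 1 :=
  LinearEquiv.ext fun x => refl_refl a x

theorem refl_inv (a : W) : (refl B a)⁻¹ = refl B a :=
  inv_eq_of_mul_eq_one_left (refl_mul_self a)

theorem refl_smul (a : W) {s : F} (hs : s ≠ 0) : refl B (s • a) = refl B a := by
  by_cases h : B a a = 0
  · simp [refl, h]
  · have h' : B (s • a) (s • a) ≠ 0 := by simp [h, hs]
    ext x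
    rw [refl_apply h', refl_apply h, smul_smul]
    congr 2
    simp only [map_smul, LinearMap.smul_apply, smul_eq_mul]
    field_simp

theorem refl_neg (a : W) : refl B (-a) = refl B a := by
  simpa using refl_smul (B := B) a (s := -1) (by simp)

/-- `g` preserves the bilinear form `B`. -/
def IsIsom (B : LinearMap.BilinForm F W) (g : W ≃ₗ[F] W) : Prop :=
  ∀ x y, B (g x) (g y) = B x y

theorem isIsom_refl (hB : ∀ x y, B x y = B y x) (a : W) : IsIsom B (refl B a) := by
  intro x y
  by_cases h : B a a = 0
  · simp [refl, h]
  · rw [refl_apply h, refl_apply h]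
    simp only [map_sub, map_smul, LinearMap.sub_apply, LinearMap.smul_apply, smul_eq_mul]
    rw [hB x a]
    field_simp
    ring

theorem IsIsom.mul {g h : W ≃ₗ[F] W} (hg : IsIsom B g) (hh : IsIsom B h) : IsIsom B (g * h) :=
  fun x y => (hg _ _).trans (hh x y)

theorem IsIsom.inv {g : W ≃ₗ[F] W} (hg : IsIsom B g) : IsIsom B g⁻¹ := by
  intro x y
  rw [← hg]
  exact congrArg₂ (fun a b => B a b) (g.apply_symm_apply x) (g.apply_symm_apply y)

theorem mul_refl_mul_inv {g : W ≃ₗ[F] W} (hg : IsIsom B g) (a : W) :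
    g * refl B a * g⁻¹ = refl B (g a) := by
  ext x
  change g (refl B a (g.symm x)) = _
  by_cases h : B a a = 0
  · simp [refl, h, hg a a]
  · rw [refl_apply h, refl_apply (by rwa [hg]), map_sub, map_smul, hg]
    have : B (g a) x = B a (g.symm x) := by
      conv_lhs => rw [← g.apply_symm_apply x]
      exact hg _ _
    rw [this, g.apply_symm_apply]

theorem refl_mem_iff {G : Subgroup (W ≃ₗ[F] W)} {g : W ≃ₗ[F] W} (hgG : g ∈ G)
    (hg : IsIsom B g) (a : W) : refl B (g a) ∈ G ↔ refl B a ∈ G := by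
  rw [← mul_refl_mul_inv hg]
  constructor
  · intro h
    have := G.mul_mem (G.mul_mem (G.inv_mem hgG) h) hgG
    simpa [mul_assoc] using this
  · exact fun h => G.mul_mem (G.mul_mem hgG h) (G.inv_mem hgG)

theorem refl_sub_apply (hB : ∀ x y, B x y = B y x) {x w : W} (hxw : B x x = B w w)
    (hd : B (x - w) (x - w) ≠ 0) : refl B (x - w) x = w := by
  have h1 : B (x - w) (x - w) = 2 * B (x - w) x := by
    simp only [map_sub, LinearMap.sub_apply, hB x w, hxw]; ring
  have h2 : 2 * (B (x - w) (x - w))⁻¹ * B (x - w) x = 1 := by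
    rw [mul_right_comm, ← h1, mul_inv_cancel₀ hd]
  rw [refl_apply hd, h2, one_smul, sub_sub_cancel]

open CliffordAlgebra in
/-- The spinor norm obstruction: a reflection which is a product of reflections in unit vectors
is a reflection in a vector of square norm. -/
theorem isSquare_of_refl_mem_closure {κ : Type*} [Fintype κ] [Invertible (2 : F)]
    (e : Module.Basis κ F W) (hB : ∀ x y, B x y = B y x)
    (hnd : ∀ f : Module.Dual F W, ∃ v, ∀ x, B v x = f x)
    {S : Set (W ≃ₗ[F] W)} (hS : ∀ g ∈ S, ∃ a, B a a = 1 ∧ g = refl B a)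
    {d : W} (hd : B d d ≠ 0) (hmem : refl B d ∈ Subgroup.closure S) :
    IsSquare (B d d) := by
  set Q : QuadraticForm F W := LinearMap.BilinMap.toQuadraticMap B with hQ
  have hQa : ∀ a, Q a = B a a := fun a => rfl
  have hpol : ∀ a b, QuadraticMap.polar Q a b = 2 * B a b := by
    intro a b
    simp only [QuadraticMap.polar, hQa, map_add, LinearMap.add_apply, hB b a]; ring
  have hrefl : ∀ a, B a a ≠ 0 → ∀ v, ι Q (refl B a v) * ι Q a = - (ι Q a * ι Q v) := by
    intro a ha v
    have hsw := ι_mul_ι_add_swap (Q := Q) v a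
    rw [hpol, hB v a] at hsw
    rw [eq_neg_iff_add_eq_zero, refl_apply ha, map_sub, map_smul, sub_mul, smul_mul_assoc,
      ι_sq_scalar, hQa, sub_add_eq_add_sub, hsw, Algebra.smul_def, ← map_mul, ← map_sub]
    rw [show 2 * B a v - 2 * (B a a)⁻¹ * B a v * B a a = 0 by field_simp; ring, map_zero]
  have lift : ∀ g ∈ Subgroup.closure S, ∃ z : CliffordAlgebra Q,
      (∀ v, ι Q (g v) * z = involute z * ι Q v) ∧ z * reverse z = 1 ∧ reverse z * z = 1 := by
    intro g hg
    induction hg using Subgroup.closure_induction with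
    | mem g hg =>
      obtain ⟨a, ha, rfl⟩ := hS g hg
      refine ⟨ι Q a, fun v => ?_, ?_, ?_⟩
      · rw [hrefl a (by simp [ha]), involute_ι, neg_mul]
      · rw [reverse_ι, ι_sq_scalar, hQa, ha, map_one]
      · rw [reverse_ι, ι_sq_scalar, hQa, ha, map_one]
    | one => exact ⟨1, fun v => by simp, by simp, by simp⟩
    | mul g h _ _ hg hh =>
      obtain ⟨z, hz, hz1, hz2⟩ := hg
      obtain ⟨y, hy, hy1, hy2⟩ := hh
      refine ⟨z * y, fun v => ?_, ?_, ?_⟩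
      · change ι Q (g (h v)) * _ = _
        rw [← mul_assoc, hz, mul_assoc, hy, map_mul, mul_assoc]
      · rw [reverse.map_mul, mul_assoc, ← mul_assoc y, hy1, one_mul, hz1]
      · rw [reverse.map_mul, mul_assoc, ← mul_assoc _ z, hz2, one_mul, hy2]
    | inv g _ hg =>
      obtain ⟨z, hz, hz1, hz2⟩ := hg
      refine ⟨reverse z, fun v => ?_, by rw [reverse_reverse, hz2], by rw [reverse_reverse, hz1]⟩
      have h1 := hz (g⁻¹ v)
      have h2 : g (g⁻¹ v) = v := g.apply_symm_apply v
      have h3 : involute (reverse z) * involute z = 1 := by rw [← map_mul, hz2, map_one]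
      rw [h2] at h1
      calc _ = involute (reverse z) * (involute z * ι Q (g⁻¹ v)) * reverse z := by
              rw [← mul_assoc, h3, one_mul]
        _ = involute (reverse z) * ι Q v * (z * reverse z) := by rw [← h1]; noncomm_ring
        _ = _ := by rw [hz1, mul_one]
  obtain ⟨z, hz, hz1, hz2⟩ := lift _ hmem
  obtain ⟨r, hr⟩ := eq_algebraMap_of_contractLeft_eq_zero e Q (ι Q d * z) (by
    intro f
    obtain ⟨v, hv⟩ := hnd f
    have hf : f = QuadraticMap.polarBilin Q ((⅟2 : F) • v) := by
      ext x
      rw [QuadraticMap.polarBilin_apply_apply, hpol, map_smul, LinearMap.smul_apply, smul_eq_mul,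
        mul_invOf_cancel_left', hv]
    have h1 := hrefl d hd (refl B d ((⅟2 : F) • v))
    rw [refl_refl] at h1
    rw [hf, ← ι_mul_sub_involute_mul_ι, ← mul_assoc, h1, map_mul, involute_ι, neg_mul, mul_assoc,
      hz, neg_mul, neg_mul, mul_assoc, sub_self])
  refine ⟨r, (algebraMap F (CliffordAlgebra Q)).injective ?_⟩
  have h1 : reverse (ι Q d * z) = algebraMap F _ r := by rw [hr, reverse.commutes]
  rw [map_mul]
  nth_rewrite 1 [← h1]
  rw [← hr, reverse.map_mul, reverse_ι, mul_assoc, ← mul_assoc _ _ z, ι_sq_scalar, ← mul_assoc,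
    ← Algebra.commutes, mul_assoc, hz2, mul_one]
  rfl

end Reflections

section StringIntersection

variable {G : Type*} [Group G] {n : ℕ}

/-- The set of indices `i` with `s ≤ i < t`. -/
def idx (n s t : ℕ) : Set (Fin n) := {i | s ≤ (i : ℕ) ∧ (i : ℕ) < t}

theorem idx_mono {s t s' t' : ℕ} (hs : s' ≤ s) (ht : t ≤ t') : idx n s t ⊆ idx n s' t' :=
  fun _ hi => ⟨hs.trans hi.1, hi.2.trans_le ht⟩

theorem closure_image_mono (ρ : Fin n → G) {I J : Set (Fin n)} (h : I ⊆ J) :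
    Subgroup.closure (ρ '' I) ≤ Subgroup.closure (ρ '' J) :=
  Subgroup.closure_mono (Set.image_mono h)

theorem mem_closure_image_of_subset {ρ : Fin n → G} {I J : Set (Fin n)} {x : G}
    (hx : x ∈ Subgroup.closure (ρ '' I)) (h : ∀ a ∈ I, a ∈ J) :
    x ∈ Subgroup.closure (ρ '' J) :=
  closure_image_mono ρ h hx

theorem commute_of_mem_closure {S T : Set G} (h : ∀ a ∈ S, ∀ b ∈ T, Commute a b) {x y : G}
    (hx : x ∈ Subgroup.closure S) (hy : y ∈ Subgroup.closure T) : Commute x y := by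
  induction hx using Subgroup.closure_induction with
  | mem a ha =>
    induction hy using Subgroup.closure_induction with
    | mem b hb => exact h a ha b hb
    | one => exact Commute.one_right _
    | mul b c _ _ hb hc => exact hb.mul_right hc
    | inv b _ hb => exact hb.inv_right
  | one => exact Commute.one_left _
  | mul b c _ _ hb hc => exact hb.mul_left hc
  | inv b _ hb => exact hb.inv_left

theorem exists_mul_of_mem_closure_union {S T : Set G} (h : ∀ a ∈ S, ∀ b ∈ T, Commute a b) {g : G}
    (hg : g ∈ Subgroup.closure (S ∪ T)) :
    ∃ x ∈ Subgroup.closure S, ∃ y ∈ Subgroup.closure T, g = x * y := by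
  induction hg using Subgroup.closure_induction with
  | mem a ha =>
    rcases ha with ha | ha
    · exact ⟨a, Subgroup.subset_closure ha, 1, one_mem _, (mul_one a).symm⟩
    · exact ⟨1, one_mem _, a, Subgroup.subset_closure ha, (one_mul a).symm⟩
  | one => exact ⟨1, one_mem _, 1, one_mem _, (mul_one 1).symm⟩
  | mul a b _ _ ha hb =>
    obtain ⟨x, hx, y, hy, rfl⟩ := ha
    obtain ⟨x', hx', y', hy', rfl⟩ := hb
    refine ⟨x * x', mul_mem hx hx', y * y', mul_mem hy hy', ?_⟩
    rw [mul_assoc, ← mul_assoc y, ← (commute_of_mem_closure h hx' hy).eq]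
    group
  | inv a _ ha =>
    obtain ⟨x, hx, y, hy, rfl⟩ := ha
    refine ⟨x⁻¹, inv_mem hx, y⁻¹, inv_mem hy, ?_⟩
    rw [(commute_of_mem_closure h hx hy).eq, mul_inv_rev]

variable {ρ : Fin n → G}

theorem exists_mul_of_notMem (hc : ∀ i j : Fin n, (i : ℕ) + 2 ≤ j → Commute (ρ i) (ρ j))
    {I : Set (Fin n)} {i : Fin n} (hi : i ∉ I) {g : G} (hg : g ∈ Subgroup.closure (ρ '' I)) :
    ∃ x ∈ Subgroup.closure (ρ '' (I ∩ {j | j < i})),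
      ∃ y ∈ Subgroup.closure (ρ '' (I ∩ {j | i < j})), g = x * y := by
  apply exists_mul_of_mem_closure_union
  · rintro _ ⟨a, ha, rfl⟩ _ ⟨b, hb, rfl⟩
    apply hc
    have h1 : (a : ℕ) < i := ha.2
    have h2 : (i : ℕ) < b := hb.2
    omega
  · rw [← Set.image_union, ← Set.inter_union_distrib_left]
    refine mem_closure_image_of_subset hg fun j hj => ⟨hj, ?_⟩
    exact lt_or_gt_of_ne (a := j) (b := i) fun h => hi (h ▸ hj)

theorem closure_idx_inf_le
    (H : ∀ s t, Subgroup.closure (ρ '' idx n s t) ⊓ Subgroup.closure (ρ '' idx n (s + 1) (t + 1)) ≤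
      Subgroup.closure (ρ '' idx n (s + 1) t)) (a b e d : ℕ) :
    Subgroup.closure (ρ '' idx n a b) ⊓ Subgroup.closure (ρ '' idx n (a + e) d) ≤
      Subgroup.closure (ρ '' idx n (a + e) b) := by
  have h1 : ∀ a e, Subgroup.closure (ρ '' idx n a b) ⊓
      Subgroup.closure (ρ '' idx n (a + 1) (b + e)) ≤ Subgroup.closure (ρ '' idx n (a + 1) b) := by
    intro a e
    induction e with
    | zero => exact inf_le_right
    | succ e ih =>
      intro g hg
      exact ih ⟨hg.1, H a (b + e)
        ⟨closure_image_mono ρ (idx_mono le_rfl (Nat.le_add_right b e)) hg.1, hg.2⟩⟩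
  induction e with
  | zero => exact inf_le_left
  | succ e ih =>
    intro g hg
    rcases le_total b d with hbd | hbd
    · obtain ⟨f, rfl⟩ := Nat.exists_eq_add_of_le hbd
      exact h1 _ f ⟨ih ⟨hg.1, closure_image_mono ρ (idx_mono (Nat.le_succ _) le_rfl) hg.2⟩, hg.2⟩
    · exact closure_image_mono ρ (idx_mono le_rfl hbd) hg.2

theorem closure_inf_closure_le_of_idx
    (hc : ∀ i j : Fin n, (i : ℕ) + 2 ≤ j → Commute (ρ i) (ρ j))
    (H : ∀ s t, Subgroup.closure (ρ '' idx n s t) ⊓ Subgroup.closure (ρ '' idx n (s + 1) (t + 1)) ≤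
      Subgroup.closure (ρ '' idx n (s + 1) t)) (d s t : ℕ) (hd : t ≤ s + d) (I J : Set (Fin n))
    (hI : I ⊆ idx n s t) (hJ : J ⊆ idx n s t) :
    Subgroup.closure (ρ '' I) ⊓ Subgroup.closure (ρ '' J) ≤ Subgroup.closure (ρ '' (I ∩ J)) := by
  induction d generalizing s t I J with
  | zero =>
    have : I = ∅ := by
      ext i
      simp only [Set.mem_empty_iff_false, iff_false]
      intro hi
      have := hI hi
      simp only [idx, Set.mem_ofPred_eq] at this
      omega
    subst this
    simp
  | succ d ih =>
    by_cases hI' : idx n s t ⊆ I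
    · intro g hg
      rw [Set.inter_eq_right.2 (hJ.trans hI')]
      exact hg.2
    by_cases hJ' : idx n s t ⊆ J
    · intro g hg
      rw [Set.inter_eq_left.2 (hI.trans hJ')]
      exact hg.1
    obtain ⟨i, hi, hiI⟩ := Set.not_subset.1 hI'
    obtain ⟨j, hj, hjJ⟩ := Set.not_subset.1 hJ'
    clear hI' hJ'
    wlog hij : i ≤ j generalizing I J i j
    · rw [inf_comm, Set.inter_comm]
      exact this J I hJ hI j hj hjJ i hi hiI (le_of_not_ge hij)
    rintro g ⟨hgI, hgJ⟩
    obtain ⟨x, hx, y, hy, rfl⟩ := exists_mul_of_notMem hc hiI hgI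
    obtain ⟨u, hu, v, hv, huv⟩ := exists_mul_of_notMem hc hjJ hgJ
    have hij' : (i : ℕ) ≤ j := hij
    have his : s ≤ (i : ℕ) := hi.1
    have hjt : (j : ℕ) < t := hj.2
    have hx' : x ∈ Subgroup.closure (ρ '' idx n s i) :=
      mem_closure_image_of_subset hx (fun a ha => ⟨(hI ha.1).1, ha.2⟩)
    have hu' : u ∈ Subgroup.closure (ρ '' idx n s j) :=
      mem_closure_image_of_subset hu (fun a ha => ⟨(hJ ha.1).1, ha.2⟩)
    have hy' : y ∈ Subgroup.closure (ρ '' idx n (i + 1) t) :=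
      mem_closure_image_of_subset hy (fun a ha => ⟨ha.2, (hI ha.1).2⟩)
    have hv' : v ∈ Subgroup.closure (ρ '' idx n (i + 1) t) :=
      mem_closure_image_of_subset hv (fun a ha => ⟨lt_of_le_of_lt hij' ha.2, (hJ ha.1).2⟩)
    have hh : u⁻¹ * x = v * y⁻¹ := by
      rw [inv_mul_eq_iff_eq_mul, ← mul_assoc, ← huv, mul_inv_cancel_right]
    have hhm : u⁻¹ * x ∈ Subgroup.closure (ρ '' idx n (i + 1) j) := by
      have h1 : u⁻¹ * x ∈ Subgroup.closure (ρ '' idx n s j) :=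
        mul_mem (inv_mem hu') (closure_image_mono ρ (idx_mono le_rfl hij') hx')
      have h2 : u⁻¹ * x ∈ Subgroup.closure (ρ '' idx n (i + 1) t) :=
        hh ▸ mul_mem hv' (inv_mem hy')
      have h3 := closure_idx_inf_le H s j (i + 1 - s) t
      rw [Nat.add_sub_cancel' (by omega)] at h3
      exact h3 ⟨h1, h2⟩
    have hu2 : u ∈ Subgroup.closure (ρ '' (idx n s j \ {i})) := by
      have h1 : u = x * (u⁻¹ * x)⁻¹ := by group
      rw [h1]
      refine mul_mem (closure_image_mono ρ ?_ hx') (inv_mem (closure_image_mono ρ ?_ hhm))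
      · intro a ha
        refine ⟨idx_mono le_rfl hij' ha, ?_⟩
        rintro rfl
        exact lt_irrefl _ ha.2
      · intro a ha
        refine ⟨idx_mono (by omega) le_rfl ha, ?_⟩
        rintro rfl
        exact absurd ha.1 (by omega)
    have hu3 := ih s j (by omega) _ _ Set.sdiff_subset
      (fun a ha => ⟨(hJ ha.1).1, ha.2⟩) ⟨hu2, hu⟩
    obtain ⟨u₁, hu₁, u₂, hu₂, rfl⟩ := exists_mul_of_notMem hc (i := i)
      (fun h => h.1.2 rfl) hu3
    have hu₁' : u₁ ∈ Subgroup.closure (ρ '' (J ∩ {a | a < i})) :=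
      mem_closure_image_of_subset hu₁ (fun a ha => ⟨ha.1.2.1, ha.2⟩)
    have hu₂' : u₂ ∈ Subgroup.closure (ρ '' (J ∩ {a | i < a})) :=
      mem_closure_image_of_subset hu₂ (fun a ha => ⟨ha.1.2.1, ha.2⟩)
    have hxu : x = u₁ := by
      have h1 : u₁⁻¹ * x ∈ Subgroup.closure (ρ '' idx n s i) := by
        refine mul_mem (inv_mem (mem_closure_image_of_subset hu₁ fun a ha => ?_)) hx'
        exact ⟨ha.1.1.1.1, ha.2⟩
      have h2 : u₁⁻¹ * x ∈ Subgroup.closure (ρ '' idx n (i + 1) j) := by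
        have : u₁⁻¹ * x = u₂ * ((u₁ * u₂)⁻¹ * x) := by group
        rw [this]
        refine mul_mem (mem_closure_image_of_subset hu₂ fun a ha => ?_) hhm
        exact ⟨ha.2, ha.1.1.1.2⟩
      have h3 := closure_idx_inf_le H s i (i + 1 - s) j
      rw [Nat.add_sub_cancel' (by omega)] at h3
      have h4 := h3 ⟨h1, h2⟩
      have h5 : idx n ((i : ℕ) + 1) i = ∅ := by
        ext a
        simp only [idx, Set.mem_ofPred_eq, Set.mem_empty_iff_false, iff_false]
        omega
      rw [h5, Set.image_empty, Subgroup.closure_empty, Subgroup.mem_bot, inv_mul_eq_one] at h4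
      exact h4.symm
    subst hxu
    have hyv : y = u₂ * v := mul_left_cancel (huv.trans (mul_assoc x u₂ v))
    have hxf := ih s i (by omega) _ _ (fun a ha => ⟨(hI ha.1).1, ha.2⟩)
      (fun a ha => ⟨(hJ ha.1).1, ha.2⟩) ⟨hx, hu₁'⟩
    have hyJ : y ∈ Subgroup.closure (ρ '' (J ∩ {a | i < a})) := by
      rw [hyv]
      refine mul_mem hu₂' (mem_closure_image_of_subset hv
        (fun a ha => ⟨ha.1, lt_of_le_of_lt hij ha.2⟩))
    have hyf := ih (i + 1) t (by omega) _ _ (fun a ha => ⟨ha.2, (hI ha.1).2⟩)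
      (fun a ha => ⟨ha.2, (hJ ha.1).2⟩) ⟨hy, hyJ⟩
    exact mul_mem (mem_closure_image_of_subset hxf (fun a ha => ⟨ha.1.1, ha.2.1⟩))
      (mem_closure_image_of_subset hyf (fun a ha => ⟨ha.1.1, ha.2.1⟩))

theorem closure_inf_closure_of_idx
    (hc : ∀ i j : Fin n, (i : ℕ) + 2 ≤ j → Commute (ρ i) (ρ j))
    (H : ∀ s t, Subgroup.closure (ρ '' idx n s t) ⊓ Subgroup.closure (ρ '' idx n (s + 1) (t + 1)) ≤
      Subgroup.closure (ρ '' idx n (s + 1) t)) (I J : Set (Fin n)) :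
    Subgroup.closure (ρ '' I) ⊓ Subgroup.closure (ρ '' J) = Subgroup.closure (ρ '' (I ∩ J)) :=
  le_antisymm
    (closure_inf_closure_le_of_idx hc H n 0 n (by omega) I J
      (fun i _ => ⟨Nat.zero_le _, i.2⟩) (fun i _ => ⟨Nat.zero_le _, i.2⟩))
    (le_inf (closure_image_mono ρ Set.inter_subset_left)
      (closure_image_mono ρ Set.inter_subset_right))

end StringIntersection

section Transvections

variable {p : ℕ} [Fact p.Prime] {W : Type*} [AddCommGroup W] [Module (ZMod p) W]
variable {B : LinearMap.BilinForm (ZMod p) W} {G : Subgroup (W ≃ₗ[ZMod p] W)}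

/-- All reflections in unit vectors of the subspace `U` belong to `G`. -/
def ReflectsIn (B : LinearMap.BilinForm (ZMod p) W) (G : Subgroup (W ≃ₗ[ZMod p] W))
    (U : Submodule (ZMod p) W) : Prop :=
  ∀ a ∈ U, B a a = 1 → refl B a ∈ G

/-- Modulo the line spanned by `c`, the group `G` contains all multiples of the transvection
`x ↦ x + (x·c) v`. -/
def HasTransvection (B : LinearMap.BilinForm (ZMod p) W) (G : Subgroup (W ≃ₗ[ZMod p] W))
    (c v : W) : Prop :=
  ∀ μ : ZMod p, ∃ g ∈ G, ∀ x, ∃ κ : ZMod p, g x = x + (μ * B c x) • v + κ • c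

theorem hasTransvection_of_mem {u : W ≃ₗ[ZMod p] W} (hu : u ∈ G) {c v : W} (hc : B c c = 0)
    (hcv : B c v = 0) (h : ∀ x, ∃ κ : ZMod p, u x = x + (B c x) • v + κ • c) :
    HasTransvection B G c v := by
  have key : ∀ m : ℕ, ∀ x, ∃ κ : ZMod p, (u ^ m) x = x + (m * B c x) • v + κ • c := by
    intro m
    induction m with
    | zero => exact fun x => ⟨0, by simp⟩
    | succ m ih =>
      intro x
      obtain ⟨κ, hκ⟩ := ih x
      obtain ⟨κ', hκ'⟩ := h ((u ^ m) x)
      refine ⟨κ + κ', ?_⟩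
      rw [pow_succ']
      change u ((u ^ m) x) = _
      have h1 : B c ((u ^ m) x) = B c x := by
        rw [hκ]; simp [hc, hcv]
      rw [hκ', h1, hκ]
      push_cast
      module
  intro μ
  refine ⟨u ^ μ.val, pow_mem hu _, fun x => ?_⟩
  simpa using key μ.val x

theorem HasTransvection.of_smul {c v : W} {s : ZMod p} (hs : s ≠ 0)
    (h : HasTransvection B G c (s • v)) : HasTransvection B G c v := by
  intro μ
  obtain ⟨g, hg, hx⟩ := h (μ * s⁻¹)
  refine ⟨g, hg, fun x => ?_⟩
  obtain ⟨κ, hκ⟩ := hx x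
  refine ⟨κ, ?_⟩
  rw [hκ, smul_smul]
  congr 3
  field_simp

theorem refl_add_smul_mem {a b : W} (hB : ∀ x y, B x y = B y x)
    (hG : ∀ g ∈ G, IsIsom B g) (ha : B a a = 1) (hb : B b b = 1) (hab : B a b = -1)
    (h2 : (2 : ZMod p) ≠ 0) (hra : refl B a ∈ G) (hrb : refl B b ∈ G) (r : ZMod p) :
    refl B (a + r • (a + b)) ∈ G := by
  have hba : B b a = -1 := by rw [hB, hab]
  set u := refl B b * refl B a with hu
  have huG : u ∈ G := mul_mem hrb hra
  have hux : ∀ x, u x = refl B b (refl B a x) := fun x => rfl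
  have key : ∀ m : ℕ, (u ^ m) a = a - (2 * m : ZMod p) • (a + b) := by
    intro m
    induction m with
    | zero => simp
    | succ m ih =>
      rw [pow_succ']
      change u ((u ^ m) a) = _
      rw [ih, hux, refl_apply_unit ha, refl_apply_unit hb]
      simp only [map_sub, map_smul, map_add, ha, hb, hab, hba, smul_eq_mul]
      push_cast
      module
  have h1 := key (-(r * 2⁻¹)).val
  have h3 : a - (2 * ((-(r * 2⁻¹)).val : ℕ) : ZMod p) • (a + b) = a + r • (a + b) := by
    rw [ZMod.natCast_zmod_val, sub_eq_add_neg, ← neg_smul]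
    congr 2
    field_simp
  rw [h3] at h1
  rw [← h1]
  exact (refl_mem_iff (pow_mem huG _) (hG _ (pow_mem huG _)) a).2 hra

theorem refl_mem_of_pair {a b : W} (hB : ∀ x y, B x y = B y x)
    (hG : ∀ g ∈ G, IsIsom B g) (ha : B a a = 1) (hb : B b b = 1) (hab : B a b = -1)
    (h2 : (2 : ZMod p) ≠ 0) (hra : refl B a ∈ G) (hrb : refl B b ∈ G) (r s : ZMod p)
    (he : B (r • a + s • b) (r • a + s • b) = 1) :
    refl B (r • a + s • b) ∈ G := by
  have hba : B b a = -1 := by rw [hB, hab]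
  have h1 : (r - s) * (r - s) = 1 := by
    simp only [map_smul, map_add, LinearMap.add_apply, LinearMap.smul_apply, ha, hb, hab, hba,
      smul_eq_mul] at he
    linear_combination he
  rcases mul_self_eq_one_iff.1 h1 with h | h
  · have : r • a + s • b = a + s • (a + b) := by
      rw [sub_eq_iff_eq_add.1 h]; module
    rw [this]
    exact refl_add_smul_mem hB hG ha hb hab h2 hra hrb s
  · have : r • a + s • b = -(a + (-s) • (a + b)) := by
      rw [sub_eq_iff_eq_add.1 h]; module
    rw [this, refl_neg]
    exact refl_add_smul_mem hB hG ha hb hab h2 hra hrb _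

theorem refl_mem_of_triple {a b t : W} (hB : ∀ x y, B x y = B y x)
    (hG : ∀ g ∈ G, IsIsom B g) (ha : B a a = 1) (hb : B b b = 1) (ht : B t t = 1)
    (hab : B a b = -1) (hat : B a t = 0) (hbt : B b t ≠ 0)
    (h2 : (2 : ZMod p) ≠ 0) (hra : refl B a ∈ G) (hrb : refl B b ∈ G) (hrt : refl B t ∈ G)
    (α β γ : ZMod p)
    (he : B (α • a + β • b + γ • t) (α • a + β • b + γ • t) = 1) :
    refl B (α • a + β • b + γ • t) ∈ G := by
  have hba : B b a = -1 := by rw [hB, hab]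
  have hta : B t a = 0 := by rw [hB, hat]
  set τ := B b t with hτ
  have htb : B t b = τ := by rw [hB]
  by_cases hγ : γ = 0
  · rw [hγ, zero_smul, add_zero] at he ⊢
    exact refl_mem_of_pair hB hG ha hb hab h2 hra hrb α β he
  set c := b + a with hc
  have hcc : B c c = 0 := by simp [hc, ha, hb, hab, hba]
  have hcb : B c b = 0 := by simp [hc, hb, hab]
  have hbc : B b c = 0 := by rw [hB, hcb]
  have hct : B c t = τ := by simp [hc, hat, hτ]
  have hline := refl_add_smul_mem hB hG hb ha hba h2 hrb hra
  obtain ⟨r, hr⟩ : ∃ r : ZMod p, -2 * τ * (1 + r) = γ :=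
    ⟨-γ / (2 * τ) - 1, by field_simp; ring⟩
  have hd : refl B t (b + r • c) = b + r • c + γ • t := by
    rw [refl_apply_unit ht, ← hr]
    simp only [map_add, map_smul, htb, hB t c, hct, smul_eq_mul]
    module
  have hrd : refl B (b + r • c + γ • t) ∈ G := by
    rw [← hd, refl_mem_iff hrt (hG _ hrt)]
    exact hline r
  have hu1 : B (b + (1 : ZMod p) • c) (b + (1 : ZMod p) • c) = 1 := by
    simp [hb, hcc, hbc, hcb]
  have htrans : HasTransvection B G c ((2 : ZMod p) • b) := by
    refine hasTransvection_of_mem (mul_mem hrb (hline 1)) hcc (by simp [hcb]) fun x =>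
      ⟨-2 * (B b x + B c x), ?_⟩
    change refl B b (refl B _ x) = _
    rw [refl_apply_unit hb, refl_apply_unit hu1]
    simp only [map_sub, map_smul, map_add, LinearMap.add_apply, LinearMap.smul_apply, hb, hbc,
      smul_eq_mul]
    module
  obtain ⟨g, hg, hgx⟩ := htrans ((β - α - 1) / (2 * (γ * τ)))
  obtain ⟨κ, hκ⟩ := hgx (b + r • c + γ • t)
  have h3 : g (b + r • c + γ • t) = (r + κ) • c + (β - α) • b + γ • t := by
    rw [hκ]
    simp only [map_add, map_smul, hcb, hcc, hct, smul_eq_mul]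
    have : (β - α - 1) / (2 * (γ * τ)) * (0 + r * 0 + γ * τ) = (β - α - 1) / 2 := by
      field_simp; ring
    rw [this, smul_smul, div_mul_cancel₀ _ h2]
    module
  have h4 : α • a + β • b + γ • t = α • c + (β - α) • b + γ • t := by
    rw [hc]; module
  have h5 : B (b + r • c + γ • t) (b + r • c + γ • t) = 1 := by
    rw [← hd, hG _ hrt]
    simp [hb, hcc, hbc, hcb]
  rw [← hG g hg, h3] at h5
  rw [h4] at he ⊢
  have h6 : r + κ = α := by
    simp only [map_smul, map_add, LinearMap.add_apply, LinearMap.smul_apply, hb, hcc, hcb, hbc,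
      hct, hB t c, htb, ← hτ, ht, smul_eq_mul] at he h5
    have h7 : (2 * (γ * τ)) * (r + κ) = (2 * (γ * τ)) * α := by linear_combination h5 - he
    exact mul_left_cancel₀ (by simp [h2, hγ, hbt]) h7
  rw [h6] at h3
  rw [← h3, refl_mem_iff hg (hG g hg)]
  exact hrd

theorem exists_unit_of_isotropic {c x z : W} (hB : ∀ x y, B x y = B y x) (h2 : (2 : ZMod p) ≠ 0)
    (hc : B c c = 0) (hcx : B c x ≠ 0) (hcz : B c z = 0) (hzx : B z x ≠ 0) :
    ∃ r s : ZMod p, B (r • x + s • c) (r • x + s • c) = 1 ∧ B c (r • x + s • c) ≠ 0 ∧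
      B z (r • x + s • c) ≠ 0 := by
  have hxc : B x c = B c x := hB _ _
  have hzc : B z c = 0 := by rw [hB, hcz]
  refine ⟨(2 * B c x)⁻¹, 1 - B x x / (4 * B c x ^ 2), ?_, ?_, ?_⟩
  · simp only [map_smul, map_add, LinearMap.add_apply, LinearMap.smul_apply, hxc, hc, smul_eq_mul]
    have h4 : (4 : ZMod p) ≠ 0 := by
      have : (4 : ZMod p) = 2 * 2 := by norm_num
      rw [this]; exact mul_ne_zero h2 h2
    field_simp
    ring
  · simp [hc, hcx, h2]
  · simp [hzc, hzx, hcx, h2]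

theorem mem_sup_span_singleton {U : Submodule (ZMod p) W} {v x : W}
    (hx : x ∈ U ⊔ Submodule.span (ZMod p) {v}) : ∃ h ∈ U, ∃ γ : ZMod p, x = h + γ • v := by
  obtain ⟨h, hh, y, hy, rfl⟩ := Submodule.mem_sup.1 hx
  obtain ⟨γ, rfl⟩ := Submodule.mem_span_singleton.1 hy
  exact ⟨h, hh, γ, rfl⟩

theorem ReflectsIn.sup_span {U : Submodule (ZMod p) W} (hB : ∀ x y, B x y = B y x)
    (hG : ∀ g ∈ G, IsIsom B g) (h2 : (2 : ZMod p) ≠ 0) (hU : ReflectsIn B G U) {c y v : W}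
    (hcU : c ∈ U) (hyU : y ∈ U) (hc : B c c = 0) (hcy : B c y ≠ 0)
    (hT : HasTransvection B G c v) :
    ReflectsIn B G (U ⊔ Submodule.span (ZMod p) {v}) := by
  have h1 : ∀ a ∈ U ⊔ Submodule.span (ZMod p) {v}, B a a = 1 → B c a ≠ 0 → refl B a ∈ G := by
    intro a ha haa hca
    obtain ⟨h, hh, γ, rfl⟩ := mem_sup_span_singleton ha
    obtain ⟨g, hg, hgx⟩ := hT (-γ / B c (h + γ • v))
    obtain ⟨κ, hκ⟩ := hgx (h + γ • v)
    rw [div_mul_cancel₀ _ hca] at hκ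
    have h3 : g (h + γ • v) = h + κ • c := by rw [hκ]; module
    rw [← refl_mem_iff hg (hG g hg), h3]
    refine hU _ (U.add_mem hh (U.smul_mem _ hcU)) ?_
    rw [← h3, hG g hg, haa]
  intro a ha haa
  by_cases hca : B c a = 0
  swap
  · exact h1 a ha haa hca
  have hac : B a c = 0 := by rw [hB, hca]
  have hle : U ≤ U ⊔ Submodule.span (ZMod p) {v} := le_sup_left
  obtain ⟨x, hx, hcx, hax⟩ : ∃ x ∈ U ⊔ Submodule.span (ZMod p) {v}, B c x ≠ 0 ∧ B a x ≠ 0 := by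
    by_cases hay : B a y = 0
    · exact ⟨y + a, Submodule.add_mem _ (hle hyU) ha, by simpa [hca] using hcy, by simp [hay, haa]⟩
    · exact ⟨y, hle hyU, hcy, hay⟩
  obtain ⟨r, s, hh, hch, hah⟩ := exists_unit_of_isotropic hB h2 hc hcx hca hax
  set h := r • x + s • c with hh_def
  have hhU : h ∈ U ⊔ Submodule.span (ZMod p) {v} :=
    Submodule.add_mem _ (Submodule.smul_mem _ _ hx) (Submodule.smul_mem _ _ (hle hcU))
  have hhG := h1 h hhU hh hch
  rw [← refl_mem_iff hhG (hG _ hhG)]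
  refine h1 _ ?_ (by rw [hG _ hhG, haa]) ?_
  · rw [refl_apply_unit hh]
    exact Submodule.sub_mem _ ha (Submodule.smul_mem _ _ hhU)
  · rw [refl_apply_unit hh, hB h a]
    simp [hca, hch, hah, h2]

theorem hasTransvection_sub {c c₁ c₂ : W} (hB : ∀ x y, B x y = B y x) (h2 : (2 : ZMod p) ≠ 0)
    (h3 : (3 : ZMod p) ≠ 0) (hc : B c c = 0) (hc₁ : B c₁ c₁ = 0) (hc₂ : B c₂ c₂ = 0)
    (hcc₁ : B c c₁ = 1) (hcc₂ : B c c₂ = 1)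
    (h₁ : ∀ s : ZMod p, s ≠ 0 → refl B (s • c + (2 * s)⁻¹ • c₁) ∈ G)
    (h₂ : ∀ s : ZMod p, s ≠ 0 → refl B (s • c + (2 * s)⁻¹ • c₂) ∈ G) :
    HasTransvection B G c (c₂ - c₁) := by
  have h4 : (4 : ZMod p) ≠ 0 := by
    have : (4 : ZMod p) = 2 * 2 := by norm_num
    rw [this]; exact mul_ne_zero h2 h2
  have key : ∀ d : W, B d d = 0 → B c d = 1 → ∀ s : ZMod p, s ≠ 0 → ∀ x,
      refl B (s • c + (2 * s)⁻¹ • d) x =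
        x - (2 * s ^ 2 * B c x + B d x) • c - (B c x + (2 * s ^ 2)⁻¹ * B d x) • d := by
    intro d hd hcd s hs x
    rw [refl_apply_unit]
    · simp only [map_add, map_smul, LinearMap.add_apply, LinearMap.smul_apply, smul_eq_mul]
      match_scalars <;> field_simp
    · simp only [map_add, map_smul, LinearMap.add_apply, LinearMap.smul_apply, smul_eq_mul, hc, hd,
        hcd, hB d c]
      field_simp
      ring
  apply HasTransvection.of_smul h3
  refine hasTransvection_of_mem (mul_mem (mul_mem (h₁ 2 h2) (h₁ 1 one_ne_zero))
    (mul_mem (h₂ 1 one_ne_zero) (h₂ 2 h2))) hc (by simp [hcc₁, hcc₂]) fun x => ?_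
  have hcx₁ : B c₁ c = 1 := by rw [hB, hcc₁]
  have hcx₂ : B c₂ c = 1 := by rw [hB, hcc₂]
  set y := refl B ((1 : ZMod p) • c + (2 * 1 : ZMod p)⁻¹ • c₂)
    (refl B ((2 : ZMod p) • c + (2 * 2 : ZMod p)⁻¹ • c₂) x) with hy
  have hy' : y = x + (3 * B c x) • c₂ - (3 / 4 * B c₂ x) • c := by
    rw [hy, key c₂ hc₂ hcc₂ 2 h2, key c₂ hc₂ hcc₂ 1 one_ne_zero]
    simp only [map_sub, map_smul, smul_eq_mul, hc, hc₂, hcc₂, hcx₂]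
    match_scalars <;> field_simp <;> ring
  refine ⟨3 * B c₁ y - 3 / 4 * B c₂ x, ?_⟩
  change refl B ((2 : ZMod p) • c + (2 * 2 : ZMod p)⁻¹ • c₁)
    (refl B ((1 : ZMod p) • c + (2 * 1 : ZMod p)⁻¹ • c₁) y) = _
  have h5 : refl B ((2 : ZMod p) • c + (2 * 2 : ZMod p)⁻¹ • c₁)
    (refl B ((1 : ZMod p) • c + (2 * 1 : ZMod p)⁻¹ • c₁) y) =
      y - (3 / 4 * B c y) • c₁ + (3 * B c₁ y) • c := by
    rw [key c₁ hc₁ hcc₁ 1 one_ne_zero, key c₁ hc₁ hcc₁ 2 h2]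
    simp only [map_sub, map_smul, smul_eq_mul, hc, hc₁, hcc₁, hcx₁]
    match_scalars <;> field_simp <;> ring
  have h6 : B c y = 4 * B c x := by
    rw [hy']
    simp only [map_sub, map_add, map_smul, smul_eq_mul, hc, hcc₂]
    ring
  rw [h5, h6, hy']
  match_scalars <;> field_simp
  ring

theorem ReflectsIn.sup_span_unit {U : Submodule (ZMod p) W} (hB : ∀ x y, B x y = B y x)
    (hG : ∀ g ∈ G, IsIsom B g) (h2 : (2 : ZMod p) ≠ 0) (h3 : (3 : ZMod p) ≠ 0)
    (hU : ReflectsIn B G U) {c y b : W}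
    (hcU : c ∈ U) (hyU : y ∈ U) (hc : B c c = 0) (hcy : B c y ≠ 0) (hb : B b b = 1)
    (hcb : B c b = 0) (hby : B b y ≠ 0) (hbG : refl B b ∈ G) :
    ReflectsIn B G (U ⊔ Submodule.span (ZMod p) {b}) := by
  refine hU.sup_span hB hG h2 hcU hyU hc hcy ?_
  have hyc : B y c = B c y := hB _ _
  have hbc : B b c = 0 := by rw [hB, hcb]
  set d := (B c y)⁻¹ • y - (B y y / (2 * B c y ^ 2)) • c with hd
  have hdU : d ∈ U := U.sub_mem (U.smul_mem _ hyU) (U.smul_mem _ hcU)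
  have hdd : B d d = 0 := by
    simp only [hd, map_sub, map_smul, LinearMap.sub_apply, LinearMap.smul_apply, smul_eq_mul, hc,
      hyc]
    field_simp
    ring
  have hcd : B c d = 1 := by simp [hd, hc, hcy]
  have hbd : B b d = (B c y)⁻¹ * B b y := by simp [hd, hbc]
  have hI := hG _ hbG
  have hbrc : refl B b c = c := by rw [refl_apply_unit hb]; simp [hbc]
  have h₁ : ∀ s : ZMod p, s ≠ 0 → refl B (s • c + (2 * s)⁻¹ • d) ∈ G := by
    intro s hs
    refine hU _ (U.add_mem (U.smul_mem _ hcU) (U.smul_mem _ hdU)) ?_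
    simp only [map_add, map_smul, LinearMap.add_apply, LinearMap.smul_apply, smul_eq_mul, hc, hdd,
        hcd, hB d c]
    field_simp
    ring
  have := hasTransvection_sub (G := G) (c₂ := refl B b d) hB h2 h3 hc hdd (by rw [hI, hdd]) hcd
    (by nth_rewrite 1 [← hbrc]; rw [hI, hcd]) h₁ (by
      intro s hs
      have : s • c + (2 * s)⁻¹ • refl B b d = refl B b (s • c + (2 * s)⁻¹ • d) := by
        rw [map_add, map_smul, map_smul, hbrc]
      rw [this, refl_mem_iff hbG hI]
      exact h₁ s hs)
  rw [refl_apply_unit hb, hbd, sub_sub_cancel_left, ← neg_smul] at this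
  exact this.of_smul (by simp [h2, hcy, hby])

theorem sub_mem_of_refl {U : Submodule (ZMod p) W} {a x w : W} (ha : a ∈ U) (haa : B a a = 1)
    (hx : x - w ∈ U) : refl B a x - w ∈ U := by
  rw [refl_apply_unit haa, sub_right_comm]
  exact U.sub_mem hx (U.smul_mem _ ha)

theorem refl_sub_apply_self (hB : ∀ x y, B x y = B y x) {a x w : W} (haa : B a a = 1) :
    B (refl B a x - w) (refl B a x - w) = B (x - w) (x - w) + 4 * B a x * B a w := by
  rw [refl_apply_unit haa]
  simp only [map_sub, map_smul, LinearMap.sub_apply, LinearMap.smul_apply, smul_eq_mul, haa,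
    hB x a, hB w a]
  ring

theorem exists_mem_apply_eq {U : Submodule (ZMod p) W} (hB : ∀ x y, B x y = B y x)
    (hG : ∀ g ∈ G, IsIsom B g) (h2 : (2 : ZMod p) ≠ 0)
    (hU : ReflectsIn B G U) {c a y y' w x : W} (hcU : c ∈ U) (haU : a ∈ U) (hyU : y ∈ U)
    (hyU' : y' ∈ U) (hc : B c c = 0) (hcw : B c w = 0) (ha : B a a = 1) (hca : B c a = 0)
    (haw : B a w ≠ 0) (hcy : B c y ≠ 0) (hxw : x - w ∈ U) (hxx : B x x = B w w)
    (hxy' : B x y' ≠ 0) : ∃ g ∈ G, g x = w := by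
  wlog hcx : B c x ≠ 0 generalizing x y'
  · rw [not_not] at hcx
    obtain ⟨z, hzU, hcz, hxz⟩ : ∃ z ∈ U, B c z ≠ 0 ∧ B x z ≠ 0 := by
      by_cases hxy : B x y = 0
      · by_cases hcy' : B c y' = 0
        · exact ⟨y + y', U.add_mem hyU hyU', by simpa [hcy'] using hcy, by simpa [hxy] using hxy'⟩
        · exact ⟨y', hyU', hcy', hxy'⟩
      · exact ⟨y, hyU, hcy, hxy⟩
    obtain ⟨r, s, hh, hch, hxh⟩ := exists_unit_of_isotropic hB h2 hc hcz hcx hxz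
    set h := r • z + s • c with hh_def
    have hhU : h ∈ U := U.add_mem (U.smul_mem _ hzU) (U.smul_mem _ hcU)
    have hhG := hU h hhU hh
    obtain ⟨g, hg, hgx⟩ := this (x := refl B h x) (y' := refl B h y')
      (by rw [refl_apply_unit hh]; exact U.sub_mem hyU' (U.smul_mem _ hhU))
      (sub_mem_of_refl hhU hh hxw) (by rw [hG _ hhG, hxx]) (by rwa [hG _ hhG])
      (by rw [refl_apply_unit hh, hB h x]; simp [hcx, hxh, hch, h2])
    exact ⟨g * refl B h, mul_mem hg hhG, hgx⟩
  have h4 : (4 : ZMod p) ≠ 0 := by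
    have : (4 : ZMod p) = 2 * 2 := by norm_num
    rw [this]; exact mul_ne_zero h2 h2
  obtain ⟨r, hr⟩ : ∃ r : ZMod p, B (x - w) (x - w) + 4 * (B a x + r * B c x) * B a w = 1 :=
    ⟨((1 - B (x - w) (x - w)) / (4 * B a w) - B a x) / B c x, by field_simp; ring⟩
  have hac : B a c = 0 := by rw [hB, hca]
  have hd : B (a + r • c) (a + r • c) = 1 := by simp [ha, hac, hca, hc]
  have hdU : a + r • c ∈ U := U.add_mem haU (U.smul_mem _ hcU)
  have hdG := hU _ hdU hd
  have h1 : B (refl B (a + r • c) x - w) (refl B (a + r • c) x - w) = 1 := by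
    rw [refl_sub_apply_self hB hd]
    simpa [hcw] using hr
  have h5 := hU _ (sub_mem_of_refl hdU hd hxw) h1
  refine ⟨_ * refl B (a + r • c), mul_mem h5 hdG, ?_⟩
  exact refl_sub_apply hB (by rw [hG _ hdG, hxx]) (by rw [h1]; exact one_ne_zero)

theorem ReflectsIn.of_isSquare {U : Submodule (ZMod p) W} (hU : ReflectsIn B G U) {d : W}
    (hdU : d ∈ U) (hd : B d d ≠ 0) (hs : IsSquare (B d d)) : refl B d ∈ G := by
  obtain ⟨s, hs⟩ := hs
  have hs0 : s ≠ 0 := by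
    rintro rfl
    exact hd (by simpa using hs)
  rw [← refl_smul (s := s⁻¹) d (inv_ne_zero hs0)]
  refine hU _ (U.smul_mem _ hdU) ?_
  simp only [map_smul, LinearMap.smul_apply, hs, smul_eq_mul]
  field_simp

end Transvections

section Diagram

/-- The span of the vectors `b i`, `i ∈ I`. -/
def vspan (p : ℕ) {W : Type*} [AddCommGroup W] [Module (ZMod p) W]
    (b : ℕ → W) (I : Set ℕ) : Submodule (ZMod p) W :=
  Submodule.span (ZMod p) (b '' I)

variable {p : ℕ} [Fact p.Prime] {W : Type*} [AddCommGroup W] [Module (ZMod p) W]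
variable {B : LinearMap.BilinForm (ZMod p) W}

/-- The group generated by the reflections in the vectors `b i`, `i ∈ I`. -/
def reflGroup (B : LinearMap.BilinForm (ZMod p) W) (b : ℕ → W) (I : Set ℕ) :
    Subgroup (W ≃ₗ[ZMod p] W) :=
  Subgroup.closure ((fun i => refl B (b i)) '' I)

/-- The vectors `b 0, …, b (n - 1)` form a basic system for the `3`-infinity group whose
infinite branches are `{i, i + 1}` with `k ≤ i < k + l`, and `w 0, …, w (n - 1)` is a dual
totally isotropic system. -/
structure IsDiagram (B : LinearMap.BilinForm (ZMod p) W) (n k l : ℕ) (b w : ℕ → W) : Prop where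
  symm : ∀ x y, B x y = B y x
  unit : ∀ i < n, B (b i) (b i) = 1
  inf : ∀ i, k ≤ i → i < k + l → i + 1 < n → B (b i) (b (i + 1)) = -1
  three : ∀ i, i < k ∨ k + l ≤ i → i + 1 < n → B (b i) (b (i + 1)) = -(2⁻¹ : ZMod p)
  far : ∀ i j, i + 2 ≤ j → j < n → B (b i) (b j) = 0
  dual_self : ∀ i < n, B (w i) (b i) = 1
  dual_ne : ∀ i < n, ∀ j < n, i ≠ j → B (w i) (b j) = 0
  isotropic : ∀ i < n, ∀ j < n, B (w i) (w j) = 0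

variable {n k l : ℕ} {b w : ℕ → W}

theorem reflGroup_mono {I J : Set ℕ} (h : I ⊆ J) : reflGroup B b I ≤ reflGroup B b J :=
  Subgroup.closure_mono (Set.image_mono h)

theorem vspan_mono {I J : Set ℕ} (h : I ⊆ J) :
    vspan p b I ≤ vspan p b J :=
  Submodule.span_mono (Set.image_mono h)

theorem refl_mem_reflGroup {I : Set ℕ} {i : ℕ} (hi : i ∈ I) : refl B (b i) ∈ reflGroup B b I :=
  Subgroup.subset_closure ⟨i, hi, rfl⟩

theorem mem_vspan {I : Set ℕ} {i : ℕ} (hi : i ∈ I) : b i ∈ vspan p b I :=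
  Submodule.subset_span ⟨i, hi, rfl⟩

theorem isIsom_of_mem_reflGroup (hB : ∀ x y, B x y = B y x) {I : Set ℕ} :
    ∀ g ∈ reflGroup B b I, IsIsom B g := by
  intro g hg
  induction hg using Subgroup.closure_induction with
  | mem g hg =>
    obtain ⟨i, -, rfl⟩ := hg
    exact isIsom_refl hB _
  | one => exact fun x y => rfl
  | mul g h _ _ hg hh => exact hg.mul hh
  | inv g _ hg => exact hg.inv

theorem refl_sub_mem {U : Submodule (ZMod p) W} {a : W} (ha : a ∈ U) (x : W) :
    refl B a x - x ∈ U := by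
  by_cases h : B a a = 0
  · simp [refl, h]
  · rw [refl_apply h, sub_sub_cancel_left]
    exact U.neg_mem (U.smul_mem _ ha)

theorem mul_apply_sub_mem {U : Submodule (ZMod p) W} {g h : W ≃ₗ[ZMod p] W}
    (hg : ∀ x, g x - x ∈ U) (hh : ∀ x, h x - x ∈ U) (x : W) : (g * h) x - x ∈ U := by
  have := U.add_mem (hg (h x)) (hh x)
  rwa [sub_add_sub_cancel] at this

theorem apply_sub_mem_vspan {I : Set ℕ} {g : W ≃ₗ[ZMod p] W} (hg : g ∈ reflGroup B b I) :
    ∀ x, g x - x ∈ vspan p b I := by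
  induction hg using Subgroup.closure_induction with
  | mem g hg =>
    obtain ⟨i, hi, rfl⟩ := hg
    exact refl_sub_mem (mem_vspan hi)
  | one => exact fun x => by simp
  | mul g h _ _ hg hh => exact mul_apply_sub_mem hg hh
  | inv g _ hg =>
    intro x
    have h1 := hg (g⁻¹ x)
    have h2 : g (g⁻¹ x) = x := g.apply_symm_apply x
    rw [h2] at h1
    rw [← neg_sub]
    exact Submodule.neg_mem _ h1

theorem IsDiagram.dual_eq_zero (D : IsDiagram B n k l b w) {I : Set ℕ} (hI : ∀ i ∈ I, i < n)
    {t : ℕ} (ht : t < n) (htI : t ∉ I) {u : W} (hu : u ∈ vspan p b I) : B (w t) u = 0 := by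
  have : vspan p b I ≤ LinearMap.ker (B (w t)) := by
    refine Submodule.span_le.2 ?_
    rintro _ ⟨i, hi, rfl⟩
    exact D.dual_ne t ht i (hI i hi) fun h => htI (h ▸ hi)
  exact this hu

theorem vspan_le_sup (I : Set ℕ) (t : ℕ) :
    vspan p b I ≤ vspan p b (I \ {t}) ⊔ Submodule.span (ZMod p) {b t} := by
  refine Submodule.span_le.2 ?_
  rintro _ ⟨i, hi, rfl⟩
  by_cases h : i = t
  · subst h
    exact Submodule.mem_sup_right (Submodule.mem_span_singleton_self _)
  · exact Submodule.mem_sup_left (mem_vspan ⟨hi, h⟩)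

theorem IsDiagram.mem_vspan_diff (D : IsDiagram B n k l b w) {I : Set ℕ} (hI : ∀ i ∈ I, i < n)
    {t : ℕ} (ht : t < n) {u : W} (hu : u ∈ vspan p b I) (hut : B (w t) u = 0) :
    u ∈ vspan p b (I \ {t}) := by
  obtain ⟨h, hh, γ, rfl⟩ := mem_sup_span_singleton (vspan_le_sup I t hu)
  have h0 : B (w t) h = 0 := D.dual_eq_zero (fun i hi => hI i hi.1) ht (fun h => h.2 rfl) hh
  rw [map_add, map_smul, h0, D.dual_self t ht, zero_add, smul_eq_mul, mul_one] at hut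
  simpa [hut] using hh

theorem IsDiagram.apply_sub_mem_diff (D : IsDiagram B n k l b w) {I : Set ℕ}
    (hI : ∀ i ∈ I, i < n) {t : ℕ} (ht : t < n) {g : W ≃ₗ[ZMod p] W} (hg : IsIsom B g)
    (hgI : ∀ x, g x - x ∈ vspan p b I) (hgt : g (w t) = w t) (x : W) :
    g x - x ∈ vspan p b (I \ {t}) := by
  refine D.mem_vspan_diff hI ht (hgI x) ?_
  nth_rewrite 1 [map_sub, ← hgt]
  rw [hg, sub_self]

theorem IsDiagram.mem_reflGroup_of_apply (D : IsDiagram B n k l b w) {I : Set ℕ}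
    (hI : ∀ i ∈ I, i < n) {t : ℕ} (ht : t < n) {g h : W ≃ₗ[ZMod p] W} (hg : IsIsom B g)
    (hgI : ∀ x, g x - x ∈ vspan p b I) (hh : h ∈ reflGroup B b I) (hgt : h (g (w t)) = w t)
    (hP : (∀ x, (h * g) x - x ∈ vspan p b (I \ {t})) → h * g ∈ reflGroup B b (I \ {t})) :
    g ∈ reflGroup B b I := by
  have h1 := hP (D.apply_sub_mem_diff hI ht ((isIsom_of_mem_reflGroup D.symm h hh).mul hg)
    (mul_apply_sub_mem (apply_sub_mem_vspan hh) hgI) hgt)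
  have h2 := mul_mem (inv_mem hh) (reflGroup_mono Set.sdiff_subset h1)
  rwa [inv_mul_cancel_left] at h2

theorem IsDiagram.eq_one_of_forall (D : IsDiagram B n k l b w) {r : ℕ} (hr : r < n)
    {g : W ≃ₗ[ZMod p] W} (hg : IsIsom B g) (hgr : ∀ x, g x - x ∈ vspan p b {r})
    (hgw : g (w r) = w r) : g = 1 := by
  ext x
  have h1 := D.apply_sub_mem_diff (by simpa using hr) hr hg hgr hgw x
  have h2 : vspan p b (({r} : Set ℕ) \ {r}) = ⊥ := by simp [vspan]
  rw [h2, Submodule.mem_bot, sub_eq_zero] at h1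
  exact h1

theorem IsDiagram.mem_reflGroup_singleton (D : IsDiagram B n k l b w) {r : ℕ} (hr : r < n)
    {g : W ≃ₗ[ZMod p] W} (hg : IsIsom B g) (hgr : ∀ x, g x - x ∈ vspan p b {r}) :
    g ∈ reflGroup B b {r} := by
  have h1 := hgr (w r)
  rw [vspan, Set.image_singleton, Submodule.mem_span_singleton] at h1
  obtain ⟨α, hα⟩ := h1
  have h3 : g (w r) = w r + α • b r := by rw [hα]; abel
  have h4 := hg (w r) (w r)
  rw [D.isotropic r hr r hr, h3] at h4
  simp only [map_add, map_smul, LinearMap.add_apply, LinearMap.smul_apply, smul_eq_mul,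
    D.isotropic r hr r hr, D.dual_self r hr, D.symm (b r) (w r), D.unit r hr] at h4
  have h5 : α * (2 + α) = 0 := by linear_combination h4
  have hmem := refl_mem_reflGroup (B := B) (b := b) (Set.mem_singleton r)
  rcases mul_eq_zero.1 h5 with h | h
  · rw [D.eq_one_of_forall hr hg hgr (by rw [h3, h, zero_smul, add_zero])]
    exact one_mem _
  · have h6 := D.eq_one_of_forall hr ((isIsom_refl D.symm (b r)).mul hg)
      (mul_apply_sub_mem (apply_sub_mem_vspan hmem) hgr) (by
        change refl B (b r) (g (w r)) = _
        rw [refl_apply_unit (D.unit r hr), h3, map_add, map_smul, D.symm (b r) (w r),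
          D.dual_self r hr, D.unit r hr, smul_eq_mul]
        have : α = -2 := by linear_combination h
        rw [this]
        module)
    rw [eq_inv_of_mul_eq_one_right h6]
    exact inv_mem hmem

theorem mem_vspan_pair {i j : ℕ} {u : W} (hu : u ∈ vspan p b {i, j}) :
    ∃ r s : ZMod p, u = r • b i + s • b j := by
  rw [vspan, Set.image_pair, Submodule.mem_span_pair] at hu
  obtain ⟨r, s, h⟩ := hu
  exact ⟨r, s, h.symm⟩

theorem IsDiagram.reflectsIn_pair (D : IsDiagram B n k l b w) (h2 : (2 : ZMod p) ≠ 0) {i j : ℕ}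
    (hi : i < n) (hj : j < n) (hij : B (b i) (b j) = -1) :
    ReflectsIn B (reflGroup B b {i, j}) (vspan p b {i, j}) := by
  intro a ha haa
  obtain ⟨r, s, rfl⟩ := mem_vspan_pair ha
  exact refl_mem_of_pair D.symm (isIsom_of_mem_reflGroup D.symm) (D.unit i hi) (D.unit j hj) hij h2
    (refl_mem_reflGroup (by simp)) (refl_mem_reflGroup (by simp)) r s haa

theorem IsDiagram.mem_reflGroup_pair (D : IsDiagram B n k l b w) (h2 : (2 : ZMod p) ≠ 0)
    {i j : ℕ} (hi : i < n) (hj : j < n) (hne : i ≠ j) (hij : B (b i) (b j) = -1)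
    {g : W ≃ₗ[ZMod p] W} (hg : IsIsom B g) (hgr : ∀ x, g x - x ∈ vspan p b {i, j}) :
    g ∈ reflGroup B b {i, j} := by
  have hI : ∀ a ∈ ({i, j} : Set ℕ), a < n := by rintro a (rfl | rfl) <;> assumption
  have hdiff : ({i, j} : Set ℕ) \ {j} = {i} := by
    ext a
    simp only [Set.mem_sdiff, Set.mem_insert_iff, Set.mem_singleton_iff]
    grind
  have hfull := D.reflectsIn_pair h2 hi hj hij
  obtain ⟨α, β, hv⟩ := mem_vspan_pair (hgr (w j))
  set v := g (w j) - w j with hvdef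
  have h3 : g (w j) = w j + v := by rw [hvdef]; abel
  have h4 := hg (w j) (w j)
  have hji : B (b j) (b i) = -1 := by rw [D.symm, hij]
  have hvv : B v v = (α - β) * (α - β) := by
    rw [hv]
    simp only [map_add, map_smul, LinearMap.add_apply, LinearMap.smul_apply, smul_eq_mul,
      D.unit i hi, D.unit j hj, hij, hji]
    ring
  have hwv : B (w j) v = β := by
    rw [hv]
    simp [D.dual_self j hj, D.dual_ne j hj i hi hne.symm]
  rw [D.isotropic j hj j hj, h3] at h4
  simp only [map_add, LinearMap.add_apply, D.isotropic j hj j hj, hwv, D.symm v (w j), hvv] at h4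
  by_cases hαβ : α - β = 0
  · have hβ : β = 0 := by
      have : 2 * β = 0 := by rw [hαβ] at h4; linear_combination h4
      exact (mul_eq_zero.1 this).resolve_left h2
    have hα : α = 0 := by rw [hβ, sub_zero] at hαβ; exact hαβ
    refine D.mem_reflGroup_of_apply hI hj hg hgr (one_mem _) ?_ fun h => ?_
    · change g (w j) = w j
      rw [h3, hv, hα, hβ]; simp
    · rw [one_mul, hdiff] at h ⊢
      exact D.mem_reflGroup_singleton hi hg h
  · have hvv0 : B v v ≠ 0 := by rw [hvv]; exact mul_ne_zero hαβ hαβ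
    have hm := hfull.of_isSquare (hgr (w j)) hvv0 ⟨_, hvv⟩
    refine D.mem_reflGroup_of_apply hI hj hg hgr hm ?_ fun h => ?_
    · exact refl_sub_apply D.symm (hg _ _) hvv0
    · rw [hdiff] at h ⊢
      exact D.mem_reflGroup_singleton hi ((isIsom_refl D.symm _).mul hg) h

end Diagram

section Good

variable {p : ℕ} [Fact p.Prime] {W : Type*} [AddCommGroup W] [Module (ZMod p) W]
variable {B : LinearMap.BilinForm (ZMod p) W} {n k l : ℕ} {b w : ℕ → W}

/-- The reflection subgroup on the index set `I` contains all reflections in unit vectors of the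
span of its roots, and all elements of the whole group which move vectors inside that span. -/
def IsGood (B : LinearMap.BilinForm (ZMod p) W) (n : ℕ) (b : ℕ → W) (I : Set ℕ) : Prop :=
  ReflectsIn B (reflGroup B b I) (vspan p b I) ∧
    ∀ g ∈ reflGroup B b (Set.Iio n), (∀ x, g x - x ∈ vspan p b I) → g ∈ reflGroup B b I

theorem IsDiagram.isGood_pair (D : IsDiagram B n k l b w) (h2 : (2 : ZMod p) ≠ 0)
    {i j : ℕ} (hi : i < n) (hj : j < n) (hne : i ≠ j) (hij : B (b i) (b j) = -1) :
    IsGood B n b {i, j} :=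
  ⟨D.reflectsIn_pair h2 hi hj hij, fun g hg =>
    D.mem_reflGroup_pair h2 hi hj hne hij (isIsom_of_mem_reflGroup D.symm g hg)⟩

theorem mem_vspan_triple {i j r : ℕ} {u : W} (hu : u ∈ vspan p b {i, j, r}) :
    ∃ α β γ : ZMod p, u = α • b i + β • b j + γ • b r := by
  rw [vspan, Set.image_insert_eq, Set.image_pair, Submodule.mem_span_triple] at hu
  obtain ⟨α, β, γ, h⟩ := hu
  exact ⟨α, β, γ, h.symm⟩

theorem exists_mem_apply_ne_zero {U : Submodule (ZMod p) W} {g : W ≃ₗ[ZMod p] W}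
    (hg : IsIsom B g) (hgU : ∀ x, g x - x ∈ U) {w a : W} (ha : a ∈ U) (hwa : B w a ≠ 0) :
    ∃ y ∈ U, B (g w) y ≠ 0 :=
  ⟨g a, by simpa using U.add_mem (hgU a) ha, by rwa [hg]⟩

theorem IsDiagram.isGood_triple (D : IsDiagram B n k l b w) (h2 : (2 : ZMod p) ≠ 0)
    (h3 : (3 : ZMod p) ≠ 0)
    (hsq : ∀ d, B d d ≠ 0 → refl B d ∈ reflGroup B b (Set.Iio n) → IsSquare (B d d))
    {i j r : ℕ} (hi : i < n) (hj : j < n) (hr : r < n) (hne : i ≠ j) (hir : i ≠ r) (hjr : j ≠ r)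
    (hij : B (b i) (b j) = -1) (hir' : B (b i) (b r) = 0) (hjr' : B (b j) (b r) ≠ 0) :
    IsGood B n b {i, j, r} := by
  have hIsom := @isIsom_of_mem_reflGroup p _ W _ _ B b D.symm
  have hI : ∀ a ∈ ({i, j, r} : Set ℕ), a < n := by rintro a (rfl | rfl | rfl) <;> assumption
  have hdiff : ({i, j, r} : Set ℕ) \ {r} = {i, j} := by
    ext a
    simp only [Set.mem_sdiff, Set.mem_insert_iff, Set.mem_singleton_iff]
    grind
  have hmi := mem_vspan (p := p) (b := b) (I := {i, j, r}) (i := i) (by simp)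
  have hmj := mem_vspan (p := p) (b := b) (I := {i, j, r}) (i := j) (by simp)
  have hmr := mem_vspan (p := p) (b := b) (I := {i, j, r}) (i := r) (by simp)
  have hGi := refl_mem_reflGroup (B := B) (b := b) (I := {i, j, r}) (i := i) (by simp)
  have hGj := refl_mem_reflGroup (B := B) (b := b) (I := {i, j, r}) (i := j) (by simp)
  have hGr := refl_mem_reflGroup (B := B) (b := b) (I := {i, j, r}) (i := r) (by simp)
  have hfull : ReflectsIn B (reflGroup B b {i, j, r}) (vspan p b {i, j, r}) := by
    intro a ha haa
    obtain ⟨α, β, γ, rfl⟩ := mem_vspan_triple ha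
    exact refl_mem_of_triple D.symm hIsom (D.unit i hi) (D.unit j hj) (D.unit r hr) hij hir' hjr' h2
      hGi hGj hGr α β γ haa
  have hsub : reflGroup B b {i, j, r} ≤ reflGroup B b (Set.Iio n) := reflGroup_mono hI
  have hA : ∀ g ∈ reflGroup B b (Set.Iio n), (∀ x, g x - x ∈ vspan p b {i, j, r}) →
      B (g (w r) - w r) (g (w r) - w r) ≠ 0 → g ∈ reflGroup B b {i, j, r} := by
    intro g hg hgI hd
    have hfix := refl_sub_apply D.symm (hIsom g hg (w r) (w r)) hd
    have hI' := (isIsom_refl D.symm (g (w r) - w r)).mul (hIsom g hg)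
    have h1 := D.apply_sub_mem_diff hI hr hI'
      (mul_apply_sub_mem (refl_sub_mem (hgI (w r))) hgI) hfix
    rw [hdiff] at h1
    have h4 := D.mem_reflGroup_pair h2 hi hj hne hij hI' h1
    have h5 : refl B (g (w r) - w r) ∈ reflGroup B b (Set.Iio n) := by
      have := mul_mem (hsub (reflGroup_mono (by grind) h4)) (inv_mem hg)
      rwa [mul_inv_cancel_right] at this
    have h6 := hfull.of_isSquare (hgI (w r)) hd (hsq _ hd h5)
    have h7 := mul_mem (inv_mem h6) (reflGroup_mono (J := {i, j, r}) (by grind) h4)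
    rwa [inv_mul_cancel_left] at h7
  refine ⟨hfull, fun g hg hgI => ?_⟩
  by_cases hv : g (w r) = w r
  · refine D.mem_reflGroup_of_apply hI hr (hIsom g hg) hgI (one_mem _) hv fun h => ?_
    rw [hdiff, one_mul] at h ⊢
    exact D.mem_reflGroup_pair h2 hi hj hne hij (hIsom g hg) h
  by_cases hd : B (g (w r) - w r) (g (w r) - w r) = 0
  swap
  · exact hA g hg hgI hd
  have hwi : B (w r) (b i) = 0 := D.dual_ne r hr i hi hir.symm
  have hwj : B (w r) (b j) = 0 := D.dual_ne r hr j hj hjr.symm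
  have hwr : B (w r) (b r) = 1 := D.dual_self r hr
  set x := g (w r) with hx
  set τ := B (b j) (b r) with hτ
  have hji : B (b j) (b i) = -1 := by rw [D.symm, hij]
  have hri : B (b r) (b i) = 0 := by rw [D.symm, hir']
  have hrj : B (b r) (b j) = τ := by rw [D.symm]
  have h4 : (4 : ZMod p) ≠ 0 := by
    have : (4 : ZMod p) = 2 * 2 := by norm_num
    rw [this]; exact mul_ne_zero h2 h2
  obtain ⟨e, heU, hee, hwe, hxe⟩ : ∃ e ∈ vspan p b {i, j, r}, B e e = 1 ∧ B e (w r) ≠ 0 ∧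
      B e x ≠ 0 := by
    simp only [D.symm _ (w r), D.symm _ x]
    by_cases hxr : B x (b r) = 0
    swap
    · exact ⟨b r, hmr, D.unit r hr, by simp [hwr], hxr⟩
    by_cases hxc : B x (b i) + B x (b j) = 0
    swap
    · refine ⟨(-3 / (4 * τ)) • (b i + b j) + (2 : ZMod p) • b r,
        Submodule.add_mem _ (Submodule.smul_mem _ _ (Submodule.add_mem _ hmi hmj))
          (Submodule.smul_mem _ _ hmr), ?_, ?_, ?_⟩
      · simp only [map_add, map_smul, LinearMap.add_apply, LinearMap.smul_apply, smul_eq_mul,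
          D.unit i hi, D.unit j hj, D.unit r hr, hij, hji, hir', hri, hrj, ← hτ]
        field_simp
        ring
      · simp [hwi, hwj, hwr, h2]
      · simp only [map_add, map_smul, smul_eq_mul, hxr, mul_zero, add_zero]
        exact mul_ne_zero (div_ne_zero (neg_ne_zero.2 h3) (mul_ne_zero h4 hjr')) hxc
    · have hxj : B x (b j) ≠ 0 := by
        intro hxj
        obtain ⟨y, hy, hxy⟩ := exists_mem_apply_ne_zero (hIsom g hg) hgI hmr
          (w := w r) (by rw [hwr]; exact one_ne_zero)
        obtain ⟨α, β, γ, rfl⟩ := mem_vspan_triple hy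
        rw [hxj, add_zero] at hxc
        rw [← hx] at hxy
        simp [hxj, hxc, hxr] at hxy
      refine ⟨b r - (2 * τ) • b j, Submodule.sub_mem _ hmr (Submodule.smul_mem _ _ hmj), ?_, ?_, ?_⟩
      · simp only [map_sub, map_smul, LinearMap.sub_apply, LinearMap.smul_apply, smul_eq_mul,
          D.unit j hj, D.unit r hr, hrj, ← hτ]
        ring
      · simp [hwr, hwj]
      · simp [hxr, h2, hjr', hxj]
  have heG := hfull e heU hee
  have h5 := hA (refl B e * g) (mul_mem (hsub heG) hg)
    (mul_apply_sub_mem (refl_sub_mem heU) hgI) (by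
      change B (refl B e x - w r) (refl B e x - w r) ≠ 0
      rw [refl_sub_apply_self D.symm hee, hd, zero_add]
      exact mul_ne_zero (mul_ne_zero h4 hxe) hwe)
  have h6 := mul_mem (inv_mem heG) h5
  rwa [inv_mul_cancel_left] at h6

theorem IsDiagram.isGood_of_diff (D : IsDiagram B n k l b w) (h2 : (2 : ZMod p) ≠ 0)
    {I : Set ℕ} (hI : ∀ i ∈ I, i < n) {r : ℕ} (hr : r ∈ I) (hgood : IsGood B n b (I \ {r}))
    (hfull : ReflectsIn B (reflGroup B b I) (vspan p b I)) {c a y : W} (hcI : c ∈ vspan p b I)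
    (haI : a ∈ vspan p b I) (hyI : y ∈ vspan p b I) (hc : B c c = 0) (hcw : B c (w r) = 0)
    (ha : B a a = 1) (hca : B c a = 0) (haw : B a (w r) ≠ 0) (hcy : B c y ≠ 0) :
    IsGood B n b I := by
  have hIsom := @isIsom_of_mem_reflGroup p _ W _ _ B b D.symm
  refine ⟨hfull, fun g hg hgI => ?_⟩
  obtain ⟨y', hy', hxy'⟩ := exists_mem_apply_ne_zero (hIsom g hg) hgI (mem_vspan hr)
    (w := w r) (by rw [D.dual_self r (hI r hr)]; exact one_ne_zero)
  obtain ⟨h, hh, hhw⟩ := exists_mem_apply_eq D.symm hIsom h2 hfull hcI haI hyI hy' hc hcw ha hca haw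
    hcy (hgI (w r)) (hIsom g hg _ _) hxy'
  exact D.mem_reflGroup_of_apply hI (hI r hr) (hIsom g hg) hgI hh hhw
    (hgood.2 _ (mul_mem (reflGroup_mono hI hh) hg))

theorem IsDiagram.isGood_of_diff_isotropic (D : IsDiagram B n k l b w) (h2 : (2 : ZMod p) ≠ 0)
    (h3 : (3 : ZMod p) ≠ 0) {I : Set ℕ} (hI : ∀ i ∈ I, i < n) {r : ℕ} (hr : r ∈ I)
    (hgood : IsGood B n b (I \ {r})) {c y : W} (hcI : c ∈ vspan p b (I \ {r}))
    (hyI : y ∈ vspan p b (I \ {r})) (hc : B c c = 0) (hcr : B c (b r) = 0) (hcy : B c y ≠ 0)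
    (hry : B (b r) y ≠ 0) : IsGood B n b I := by
  have hrn := hI r hr
  have hfull : ReflectsIn B (reflGroup B b I) (vspan p b I) := by
    intro a ha haa
    have h1 : ReflectsIn B (reflGroup B b I) (vspan p b (I \ {r})) := fun a ha haa =>
      reflGroup_mono Set.sdiff_subset (hgood.1 a ha haa)
    exact h1.sup_span_unit D.symm (isIsom_of_mem_reflGroup D.symm) h2 h3 hcI hyI hc hcy
      (D.unit r hrn) hcr hry (refl_mem_reflGroup hr) a (vspan_le_sup I r ha) haa
  have hle : vspan p b (I \ {r}) ≤ vspan p b I := vspan_mono Set.sdiff_subset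
  refine D.isGood_of_diff h2 hI hr hgood hfull (hle hcI) (mem_vspan hr) (hle hyI) hc ?_
    (D.unit r hrn) hcr ?_ hcy
  · rw [D.symm]
    exact D.dual_eq_zero (fun i hi => hI i hi.1) hrn (fun h => h.2 rfl) hcI
  · rw [D.symm, D.dual_self r hrn]
    exact one_ne_zero

end Good

section Intervals

variable {p : ℕ} [Fact p.Prime] {W : Type*} [AddCommGroup W] [Module (ZMod p) W]
variable {B : LinearMap.BilinForm (ZMod p) W} {n k l : ℕ} {b w : ℕ → W}

theorem IsDiagram.adj_ne_zero (D : IsDiagram B n k l b w) (h2 : (2 : ZMod p) ≠ 0) (i : ℕ)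
    (hi : i + 1 < n) : B (b i) (b (i + 1)) ≠ 0 := by
  by_cases h : i < k ∨ k + l ≤ i
  · rw [D.three i h hi]
    exact neg_ne_zero.2 (inv_ne_zero h2)
  · push Not at h
    rw [D.inf i h.1 h.2 hi]
    exact neg_ne_zero.2 one_ne_zero

theorem IsDiagram.isGood_middle (D : IsDiagram B n k l b w) (h2 : (2 : ZMod p) ≠ 0)
    (h3 : (3 : ZMod p) ≠ 0) {s : ℕ} (hs : s + 3 < n)
    (h01 : B (b s) (b (s + 1)) = -(2⁻¹ : ZMod p)) (h12 : B (b (s + 1)) (b (s + 2)) = -1)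
    (h23 : B (b (s + 2)) (b (s + 3)) = -(2⁻¹ : ZMod p)) (hL : IsGood B n b (Set.Ico s (s + 3)))
    (hR : IsGood B n b (Set.Ico (s + 1) (s + 4))) : IsGood B n b (Set.Ico s (s + 4)) := by
  have hIsom := @isIsom_of_mem_reflGroup p _ W _ _ B b D.symm
  have hI : ∀ a ∈ Set.Ico s (s + 4), a < n := fun a ha => by
    have := ha.2
    omega
  have hdiff : Set.Ico s (s + 4) \ {s + 3} = Set.Ico s (s + 3) := by
    ext a
    simp only [Set.mem_sdiff, Set.mem_Ico, Set.mem_singleton_iff]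
    omega
  have hLK : Set.Ico s (s + 3) ⊆ Set.Ico s (s + 4) := Set.Ico_subset_Ico_right (by omega)
  have hRK : Set.Ico (s + 1) (s + 4) ⊆ Set.Ico s (s + 4) := Set.Ico_subset_Ico_left (by omega)
  have u0 := D.unit s (by omega)
  have u1 := D.unit (s + 1) (by omega)
  have u2 := D.unit (s + 2) (by omega)
  have u3 := D.unit (s + 3) (by omega)
  have h02 := D.far s (s + 2) (by omega) (by omega)
  have h03 := D.far s (s + 3) (by omega) (by omega)
  have h13 := D.far (s + 1) (s + 3) (by omega) (by omega)
  have h10 := D.symm (b (s + 1)) (b s)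
  have h20 := D.symm (b (s + 2)) (b s)
  have h30 := D.symm (b (s + 3)) (b s)
  have h21 := D.symm (b (s + 2)) (b (s + 1))
  have h31 := D.symm (b (s + 3)) (b (s + 1))
  have h32 := D.symm (b (s + 3)) (b (s + 2))
  rw [h01] at h10
  rw [h02] at h20
  rw [h03] at h30
  rw [h12] at h21
  rw [h13] at h31
  rw [h23] at h32
  have m0 : b s ∈ vspan p b (Set.Ico s (s + 3)) := mem_vspan (by simp)
  have m1 : b (s + 1) ∈ vspan p b (Set.Ico s (s + 3)) := mem_vspan (by simp)
  have m2 : b (s + 2) ∈ vspan p b (Set.Ico s (s + 3)) := mem_vspan (by simp)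
  have m1' : b (s + 1) ∈ vspan p b (Set.Ico (s + 1) (s + 4)) := mem_vspan (by simp)
  have m2' : b (s + 2) ∈ vspan p b (Set.Ico (s + 1) (s + 4)) := mem_vspan (by simp)
  have m3' : b (s + 3) ∈ vspan p b (Set.Ico (s + 1) (s + 4)) := mem_vspan (by simp)
  have hle := vspan_mono (p := p) (b := b) hLK
  have m3 : b (s + 3) ∈ vspan p b (Set.Ico s (s + 4)) := vspan_mono hRK m3'
  set c := b (s + 1) + b (s + 2) with hc
  have mc : c ∈ vspan p b (Set.Ico s (s + 3)) := Submodule.add_mem _ m1 m2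
  have mc' : c ∈ vspan p b (Set.Ico (s + 1) (s + 4)) := Submodule.add_mem _ m1' m2'
  have hcc : B c c = 0 := by simp [hc, u1, u2, h12, h21]
  have hc0 : B c (b s) = -(2⁻¹ : ZMod p) := by simp [hc, h10, h20]
  have hc3 : B c (b (s + 3)) = -(2⁻¹ : ZMod p) := by simp [hc, h13, h23]
  have h0c : B (b s) c = -(2⁻¹ : ZMod p) := by rw [D.symm, hc0]
  have h3c : B (b (s + 3)) c = -(2⁻¹ : ZMod p) := by rw [D.symm, hc3]
  set c₁ := (-2 : ZMod p) • b s - (2 : ZMod p) • c with hc₁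
  set c₂ := (-2 : ZMod p) • b (s + 3) - (2 : ZMod p) • c with hc₂
  have hcc₁ : B c c₁ = 1 := by simp [hc₁, hc0, hcc, h2]
  have hcc₂ : B c c₂ = 1 := by simp [hc₂, hc3, hcc, h2]
  have hc₁c₁ : B c₁ c₁ = 0 := by
    simp only [hc₁, map_sub, map_smul, LinearMap.sub_apply, LinearMap.smul_apply, smul_eq_mul, u0,
      hc0, h0c, hcc]
    field_simp
    ring
  have hc₂c₂ : B c₂ c₂ = 0 := by
    simp only [hc₂, map_sub, map_smul, LinearMap.sub_apply, LinearMap.smul_apply, smul_eq_mul, u3,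
      hc3, h3c, hcc]
    field_simp
    ring
  have hunit : ∀ d, B d d = 0 → B c d = 1 → ∀ r : ZMod p, r ≠ 0 →
      B (r • c + (2 * r)⁻¹ • d) (r • c + (2 * r)⁻¹ • d) = 1 := by
    intro d hd hcd r hr
    simp only [map_add, map_smul, LinearMap.add_apply, LinearMap.smul_apply, smul_eq_mul, hcc, hd,
      hcd, D.symm d c]
    field_simp
    ring
  have mc₁ : c₁ ∈ vspan p b (Set.Ico s (s + 3)) :=
    Submodule.sub_mem _ (Submodule.smul_mem _ _ m0) (Submodule.smul_mem _ _ mc)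
  have mc₂ : c₂ ∈ vspan p b (Set.Ico (s + 1) (s + 4)) :=
    Submodule.sub_mem _ (Submodule.smul_mem _ _ m3') (Submodule.smul_mem _ _ mc')
  have hT : HasTransvection B (reflGroup B b (Set.Ico s (s + 4))) c (c₂ - c₁) :=
    hasTransvection_sub D.symm h2 h3 hcc hc₁c₁ hc₂c₂ hcc₁ hcc₂
      (fun r hr => reflGroup_mono hLK (hL.1 _ (Submodule.add_mem _ (Submodule.smul_mem _ _ mc)
        (Submodule.smul_mem _ _ mc₁)) (hunit c₁ hc₁c₁ hcc₁ r hr)))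
      (fun r hr => reflGroup_mono hRK (hR.1 _ (Submodule.add_mem _ (Submodule.smul_mem _ _ mc')
        (Submodule.smul_mem _ _ mc₂)) (hunit c₂ hc₂c₂ hcc₂ r hr)))
  have hc0' : B c (b s) ≠ 0 := by rw [hc0]; exact neg_ne_zero.2 (inv_ne_zero h2)
  have hfull : ReflectsIn B (reflGroup B b (Set.Ico s (s + 4)))
      (vspan p b (Set.Ico s (s + 4))) := by
    have h1 : ReflectsIn B (reflGroup B b (Set.Ico s (s + 4))) (vspan p b (Set.Ico s (s + 3))) :=
      fun a ha haa => reflGroup_mono hLK (hL.1 a ha haa)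
    have h4 := h1.sup_span D.symm hIsom h2 mc m0 hcc hc0' hT
    have h5 : vspan p b (Set.Ico s (s + 4)) ≤
        vspan p b (Set.Ico s (s + 3)) ⊔ Submodule.span (ZMod p) {c₂ - c₁} := by
      refine Submodule.span_le.2 ?_
      rintro _ ⟨i, hi, rfl⟩
      by_cases his : i = s + 3
      · have h6 : b i = b s + (-(2⁻¹) : ZMod p) • (c₂ - c₁) := by
          rw [his, hc₁, hc₂]
          match_scalars <;> field_simp <;> ring
        rw [h6]
        exact Submodule.add_mem _ (Submodule.mem_sup_left m0)
          (Submodule.mem_sup_right (Submodule.smul_mem _ _ (Submodule.mem_span_singleton_self _)))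
      · exact Submodule.mem_sup_left (mem_vspan (hdiff ▸ ⟨hi, his⟩))
    exact fun a ha haa => h4 a (h5 ha) haa
  have hw0 := D.dual_ne (s + 3) hs s (by omega) (by omega)
  have hw1 := D.dual_ne (s + 3) hs (s + 1) (by omega) (by omega)
  have hw2 := D.dual_ne (s + 3) hs (s + 2) (by omega) (by omega)
  have hw3 := D.dual_self (s + 3) hs
  refine D.isGood_of_diff h2 hI (r := s + 3) (by simp) (hdiff ▸ hL) hfull (c := c)
    (a := b (s + 1) + (2⁻¹ : ZMod p) • (b s - b (s + 3))) (y := b s) (hle mc)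
    (Submodule.add_mem _ (hle m1) (Submodule.smul_mem _ _ (Submodule.sub_mem _ (hle m0) m3)))
    (hle m0) hcc ?_ ?_ ?_ ?_ hc0'
  · rw [D.symm, hc, map_add, hw1, hw2, add_zero]
  · simp only [map_add, map_sub, map_smul, LinearMap.add_apply, LinearMap.sub_apply,
      LinearMap.smul_apply, smul_eq_mul, u0, u1, u3, h01, h10, h03, h30, h13, h31]
    field_simp
    ring
  · have hc1 : B c (b (s + 1)) = 0 := by simp [hc, u1, h21]
    simp [hc1, hc0, hc3]
  · rw [D.symm]
    simp [hw1, hw0, hw3, h2]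

theorem IsDiagram.isGood_Ico (D : IsDiagram B n k l b w) (h2 : (2 : ZMod p) ≠ 0)
    (h3 : (3 : ZMod p) ≠ 0)
    (hsq : ∀ d, B d d ≠ 0 → refl B d ∈ reflGroup B b (Set.Iio n) → IsSquare (B d d))
    (d s t i : ℕ) (hd : t = s + d) (ht : t ≤ n) (hsi : s ≤ i) (hit : i + 1 < t) (hki : k ≤ i)
    (hil : i < k + l) : IsGood B n b (Set.Ico s t) := by
  induction d generalizing s t i with
  | zero => omega
  | succ d ih =>
    have hI : ∀ a ∈ Set.Ico s t, a < n := fun a ha => lt_of_lt_of_le ha.2 ht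
    have hii := D.inf i hki hil (by omega)
    have hii' : B (b (i + 1)) (b i) = -1 := by rw [D.symm, hii]
    have hadj := D.adj_ne_zero h2
    have hadj' : ∀ j, j + 1 < n → B (b (j + 1)) (b j) ≠ 0 := fun j hj => by
      rw [D.symm]
      exact hadj j hj
    have hfar := D.far
    have hfar' : ∀ j j', j + 2 ≤ j' → j' < n → B (b j') (b j) = 0 := fun j j' h h' => by
      rw [D.symm]
      exact hfar j j' h h'
    have hdr : ∀ r, t = r + 1 → Set.Ico s t \ {r} = Set.Ico s r := by
      intro r hr
      ext a
      simp only [Set.mem_sdiff, Set.mem_Ico, Set.mem_singleton_iff]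
      omega
    have hdl : Set.Ico s t \ {s} = Set.Ico (s + 1) t := by
      ext a
      simp only [Set.mem_sdiff, Set.mem_Ico, Set.mem_singleton_iff]
      omega
    by_cases h2' : t = s + 2
    · obtain rfl : i = s := by omega
      have : Set.Ico i t = {i, i + 1} := by
        ext a
        simp only [Set.mem_Ico, Set.mem_insert_iff, Set.mem_singleton_iff]
        omega
      rw [this]
      exact D.isGood_pair h2 (by omega) (by omega) (by omega) hii
    by_cases h3' : t = s + 3
    · by_cases his : i = s
      · subst his
        have : Set.Ico i t = {i, i + 1, i + 2} := by
          ext a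
          simp only [Set.mem_Ico, Set.mem_insert_iff, Set.mem_singleton_iff]
          omega
        rw [this]
        exact D.isGood_triple h2 h3 hsq (by omega) (by omega) (by omega) (by omega) (by omega)
          (by omega) hii (hfar _ _ (by omega) (by omega)) (hadj _ (by omega))
      · obtain rfl : i = s + 1 := by omega
        have : Set.Ico s t = {s + 1 + 1, s + 1, s} := by
          ext a
          simp only [Set.mem_Ico, Set.mem_insert_iff, Set.mem_singleton_iff]
          omega
        rw [this]
        exact D.isGood_triple h2 h3 hsq (by omega) (by omega) (by omega) (by omega) (by omega)
          (by omega) hii' (hfar' _ _ (by omega) (by omega)) (hadj' _ (by omega))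
    have hiso : ∀ j, k ≤ j → j < k + l → j + 1 < n →
        B (b j + b (j + 1)) (b j + b (j + 1)) = 0 := by
      intro j hj hj' hj''
      have h := D.inf j hj hj' hj''
      have h' := D.symm (b (j + 1)) (b j)
      rw [h] at h'
      simp [D.unit j (by omega), D.unit (j + 1) hj'', h, h']
    have hlast : ∀ j, k ≤ j → j < k + l → s ≤ j → j + 4 ≤ t → IsGood B n b (Set.Ico s t) := by
      intro j hkj hjl hsj hjt
      obtain ⟨r, rfl⟩ : ∃ r, t = r + 2 := ⟨t - 2, by omega⟩
      have hgood : IsGood B n b (Set.Ico s (r + 2) \ {r + 1}) := by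
        rw [hdr (r + 1) rfl]
        exact ih s (r + 1) j (by omega) (by omega) hsj (by omega) hkj hjl
      have hm : ∀ a, s ≤ a → a < r + 1 → b a ∈ vspan p b (Set.Ico s (r + 2) \ {r + 1}) :=
        fun a h h' => mem_vspan ⟨⟨h, by omega⟩, by simp only [Set.mem_singleton_iff]; omega⟩
      have hcm := Submodule.add_mem _ (hm j hsj (by omega)) (hm (j + 1) (by omega) (by omega))
      have hcr : B (b j + b (j + 1)) (b (r + 1)) = 0 := by
        simp [hfar j (r + 1) (by omega) (by omega), hfar (j + 1) (r + 1) (by omega) (by omega)]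
      have hcy : B (b j + b (j + 1)) (b (j + 2)) ≠ 0 := by
        simpa [hfar j (j + 2) (by omega) (by omega)] using hadj (j + 1) (by omega)
      have hrI : r + 1 ∈ Set.Ico s (r + 2) := ⟨by omega, by omega⟩
      by_cases hjr : r = j + 2
      · subst hjr
        exact D.isGood_of_diff_isotropic h2 h3 hI hrI hgood hcm
          (hm (j + 2) (by omega) (by omega)) (hiso j hkj hjl (by omega)) hcr hcy
          (hadj' _ (by omega))
      · refine D.isGood_of_diff_isotropic h2 h3 hI hrI hgood hcm (y := b r + b (j + 2))
          (Submodule.add_mem _ (hm r (by omega) (by omega)) (hm (j + 2) (by omega) (by omega)))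
          (hiso j hkj hjl (by omega)) hcr ?_ ?_
        · rw [map_add, show B (b j + b (j + 1)) (b r) = 0 by
            simp [hfar j r (by omega) (by omega), hfar (j + 1) r (by omega) (by omega)], zero_add]
          exact hcy
        · rw [map_add, hfar' (j + 2) (r + 1) (by omega) (by omega), add_zero]
          exact hadj' _ (by omega)
    have hfirst : ∀ j, k ≤ j → j < k + l → s + 2 ≤ j → j + 1 < t → IsGood B n b (Set.Ico s t) := by
      intro j hkj hjl hsj hjt
      obtain ⟨r, rfl⟩ : ∃ r, j = r + 1 := ⟨j - 1, by omega⟩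
      have hgood : IsGood B n b (Set.Ico s t \ {s}) := by
        rw [hdl]
        exact ih (s + 1) t (r + 1) (by omega) (by omega) (by omega) hjt hkj hjl
      have hm : ∀ a, s < a → a < t → b a ∈ vspan p b (Set.Ico s t \ {s}) :=
        fun a h h' => mem_vspan ⟨⟨h.le, h'⟩, by simp only [Set.mem_singleton_iff]; omega⟩
      have hcm := Submodule.add_mem _ (hm (r + 1) (by omega) (by omega))
        (hm (r + 1 + 1) (by omega) (by omega))
      have hcr : B (b (r + 1) + b (r + 1 + 1)) (b s) = 0 := by
        simp [hfar' s (r + 1) (by omega) (by omega), hfar' s (r + 1 + 1) (by omega) (by omega)]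
      have hcy : B (b (r + 1) + b (r + 1 + 1)) (b r) ≠ 0 := by
        simpa [hfar' r (r + 1 + 1) (by omega) (by omega)] using hadj' r (by omega)
      have hsI : s ∈ Set.Ico s t := ⟨le_rfl, by omega⟩
      by_cases hjr : r = s + 1
      · subst hjr
        exact D.isGood_of_diff_isotropic h2 h3 hI hsI hgood hcm
          (hm (s + 1) (by omega) (by omega)) (hiso _ hkj hjl (by omega)) hcr hcy
          (hadj _ (by omega))
      · refine D.isGood_of_diff_isotropic h2 h3 hI hsI hgood hcm (y := b (s + 1) + b r)
          (Submodule.add_mem _ (hm (s + 1) (by omega) (by omega)) (hm r (by omega) (by omega)))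
          (hiso _ hkj hjl (by omega)) hcr ?_ ?_
        · rw [map_add, show B (b (r + 1) + b (r + 1 + 1)) (b (s + 1)) = 0 by
            simp [hfar' (s + 1) (r + 1) (by omega) (by omega),
              hfar' (s + 1) (r + 1 + 1) (by omega) (by omega)], zero_add]
          exact hcy
        · rw [map_add, hfar s r (by omega) (by omega), add_zero]
          exact hadj _ (by omega)
    by_cases hc1 : i + 4 ≤ t
    · exact hlast i hki hil hsi hc1
    by_cases hc2 : s + 2 ≤ i
    · exact hfirst i hki hil hc2 hit
    obtain rfl : i = s + 1 := by omega
    obtain rfl : t = s + 4 := by omega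
    by_cases hs : k ≤ s
    · exact hlast s hs (by omega) le_rfl le_rfl
    by_cases hs' : s + 2 < k + l
    · exact hfirst (s + 2) (by omega) hs' le_rfl (by omega)
    exact D.isGood_middle h2 h3 (by omega) (D.three _ (by omega) (by omega)) hii
      (D.three _ (by omega) (by omega)) (ih s (s + 3) (s + 1) (by omega) (by omega) (by omega)
        (by omega) hki hil)
      (ih (s + 1) (s + 4) (s + 1) (by omega) (by omega) (by omega) (by omega) hki hil)

end Intervals

section Braid

/-- The product `ρ (j - 1) * ⋯ * ρ 0`. -/
def descProd {G : Type*} [Group G] (ρ : ℕ → G) : ℕ → G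
  | 0 => 1
  | j + 1 => ρ j * descProd ρ j

variable {G : Type*} [Group G] {ρ : ℕ → G} {q : ℕ}

theorem mul_descProd_of_lt (hc : ∀ i j, i + 2 ≤ j → j < q → ρ j * ρ i = ρ i * ρ j) {i j : ℕ}
    (hij : j < i) (hi : i < q) : ρ i * descProd ρ j = descProd ρ j * ρ i := by
  induction j with
  | zero => simp [descProd]
  | succ j ih =>
    rw [descProd, ← mul_assoc, hc j i hij hi, mul_assoc, ih (by omega), mul_assoc]

theorem mul_descProd_of_add_two_le (hc : ∀ i j, i + 2 ≤ j → j < q → ρ j * ρ i = ρ i * ρ j)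
    (hb : ∀ i, i + 1 < q → ρ i * ρ (i + 1) * ρ i = ρ (i + 1) * ρ i * ρ (i + 1)) {i d : ℕ}
    (hj : i + 2 + d ≤ q) :
    ρ i * descProd ρ (i + 2 + d) = descProd ρ (i + 2 + d) * ρ (i + 1) := by
  induction d with
  | zero =>
    simp only [descProd, ← mul_assoc]
    rw [hb i (by omega), mul_assoc _ (ρ (i + 1)),
      mul_descProd_of_lt hc (Nat.lt_succ_self i) (by omega), ← mul_assoc]
  | succ d ih =>
    change ρ i * (ρ (i + 2 + d) * descProd ρ (i + 2 + d)) =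
      ρ (i + 2 + d) * descProd ρ (i + 2 + d) * ρ (i + 1)
    rw [← mul_assoc, ← hc i (i + 2 + d) (by omega) (by omega), mul_assoc, ih (by omega),
      mul_assoc]

theorem exists_descProd_mul (hc : ∀ i j, i + 2 ≤ j → j < q → ρ j * ρ i = ρ i * ρ j)
    (hb : ∀ i, i + 1 < q → ρ i * ρ (i + 1) * ρ i = ρ (i + 1) * ρ i * ρ (i + 1))
    (hinv : ∀ i, ρ i * ρ i = 1) {g : G} (hg : g ∈ Subgroup.closure (ρ '' Set.Ico 0 q)) :
    ∃ j ≤ q, ∃ h ∈ Subgroup.closure (ρ '' Set.Ico 1 q), g = descProd ρ j * h := by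
  have step : ∀ i < q, ∀ g : G,
      (∃ j ≤ q, ∃ h ∈ Subgroup.closure (ρ '' Set.Ico 1 q), g = descProd ρ j * h) →
      ∃ j ≤ q, ∃ h ∈ Subgroup.closure (ρ '' Set.Ico 1 q), ρ i * g = descProd ρ j * h := by
    rintro i hi _ ⟨j, hj, h, hh, rfl⟩
    rcases lt_trichotomy i j with hij | rfl | hij
    · obtain ⟨d, rfl⟩ := Nat.exists_eq_add_of_lt hij
      cases d with
      | zero =>
        refine ⟨i, by omega, h, hh, ?_⟩
        rw [add_zero, descProd, ← mul_assoc, ← mul_assoc, hinv, one_mul]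
      | succ d =>
        refine ⟨i + 2 + d, by omega, ρ (i + 1) * h,
          mul_mem (Subgroup.subset_closure ⟨i + 1, ⟨by omega, by omega⟩, rfl⟩) hh, ?_⟩
        rw [show i + (d + 1) + 1 = i + 2 + d by omega, ← mul_assoc,
          mul_descProd_of_add_two_le hc hb (by omega), mul_assoc]
    · exact ⟨i + 1, hi, h, hh, by rw [descProd, mul_assoc]⟩
    · refine ⟨j, hj, ρ i * h,
        mul_mem (Subgroup.subset_closure ⟨i, ⟨by omega, hi⟩, rfl⟩) hh, ?_⟩
      rw [← mul_assoc, mul_descProd_of_lt hc hij hi, mul_assoc]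
  induction hg using Subgroup.closure_induction_left with
  | one => exact ⟨0, Nat.zero_le _, 1, one_mem _, by simp [descProd]⟩
  | mul_left x hx y hy ih =>
    obtain ⟨i, hi, rfl⟩ := hx
    exact step i hi.2 y ih
  | inv_mul_cancel x hx y hy ih =>
    obtain ⟨i, hi, rfl⟩ := hx
    rw [inv_eq_of_mul_eq_one_left (hinv i)]
    exact step i hi.2 y ih

variable {p : ℕ} [Fact p.Prime] {W : Type*} [AddCommGroup W] [Module (ZMod p) W]
variable {B : LinearMap.BilinForm (ZMod p) W}

theorem refl_commute (hB : ∀ x y, B x y = B y x) {a b : W} (ha : B a a = 1) (hab : B a b = 0) :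
    refl B a * refl B b = refl B b * refl B a := by
  have h := mul_refl_mul_inv (isIsom_refl hB a) b
  rw [refl_apply_unit ha, hab, mul_zero, zero_smul, sub_zero, mul_inv_eq_iff_eq_mul] at h
  exact h

theorem refl_braid (hB : ∀ x y, B x y = B y x) (h2 : (2 : ZMod p) ≠ 0) {a b : W} (ha : B a a = 1)
    (hb : B b b = 1) (hab : B a b = -(2⁻¹ : ZMod p)) :
    refl B a * refl B b * refl B a = refl B b * refl B a * refl B b := by
  have h := mul_refl_mul_inv (isIsom_refl hB a) b
  have h' := mul_refl_mul_inv (isIsom_refl hB b) a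
  have hm : (2 : ZMod p) * -2⁻¹ = -1 := by field_simp
  rw [refl_inv] at h h'
  rw [h, h', refl_apply_unit ha, refl_apply_unit hb, hB b a, hab, hm]
  congr 1
  module

theorem mem_reflGroup_of_braid (hB : ∀ x y, B x y = B y x) (h2 : (2 : ZMod p) ≠ 0) {β : ℕ → W}
    (hu : ∀ i < q, B (β i) (β i) = 1)
    (hadj : ∀ i, i + 1 < q → B (β i) (β (i + 1)) = -(2⁻¹ : ZMod p))
    (hfar : ∀ i j, i + 2 ≤ j → j < q → B (β i) (β j) = 0) {w : W} (hw : B w (β 0) = 1)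
    (hw' : ∀ i, 1 ≤ i → i < q → B w (β i) = 0) {g : W ≃ₗ[ZMod p] W}
    (hg : g ∈ reflGroup B β (Set.Ico 0 q)) (hgw : B w (g w - w) = 0) :
    g ∈ reflGroup B β (Set.Ico 1 q) := by
  obtain ⟨j, hj, h, hh, rfl⟩ := exists_descProd_mul (ρ := fun i => refl B (β i))
    (fun i j hij hj => (refl_commute hB (hu i (by omega)) (hfar i j hij hj)).symm)
    (fun i hi => refl_braid hB h2 (hu i (by omega)) (hu _ hi) (hadj i hi))
    (fun i => refl_mul_self _) hg
  have hhw : h w = w := by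
    clear hg hgw
    induction hh using Subgroup.closure_induction with
    | mem x hx =>
      obtain ⟨i, hi, rfl⟩ := hx
      change refl B (β i) w = w
      rw [refl_apply_unit (hu i hi.2), hB, hw' i hi.1 hi.2]
      simp
    | one => rfl
    | mul x y _ _ hx hy =>
      change x (y w) = w
      rw [hy, hx]
    | inv x _ hx => exact x.symm_apply_eq.2 hx.symm
  have hdesc : ∀ j ≤ q, descProd (fun i => refl B (β i)) j w =
      w - (2 : ZMod p) • ∑ i ∈ Finset.range j, β i := by
    intro j hj
    induction j with
    | zero => simp [descProd]
    | succ j ih =>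
      have h1 : B (β j) (w - (2 : ZMod p) • ∑ i ∈ Finset.range j, β i) = 1 := by
        cases j with
        | zero => simp [hB _ w, hw]
        | succ j =>
          have h0 : ∀ i ∈ Finset.range j, B (β (j + 1)) (β i) = 0 := fun i hi => by
            rw [hB]
            exact hfar i (j + 1) (by have := Finset.mem_range.1 hi; omega) (by omega)
          rw [map_sub, map_smul, map_sum, Finset.sum_range_succ, Finset.sum_eq_zero h0, hB _ w,
            hw' (j + 1) (by omega) (by omega), hB _ (β j), hadj j (by omega), smul_eq_mul]
          field_simp
          ring
      change refl B (β j) (descProd (fun i => refl B (β i)) j w) = _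
      rw [ih (by omega), refl_apply_unit (hu j (by omega)), h1, Finset.sum_range_succ]
      module
  cases j with
  | zero => simpa [descProd, reflGroup] using hh
  | succ j =>
    exfalso
    change B w (descProd (fun i => refl B (β i)) (j + 1) (h w) - w) = 0 at hgw
    rw [hhw, hdesc _ hj, sub_sub_cancel_left, map_neg, map_smul, map_sum,
      Finset.sum_range_succ', hw, Finset.sum_eq_zero, zero_add, smul_eq_mul, mul_one,
      neg_eq_zero] at hgw
    · exact h2 hgw
    · intro i hi
      exact hw' _ (by omega) (by have := Finset.mem_range.1 hi; omega)

end Braid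

section Adjacent

variable {p : ℕ} [Fact p.Prime] {W : Type*} [AddCommGroup W] [Module (ZMod p) W]
variable {B : LinearMap.BilinForm (ZMod p) W} {n k l : ℕ} {b w : ℕ → W}

theorem reflGroup_comp (β : ℕ → ℕ) (I : Set ℕ) :
    reflGroup B (fun i => b (β i)) I = reflGroup B b (β '' I) := by
  rw [reflGroup, reflGroup, Set.image_image]

theorem IsDiagram.mem_reflGroup_of_three_left (D : IsDiagram B n k l b w)
    (h2 : (2 : ZMod p) ≠ 0) {s t : ℕ} (hst : s < t) (ht : t ≤ n)
    (h3 : ∀ i, s ≤ i → i + 1 < t → i < k ∨ k + l ≤ i) {g : W ≃ₗ[ZMod p] W}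
    (hg : g ∈ reflGroup B b (Set.Ico s t)) (hgs : B (w s) (g (w s) - w s) = 0) :
    g ∈ reflGroup B b (Set.Ico (s + 1) t) := by
  have himg : ∀ c, (fun j => s + j) '' Set.Ico c (t - s) = Set.Ico (s + c) t := by
    intro c
    ext x
    simp only [Set.mem_image, Set.mem_Ico]
    exact ⟨by rintro ⟨j, hj, rfl⟩; omega, fun h => ⟨x - s, by omega, by omega⟩⟩
  rw [← himg, ← reflGroup_comp]
  refine mem_reflGroup_of_braid (β := fun i => b (s + i)) (w := w s) D.symm h2
    (fun i hi => D.unit _ (by omega))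
    (fun i hi => D.three (s + i) (h3 _ (by omega) (by omega)) (by omega))
    (fun i j hij hj => D.far _ _ (by omega) (by omega)) (D.dual_self s (by omega))
    (fun i h1 hi => D.dual_ne _ (by omega) _ (by omega) (by omega)) ?_ hgs
  rwa [reflGroup_comp, himg]

theorem IsDiagram.mem_reflGroup_of_three_right (D : IsDiagram B n k l b w)
    (h2 : (2 : ZMod p) ≠ 0) {s t : ℕ} (hst : s < t) (ht : t < n)
    (h3 : ∀ i, s < i → i < t → i < k ∨ k + l ≤ i) {g : W ≃ₗ[ZMod p] W}
    (hg : g ∈ reflGroup B b (Set.Ico (s + 1) (t + 1))) (hgt : B (w t) (g (w t) - w t) = 0) :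
    g ∈ reflGroup B b (Set.Ico (s + 1) t) := by
  have himg : ∀ c ≤ 1, (fun j => t - j) '' Set.Ico c (t - s) = Set.Ico (s + 1) (t + 1 - c) := by
    intro c hc
    ext x
    simp only [Set.mem_image, Set.mem_Ico]
    exact ⟨by rintro ⟨j, hj, rfl⟩; omega, fun h => ⟨t - x, by omega, by omega⟩⟩
  have h1 := himg 1 le_rfl
  rw [Nat.add_sub_cancel] at h1
  rw [← h1, ← reflGroup_comp]
  refine mem_reflGroup_of_braid (β := fun i => b (t - i)) (w := w t) D.symm h2
    (fun i hi => D.unit _ (by omega))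
    (fun i hi => ?_) (fun i j hij hj => ?_) (D.dual_self t (by omega))
    (fun i h1 hi => D.dual_ne _ (by omega) _ (by omega) (by omega)) ?_ hgt
  · have := D.three (t - (i + 1)) (h3 _ (by omega) (by omega)) (by omega)
    rwa [show t - (i + 1) + 1 = t - i by omega, D.symm] at this
  · rw [D.symm]
    exact D.far _ _ (by omega) (by omega)
  · rw [reflGroup_comp, himg 0 (Nat.zero_le _), Nat.sub_zero]
    exact hg

theorem IsDiagram.inf_Ico_le (D : IsDiagram B n k l b w) (h2 : (2 : ZMod p) ≠ 0)
    (h3 : (3 : ZMod p) ≠ 0)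
    (hsq : ∀ d, B d d ≠ 0 → refl B d ∈ reflGroup B b (Set.Iio n) → IsSquare (B d d))
    (hl : 1 ≤ l) {s t : ℕ} (ht : t < n) :
    reflGroup B b (Set.Ico s t) ⊓ reflGroup B b (Set.Ico (s + 1) (t + 1)) ≤
      reflGroup B b (Set.Ico (s + 1) t) := by
  rintro g ⟨hg1, hg2⟩
  have hiso := isIsom_of_mem_reflGroup D.symm g hg1
  have hg : ∀ x, g x - x ∈ vspan p b (Set.Ico (s + 1) t) := by
    intro x
    have h := D.mem_vspan_diff (fun i hi => by have := hi.2; omega) ht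
      (apply_sub_mem_vspan hg2 x) (D.dual_eq_zero (fun i hi => hi.2.trans ht) ht
        (fun h => lt_irrefl _ h.2) (apply_sub_mem_vspan hg1 x))
    refine vspan_mono ?_ h
    rintro i ⟨⟨h1, h2⟩, h3⟩
    exact ⟨h1, by simp only [Set.mem_singleton_iff] at h3; omega⟩
  rcases lt_trichotomy t (s + 2) with hst | rfl | hst
  · have : g = 1 := by
      ext x
      have h := hg x
      rw [Set.Ico_eq_empty (by omega), vspan, Set.image_empty, Submodule.span_empty,
        Submodule.mem_bot, sub_eq_zero] at h
      exact h
    rw [this]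
    exact one_mem _
  · have hs : Set.Ico (s + 1) (s + 2) = {s + 1} := by
      ext x
      simp only [Set.mem_Ico, Set.mem_singleton_iff]
      omega
    rw [hs] at hg ⊢
    exact D.mem_reflGroup_singleton (by omega) hiso hg
  · by_cases hinf : ∃ i, s + 1 ≤ i ∧ i + 1 < t ∧ k ≤ i ∧ i < k + l
    · obtain ⟨i, hsi, hit, hki, hil⟩ := hinf
      refine (D.isGood_Ico h2 h3 hsq (t - (s + 1)) (s + 1) t i (by omega) (by omega) hsi hit hki
        hil).2 g (reflGroup_mono ?_ hg1) hg
      exact fun j hj => lt_trans hj.2 ht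
    · push Not at hinf
      have hsplit : ∀ i, s + 1 ≤ i → i + 1 < t → i < k ∨ k + l ≤ i := by
        intro i h1 h2
        have := hinf i h1 h2
        omega
      by_cases hk : t - 2 < k
      · exact D.mem_reflGroup_of_three_left h2 (by omega) (by omega)
          (fun i _ _ => Or.inl (by omega)) hg1
          (D.dual_eq_zero (fun i hi => hi.2.trans ht) (by omega) (fun h => by simp at h) (hg _))
      · have hkl : k + l ≤ s + 1 := by
          by_contra hlt
          have h1 := hsplit (max k (s + 1)) (le_max_right _ _) (by omega)
          have h4 := hsplit (t - 2) (by omega) (by omega)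
          omega
        exact D.mem_reflGroup_of_three_right h2 (by omega) ht
          (fun i _ _ => Or.inr (by omega)) hg2
          (D.dual_eq_zero (fun i hi => hi.2.trans ht) ht (fun h => by simp at h) (hg _))

end Adjacent

section Lift

theorem inter_closure_of_lift {ι G H : Type*} [Group G] [Group H] {ρ : ι → G} {σ : ι → H}
    (h : ∀ q ∈ Subgroup.closure (Set.range fun i => (ρ i, σ i)), q.1 = 1 ↔ q.2 = 1)
    (hρ : ∀ I J : Set ι, Subgroup.closure (ρ '' I) ⊓ Subgroup.closure (ρ '' J) =
      Subgroup.closure (ρ '' (I ∩ J))) (I J : Set ι) :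
    Subgroup.closure (σ '' I) ⊓ Subgroup.closure (σ '' J) = Subgroup.closure (σ '' (I ∩ J)) := by
  set P : Set ι → Subgroup (G × H) := fun I => Subgroup.closure ((fun i => (ρ i, σ i)) '' I)
  have hP : ∀ I, P I ≤ Subgroup.closure (Set.range fun i => (ρ i, σ i)) :=
    fun I => Subgroup.closure_mono (Set.image_subset_range _ _)
  have hfst : ∀ I, (P I).map (MonoidHom.fst G H) = Subgroup.closure (ρ '' I) := fun I => by
    rw [MonoidHom.map_closure, Set.image_image]
    rfl
  have hsnd : ∀ I, (P I).map (MonoidHom.snd G H) = Subgroup.closure (σ '' I) := fun I => by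
    rw [MonoidHom.map_closure, Set.image_image]
    rfl
  have hdiv : ∀ {I J : Set ι} {x y : G × H}, x ∈ P I → y ∈ P J → (x.1 = y.1 ↔ x.2 = y.2) := by
    intro I J x y hx hy
    have := h (x * y⁻¹) (mul_mem (hP _ hx) (inv_mem (hP _ hy)))
    simpa [mul_inv_eq_one] using this
  refine le_antisymm ?_ (le_inf (Subgroup.closure_mono (Set.image_mono Set.inter_subset_left))
    (Subgroup.closure_mono (Set.image_mono Set.inter_subset_right)))
  rintro g ⟨hI, hJ⟩
  rw [SetLike.mem_coe, ← hsnd] at hI hJ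
  obtain ⟨x, hx, rfl⟩ := hI
  obtain ⟨y, hy, hxy⟩ := hJ
  have hx1 : x.1 ∈ Subgroup.closure (ρ '' I) := by
    rw [← hfst]
    exact ⟨x, hx, rfl⟩
  have hy1 : x.1 ∈ Subgroup.closure (ρ '' J) := by
    rw [← hfst, (hdiv hx hy).2 hxy.symm]
    exact ⟨y, hy, rfl⟩
  have hz := Subgroup.mem_inf.2 ⟨hx1, hy1⟩
  rw [hρ, ← hfst] at hz
  obtain ⟨z, hz, hzx⟩ := hz
  rw [← hsnd]
  exact ⟨z, hz, (hdiv hz hx).1 hzx⟩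

theorem IsDiagram.inter_closure {p : ℕ} [Fact p.Prime] {W : Type*} [AddCommGroup W]
    [Module (ZMod p) W] {B : LinearMap.BilinForm (ZMod p) W} {n k l : ℕ} {b w : ℕ → W}
    (D : IsDiagram B n k l b w) (h2 : (2 : ZMod p) ≠ 0) (h3 : (3 : ZMod p) ≠ 0)
    (hsq : ∀ d, B d d ≠ 0 → refl B d ∈ reflGroup B b (Set.Iio n) → IsSquare (B d d))
    (hl : 1 ≤ l) (I J : Set (Fin n)) :
    Subgroup.closure ((fun i : Fin n => refl B (b i)) '' I) ⊓
      Subgroup.closure ((fun i : Fin n => refl B (b i)) '' J) =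
        Subgroup.closure ((fun i : Fin n => refl B (b i)) '' (I ∩ J)) := by
  have himg : ∀ s t, t ≤ n → Subgroup.closure ((fun i : Fin n => refl B (b i)) '' idx n s t) =
      reflGroup B b (Set.Ico s t) := by
    intro s t ht
    rw [reflGroup]
    congr 1
    ext g
    constructor
    · rintro ⟨i, hi, rfl⟩
      exact ⟨i, hi, rfl⟩
    · rintro ⟨i, hi, rfl⟩
      exact ⟨⟨i, lt_of_lt_of_le hi.2 ht⟩, hi, rfl⟩
  refine closure_inf_closure_of_idx (fun i j hij => refl_commute D.symm (D.unit _ i.2)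
    (D.far _ _ hij j.2)) (fun s t => ?_) I J
  by_cases ht : t < n
  · rw [himg _ _ ht.le, himg _ _ ht, himg _ _ ht.le]
    exact D.inf_Ico_le h2 h3 hsq hl ht
  · exact inf_le_right.trans (closure_image_mono _ fun i hi => ⟨hi.1, by have := i.2; omega⟩)

variable {F : Type*} [Field F] {n : ℕ}

/-- The extension of the bilinear form `M` on `V` to `V × V`, in which the second factor is
totally isotropic and dual to the first one. -/
noncomputable def extForm (M : Matrix (Fin n) (Fin n) F) :
    LinearMap.BilinForm F ((Fin n → F) × (Fin n → F)) :=
  (Matrix.toBilin' M).compl₁₂ (LinearMap.fst F _ _) (LinearMap.fst F _ _) +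
    ((Matrix.toBilin' 1).compl₁₂ (LinearMap.snd F _ _) (LinearMap.fst F _ _) +
      (Matrix.toBilin' 1).compl₁₂ (LinearMap.fst F _ _) (LinearMap.snd F _ _))

theorem extForm_apply (M : Matrix (Fin n) (Fin n) F) (u v : (Fin n → F) × (Fin n → F)) :
    extForm M u v = Matrix.toBilin' M u.1 v.1 + (u.2 ⬝ᵥ v.1 + u.1 ⬝ᵥ v.2) := by
  simp [extForm, Matrix.toBilin'_apply']

theorem extForm_symm {M : Matrix (Fin n) (Fin n) F} (hM : ∀ i j, M i j = M j i)
    (u v : (Fin n → F) × (Fin n → F)) : extForm M u v = extForm M v u := by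
  have h : Matrix.toBilin' M u.1 v.1 = Matrix.toBilin' M v.1 u.1 := by
    rw [Matrix.toBilin'_apply, Matrix.toBilin'_apply, Finset.sum_comm]
    exact Finset.sum_congr rfl fun i _ => Finset.sum_congr rfl fun j _ => by rw [hM j i]; ring
  rw [extForm_apply, extForm_apply, h, dotProduct_comm u.2, dotProduct_comm u.1]
  ring

theorem exists_extForm_eq (M : Matrix (Fin n) (Fin n) F)
    (f : Module.Dual F ((Fin n → F) × (Fin n → F))) : ∃ v, ∀ x, extForm M v x = f x := by
  set c : Fin n → F := fun i => f (0, Pi.single i 1) with hc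
  refine ⟨(c, fun i => f (Pi.single i 1, 0) - Matrix.toBilin' M c (Pi.single i 1)), fun x => ?_⟩
  refine LinearMap.congr_fun (f := extForm M _) (g := f) ?_ x
  refine LinearMap.prod_ext (LinearMap.pi_ext' fun i => LinearMap.ext_ring ?_)
    (LinearMap.pi_ext' fun i => LinearMap.ext_ring ?_)
  · simp [extForm_apply]
  · simp [extForm_apply, hc]

theorem eq_zero_of_tridiagonal {M : Matrix (Fin n) (Fin n) F}
    (hfar : ∀ i j : Fin n, (j : ℕ) + 2 ≤ i → M i j = 0)
    (hadj : ∀ i j : Fin n, (i : ℕ) = j + 1 → M i j ≠ 0) {x : Fin n → F}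
    (hx : ∀ j, ∑ i, x i * M i j = 0) (hx0 : ∀ i : Fin n, (i : ℕ) = 0 → x i = 0) : x = 0 := by
  have h : ∀ a : ℕ, ∀ i : Fin n, (i : ℕ) = a → x i = 0 := by
    intro a
    induction a using Nat.strong_induction_on with
    | _ a ih =>
      intro i hi
      cases a with
      | zero => exact hx0 i hi
      | succ a =>
        have h1 := hx ⟨a, by omega⟩
        rw [Finset.sum_eq_single i] at h1
        · exact (mul_eq_zero.1 h1).resolve_right (hadj _ _ hi)
        · intro j _ hji
          rcases lt_or_ge (j : ℕ) (a + 1) with hj | hj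
          · rw [ih j hj j rfl, zero_mul]
          · have : (j : ℕ) ≠ i := fun h => hji (Fin.ext h)
            rw [hfar j _ (by change a + 2 ≤ (j : ℕ); omega), mul_zero]
        · simp
  funext i
  exact h i i rfl

theorem eq_one_of_apply_fst {M : Matrix (Fin n) (Fin n) F} (h2 : (2 : F) ≠ 0)
    (hfar : ∀ i j : Fin n, (j : ℕ) + 2 ≤ i → M i j = 0)
    (hadj : ∀ i j : Fin n, (i : ℕ) = j + 1 → M i j ≠ 0) (hn : 0 < n)
    {g : ((Fin n → F) × (Fin n → F)) ≃ₗ[F] ((Fin n → F) × (Fin n → F))}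
    (hg : IsIsom (extForm M) g) (hg2 : ∀ x, (g x).2 = x.2) (hg1 : ∀ x, g (x, 0) = (x, 0)) :
    g = 1 := by
  set u : (Fin n → F) → Fin n → F := fun f => (g (0, f)).1 with hu
  have hgu : ∀ f, g (0, f) = (u f, f) := fun f => Prod.ext rfl (hg2 _)
  have hrad : ∀ f x, Matrix.toBilin' M (u f) x = 0 := by
    intro f x
    have h := hg (0, f) (x, 0)
    rw [hgu, hg1, extForm_apply, extForm_apply] at h
    simpa using h
  have hskew : ∀ f f', f ⬝ᵥ u f' + u f ⬝ᵥ f' = 0 := by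
    intro f f'
    have h := hg (0, f) (0, f')
    rw [hgu, hgu, extForm_apply, extForm_apply, hrad] at h
    simpa using h
  have hzero : ∀ f, u f ⟨0, hn⟩ = 0 → u f = 0 := by
    intro f hf
    refine eq_zero_of_tridiagonal hfar hadj (fun j => ?_) fun i hi => ?_
    · have h := hrad f (Pi.single j 1)
      rw [Matrix.toBilin'_apply] at h
      simpa [Pi.single_apply] using h
    · rwa [show i = ⟨0, hn⟩ from Fin.ext hi]
  have hu0 : u (Pi.single ⟨0, hn⟩ 1) = 0 := by
    refine hzero _ ?_
    have h := hskew (Pi.single ⟨0, hn⟩ 1) (Pi.single ⟨0, hn⟩ 1)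
    simp only [single_dotProduct, dotProduct_single, one_mul, mul_one, ← two_mul] at h
    exact (mul_eq_zero.1 h).resolve_left h2
  have huf : ∀ f, u f = 0 := by
    intro f
    refine hzero f ?_
    have h := hskew f (Pi.single ⟨0, hn⟩ 1)
    rwa [hu0, dotProduct_zero, zero_add, dotProduct_single, mul_one] at h
  refine LinearEquiv.ext fun x => ?_
  have hx : x = (x.1, 0) + (0, x.2) := by simp
  change g x = x
  rw [hx, map_add, hg1, hgu, huf]

end Lift

section Main

theorem gram_symm (p k l m : ℕ) (i j : Fin (k + l + m + 1)) :
    gram p k l m i j = gram p k l m j i := by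
  unfold gram
  split_ifs <;> first | rfl | omega

theorem gram_of_add_two_le (p k l m : ℕ) {i j : Fin (k + l + m + 1)} (h : (j : ℕ) + 2 ≤ i) :
    gram p k l m i j = 0 := by
  unfold gram
  split_ifs <;> first | rfl | omega

theorem gram_ne_zero {p k l m : ℕ} [Fact p.Prime] (h2 : (2 : ZMod p) ≠ 0)
    {i j : Fin (k + l + m + 1)} (h : (i : ℕ) = j + 1) : gram p k l m i j ≠ 0 := by
  unfold gram
  rw [if_neg (by omega), if_neg (by omega), if_pos h]
  split_ifs
  · exact neg_ne_zero.2 (inv_ne_zero h2)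
  · exact neg_ne_zero.2 one_ne_zero

theorem form_eq_toBilin' (p k l m : ℕ) (x y : Fin (k + l + m + 1) → ZMod p) :
    form p k l m x y = Matrix.toBilin' (gram p k l m) x y :=
  (Matrix.toBilin'_apply _ _ _).symm

/-- The `i`-th standard basis vector of `(ZMod p)^n`, and zero for `i ≥ n`. -/
def stdVec (p n i : ℕ) : Fin n → ZMod p :=
  if h : i < n then Pi.single ⟨i, h⟩ 1 else 0

theorem stdVec_of_lt {p n i : ℕ} (h : i < n) : stdVec p n i = Pi.single ⟨i, h⟩ 1 :=
  dif_pos h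

theorem isDiagram_extForm (p k l m : ℕ) [Fact p.Prime] :
    IsDiagram (extForm (gram p k l m)) (k + l + m + 1) k l
      (fun i => (stdVec p (k + l + m + 1) i, 0)) (fun i => (0, stdVec p (k + l + m + 1) i)) := by
  have hbb : ∀ i j (hi : i < k + l + m + 1) (hj : j < k + l + m + 1),
      extForm (gram p k l m) (stdVec p (k + l + m + 1) i, 0) (stdVec p (k + l + m + 1) j, 0) =
        gram p k l m ⟨i, hi⟩ ⟨j, hj⟩ := by
    intro i j hi hj
    rw [extForm_apply, stdVec_of_lt hi, stdVec_of_lt hj]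
    simp
  refine ⟨extForm_symm (gram_symm p k l m), fun i hi => ?_, fun i h1 h2 hi => ?_,
    fun i h hi => ?_, fun i j hij hj => ?_, fun i hi => ?_, fun i hi j hj hij => ?_,
    fun i hi j hj => ?_⟩
  · rw [hbb i i hi hi, gram, if_pos rfl]
  · rw [hbb i (i + 1) (by omega) hi, gram, if_neg (by simp), if_pos rfl,
      if_neg (by simp only; omega)]
  · rw [hbb i (i + 1) (by omega) hi, gram, if_neg (by simp), if_pos rfl,
      if_pos (by simp only; omega)]
  · rw [hbb i j (by omega) hj, gram_symm]
    exact gram_of_add_two_le p k l m hij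
  · rw [extForm_apply, stdVec_of_lt hi]
    simp
  · rw [extForm_apply, stdVec_of_lt hi, stdVec_of_lt hj]
    simpa [Pi.single_apply] using Ne.symm hij
  · simp [extForm_apply]

end Main

/-- for `[3^k, ∞^l, 3^m]` with `k, l, m ≥ 1` and `k > 1` or `m > 1`,
there is a finite set `S` of primes such that `[3^k, ∞^l, 3^m]ᵖ` is a string C-group
for every odd prime `p ∉ S`. -/
theorem statement11 (k l m : ℕ) (hk : 1 ≤ k) (hl : 1 ≤ l) (hm : 1 ≤ m)
    (hkm : 1 < k ∨ 1 < m) :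
    ∃ S : Finset ℕ, ∀ p : ℕ, p.Prime → p ≠ 2 → p ∉ S →
      ∀ r : Fin (k + l + m + 1) → GLV p k l m, ReflHyp p k l m r →
        IsStringC p k l m r := by
  refine ⟨{3}, fun p hp hp2 hp3 r hr => ?_⟩
  have : Fact p.Prime := ⟨hp⟩
  have h2 : (2 : ZMod p) ≠ 0 := fun h => hp2
    ((Nat.prime_dvd_prime_iff_eq hp Nat.prime_two).1 ((ZMod.natCast_eq_zero_iff 2 p).1 h))
  have h3 : (3 : ZMod p) ≠ 0 := fun h => hp3 (Finset.mem_singleton.2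
    ((Nat.prime_dvd_prime_iff_eq hp Nat.prime_three).1 ((ZMod.natCast_eq_zero_iff 3 p).1 h)))
  have D := isDiagram_extForm p k l m
  let : Invertible (2 : ZMod p) := invertibleOfNonzero h2
  refine inter_closure_of_lift (fun q hq => ?_) (D.inter_closure h2 h3 (fun d hd hmem => ?_) hl)
  · have key : IsIsom (extForm (gram p k l m)) q.1 ∧ (∀ x, (q.1 x).2 = x.2) ∧
        ∀ x, q.1 (x, 0) = (q.2.1 x, 0) := by
      induction hq using Subgroup.closure_induction with
      | mem q hq =>
        obtain ⟨i, rfl⟩ := hq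
        have hu := D.unit i i.2
        refine ⟨isIsom_refl D.symm _, fun x => ?_, fun x => ?_⟩
        · rw [refl_apply_unit hu]
          simp
        · have hs := stdVec_of_lt (p := p) i.2
          simp only at hu ⊢
          rw [refl_apply_unit hu, hr, D.symm, extForm_apply, form_eq_toBilin', hs]
          simp
      | one => exact ⟨fun x y => rfl, fun x => rfl, fun x => rfl⟩
      | mul a b _ _ ha hb =>
        refine ⟨ha.1.mul hb.1, fun x => (ha.2.1 _).trans (hb.2.1 x), fun x => ?_⟩
        change a.1 (b.1 (x, 0)) = (a.2.1 (b.2.1 x), 0)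
        rw [hb.2.2, ha.2.2]
      | inv a _ ha =>
        have h1 : ∀ x, a.1 (a.1⁻¹ x) = x := a.1.apply_symm_apply
        refine ⟨ha.1.inv, fun x => ?_, fun x => ?_⟩
        · rw [← ha.2.1, Prod.fst_inv, h1]
        · refine a.1.symm_apply_eq.2 ?_
          rw [ha.2.2, ← Module.End.mul_apply, ← Units.val_mul, Prod.snd_inv, mul_inv_cancel]
          rfl
    constructor
    · intro h
      refine Units.ext (LinearMap.ext fun x => ?_)
      have := key.2.2 x
      rw [h] at this
      exact (congrArg Prod.fst this).symm
    · intro h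
      refine eq_one_of_apply_fst h2 (fun i j hij => gram_of_add_two_le p k l m hij)
        (fun i j hij => gram_ne_zero h2 hij) (Nat.succ_pos _) key.1 key.2.1 fun x => ?_
      rw [key.2.2, h]
      rfl
  · refine isSquare_of_refl_mem_closure (Module.finBasis (ZMod p) _) D.symm
      (exists_extForm_eq _) ?_ hd hmem
    rintro _ ⟨i, hi, rfl⟩
    exact ⟨_, D.unit i hi, rfl⟩

end Statement11
end

section
/- Let G = [3^k] (the case l = m = 0), with k ≥ 1 and n = k + 1, acting on the (k+1)-dimensional space V = (ZMod p)^{k+1}, and let p ≥ 5 be prime with p ∤ (k+2). Then the bilinear form on V is nondegenerate, G^p is contained in O_1(V), and G^p = O_1(V) if and only if k = 1 and p ∈ {5, 7}. -/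
/- Setup: the reduction mod an odd prime `p` of the `3`-infinity Coxeter group
`[3^k, ∞^l, 3^m]`, acting on `V = (ZMod p)^n` with `n = k + l + m + 1`. -/

namespace Statement12

/-- The Gram matrix of the basic system for `[3^k, ∞^l, 3^m]`, reduced mod `p`:
diagonal entries `1`; the entry for the branch `{i−1, i}` is `−2⁻¹` if the branch is
labelled `3` (i.e. `1 ≤ i ≤ k` or `k+l+1 ≤ i ≤ n−1`) and `−1` if it is labelled `∞`
(i.e. `k+1 ≤ i ≤ k+l`); all other entries `0`. -/
def gram (p k l m : ℕ) : Matrix (Fin (k + l + m + 1)) (Fin (k + l + m + 1)) (ZMod p) :=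
  fun i j =>
    if i = j then 1
    else if (j : ℕ) = (i : ℕ) + 1 then
      (if (j : ℕ) ≤ k ∨ k + l + 1 ≤ (j : ℕ) then -(2⁻¹ : ZMod p) else -1)
    else if (i : ℕ) = (j : ℕ) + 1 then
      (if (i : ℕ) ≤ k ∨ k + l + 1 ≤ (i : ℕ) then -(2⁻¹ : ZMod p) else -1)
    else 0

/-- The corresponding symmetric bilinear form `x·y` on `V`. -/
def form (p k l m : ℕ) (x y : Fin (k + l + m + 1) → ZMod p) : ZMod p :=
  ∑ i, ∑ j, x i * gram p k l m i j * y j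

/-- The general linear group of `V`. -/
abbrev GLV (p k l m : ℕ) := (Module.End (ZMod p) (Fin (k + l + m + 1) → ZMod p))ˣ

/-- `r i` is the generating reflection `r_i : x ↦ x − 2(x·b_i) b_i`. -/
def ReflHyp (p k l m : ℕ) (r : Fin (k + l + m + 1) → GLV p k l m) : Prop :=
  ∀ i x, (r i).1 x =
    x - (2 * form p k l m x (Pi.single i 1)) •
      (Pi.single i 1 : Fin (k + l + m + 1) → ZMod p)

/-- The intersection property (string C-group condition). -/
def IsStringC (p k l m : ℕ) (r : Fin (k + l + m + 1) → GLV p k l m) : Prop :=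
  ∀ I J : Set (Fin (k + l + m + 1)),
    Subgroup.closure (r '' I) ⊓ Subgroup.closure (r '' J) = Subgroup.closure (r '' (I ∩ J))

/-- `O₁(V)` (written `Ô₁(V)` when the form on `V` is degenerate): the subgroup of `O(V)`
generated by all reflections `r_a : x ↦ x − 2((x·a)/(a·a)) a` with `a·a` a nonzero square. -/
def O1 (p k l m : ℕ) : Subgroup (GLV p k l m) :=
  Subgroup.closure {g | ∃ a : Fin (k + l + m + 1) → ZMod p,
    (∃ t : ZMod p, t ≠ 0 ∧ form p k l m a a = t ^ 2) ∧
    ∀ x, g.1 x = x - (2 * form p k l m x a * (form p k l m a a)⁻¹) • a}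

/-- Coordinate `j` of `x`, extended by zero to all natural indices. -/
def extCoord {p n : ℕ} (x : Fin n → ZMod p) (j : ℕ) : ZMod p :=
  if h : j < n then x ⟨j, h⟩ else 0

/-- The successive differences of the coordinates of `x`: the image of `x` under the embedding
of the root lattice of type `A` into the hyperplane of vectors with coordinate sum zero. -/
def diffCoord {p n : ℕ} (x : Fin n → ZMod p) : ℕ → ZMod p
  | 0 => extCoord x 0
  | j + 1 => extCoord x (j + 1) - extCoord x j

lemma extCoord_val {p n : ℕ} (x : Fin n → ZMod p) (i : Fin n) : extCoord x i = x i := by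
  simp [extCoord]

lemma extCoord_of_le {p n : ℕ} (x : Fin n → ZMod p) {j : ℕ} (h : n ≤ j) : extCoord x j = 0 := by
  simp [extCoord, h]

lemma diffCoord_neg {p n : ℕ} (x : Fin n → ZMod p) (j : ℕ) :
    diffCoord (-x) j = -diffCoord x j := by
  have h : ∀ i, extCoord (-x) i = -extCoord x i := fun i => by
    unfold extCoord; split_ifs <;> simp
  cases j with
  | zero => exact h 0
  | succ j => simp only [diffCoord, h]; ring

lemma sum_mul_ite_val_eq {p n : ℕ} (x : Fin n → ZMod p) (m : ℕ) (c : ZMod p) :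
    ∑ j : Fin n, x j * (if (j : ℕ) = m then c else 0) = extCoord x m * c := by
  by_cases h : m < n
  · rw [Finset.sum_eq_single ⟨m, h⟩]
    · simp [extCoord, h]
    · intro b _ hb
      rw [if_neg (fun h' => hb (Fin.ext h')), mul_zero]
    · simp
  · rw [Finset.sum_eq_zero]
    · simp [extCoord, h]
    · intro b _
      rw [if_neg (by omega), mul_zero]

lemma form_add_left (p k l m : ℕ) (x y z : Fin (k + l + m + 1) → ZMod p) :
    form p k l m (x + y) z = form p k l m x z + form p k l m y z := by
  simp only [form, ← Finset.sum_add_distrib, Pi.add_apply]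
  exact Finset.sum_congr rfl fun i _ => Finset.sum_congr rfl fun j _ => by ring

lemma form_smul_left (p k l m : ℕ) (c : ZMod p) (x z : Fin (k + l + m + 1) → ZMod p) :
    form p k l m (c • x) z = c * form p k l m x z := by
  simp only [form, Finset.mul_sum, Pi.smul_apply, smul_eq_mul]
  exact Finset.sum_congr rfl fun i _ => Finset.sum_congr rfl fun j _ => by ring

lemma form_eq_sum_single (p k l m : ℕ) (x y : Fin (k + l + m + 1) → ZMod p) :
    form p k l m x y = ∑ j, form p k l m x (Pi.single j 1) * y j := by
  have h : ∀ j, form p k l m x (Pi.single j 1) = ∑ i, x i * gram p k l m i j := fun j => by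
    simp [form, Pi.single_apply]
  simp only [h, Finset.sum_mul]
  exact Finset.sum_comm

lemma two_mul_form_single {p k : ℕ} (h2 : (2 : ZMod p) * 2⁻¹ = 1)
    (x : Fin (k + 0 + 0 + 1) → ZMod p) (i : Fin (k + 0 + 0 + 1)) :
    2 * form p k 0 0 x (Pi.single i 1) = diffCoord x i - diffCoord x (i + 1) := by
  have hform : form p k 0 0 x (Pi.single i 1) = ∑ j, x j * gram p k 0 0 j i := by
    simp [form, Pi.single_apply]
  obtain ⟨i, hi⟩ := i
  cases i with
  | zero =>
    have hg : ∀ j, gram p k 0 0 j ⟨0, hi⟩ = (if (j : ℕ) = 0 then 1 else 0)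
        + (if (j : ℕ) = 1 then -(2⁻¹ : ZMod p) else 0) := fun j => by
      have := j.2
      simp only [gram, Fin.ext_iff]
      split_ifs <;> first | omega | contradiction | simp
    rw [hform]
    simp only [hg, mul_add, Finset.sum_add_distrib, sum_mul_ite_val_eq, diffCoord]
    linear_combination (-extCoord x 1) * h2
  | succ i =>
    have hg : ∀ j, gram p k 0 0 j ⟨i + 1, hi⟩ = (if (j : ℕ) = i + 1 then 1 else 0)
        + (if (j : ℕ) = i then -(2⁻¹ : ZMod p) else 0)
        + (if (j : ℕ) = i + 2 then -(2⁻¹ : ZMod p) else 0) := fun j => by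
      have := j.2
      simp only [gram, Fin.ext_iff]
      split_ifs <;> first | omega | contradiction | simp
    rw [hform]
    simp only [hg, mul_add, Finset.sum_add_distrib, sum_mul_ite_val_eq, diffCoord]
    linear_combination (-extCoord x i - extCoord x (i + 2)) * h2

/-- The reflection in a vector `a` with `a·a ≠ 0`, as an element of `GL(V)`. -/
lemma exists_reflection {p k l m : ℕ} [Fact p.Prime] (a : Fin (k + l + m + 1) → ZMod p)
    (ha : form p k l m a a ≠ 0) :
    ∃ g : GLV p k l m, ∀ x,
      g.1 x = x - (2 * form p k l m x a * (form p k l m a a)⁻¹) • a := by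
  let f : Module.End (ZMod p) (Fin (k + l + m + 1) → ZMod p) :=
    { toFun := fun x => x - (2 * form p k l m x a * (form p k l m a a)⁻¹) • a
      map_add' := fun x y => by
        rw [form_add_left]; module
      map_smul' := fun c x => by
        rw [form_smul_left, RingHom.id_apply]; module }
  have hf : f * f = 1 := by
    refine LinearMap.ext fun x => ?_
    change (x - (2 * form p k l m x a * (form p k l m a a)⁻¹) • a)
      - (2 * form p k l m (x - (2 * form p k l m x a * (form p k l m a a)⁻¹) • a) a
        * (form p k l m a a)⁻¹) • a = x
    rw [sub_eq_add_neg x, ← neg_smul, form_add_left, form_smul_left, add_sub_assoc, ← sub_smul]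
    convert add_zero x
    convert zero_smul (ZMod p) a
    field_simp
    ring
  exact ⟨⟨f, f, hf, hf⟩, fun _ => rfl⟩

/-- The generating reflections permute the successive differences, hence so does the group they
generate. -/
lemma exists_perm_of_mem_closure {p k : ℕ} (h2 : (2 : ZMod p) * 2⁻¹ = 1)
    {r : Fin (k + 0 + 0 + 1) → GLV p k 0 0} (hr : ReflHyp p k 0 0 r) {g : GLV p k 0 0}
    (hg : g ∈ Subgroup.closure (Set.range r)) :
    ∃ σ : Equiv.Perm (Fin (k + 2)), ∀ (x : Fin (k + 0 + 0 + 1) → ZMod p) (j : Fin (k + 2)),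
      diffCoord (g.1 x) j = diffCoord x (σ j) := by
  induction hg using Subgroup.closure_induction with
  | one => exact ⟨1, fun x j => rfl⟩
  | mul g h _ _ ihg ihh =>
    obtain ⟨σ, hσ⟩ := ihg
    obtain ⟨τ, hτ⟩ := ihh
    refine ⟨τ * σ, fun x j => ?_⟩
    change diffCoord (g.1 (h.1 x)) j = _
    rw [hσ, hτ]; rfl
  | inv g _ ihg =>
    obtain ⟨σ, hσ⟩ := ihg
    refine ⟨σ⁻¹, fun x j => ?_⟩
    have h := hσ (g⁻¹.1 x) (σ⁻¹ j)
    have hx : g.1 (g⁻¹.1 x) = x := LinearMap.congr_fun g.mul_inv x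
    rw [hx] at h
    simpa using h.symm
  | mem g hg =>
    obtain ⟨i, rfl⟩ := hg
    have hi := i.2
    refine ⟨Equiv.swap ⟨i, by omega⟩ ⟨i + 1, by omega⟩, fun x j => ?_⟩
    have hext : ∀ m : ℕ, extCoord ((r i).1 x) m
        = extCoord x m - (if m = i then diffCoord x i - diffCoord x (i + 1) else 0) := fun m => by
      rw [hr, two_mul_form_single h2]
      unfold extCoord
      by_cases hm : m < k + 0 + 0 + 1
      · simp [hm, Pi.single_apply, Fin.ext_iff]
      · rw [dif_neg hm, dif_neg hm, if_neg (by omega), sub_zero]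
    obtain ⟨j, hj⟩ := j
    obtain ⟨i, hi'⟩ := i
    simp only at hext
    have hs : ((Equiv.swap (⟨i, by omega⟩ : Fin (k + 2)) ⟨i + 1, by omega⟩ ⟨j, hj⟩ : Fin (k + 2))
        : ℕ) = if j = i then i + 1 else if j = i + 1 then i else j := by
      rw [Equiv.swap_apply_def]
      simp only [Fin.ext_iff]
      split_ifs <;> rfl
    simp only [hs]
    generalize (r ⟨i, hi'⟩).1 x = y at hext ⊢
    cases j with
    | zero =>
      by_cases h : i = 0
      · subst h
        simp [diffCoord, hext]
      · rw [if_neg (Ne.symm h), if_neg (by omega)]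
        simp [diffCoord, hext, Ne.symm h]
    | succ j =>
      by_cases h : j + 1 = i
      · subst h
        simp [diffCoord, hext]
        ring
      · by_cases h' : j = i
        · subst h'
          rw [if_neg (by omega), if_pos rfl, diffCoord, hext, hext, if_neg (by omega), if_pos rfl,
            diffCoord]
          ring
        · rw [if_neg h, if_neg (by omega)]
          simp [diffCoord, hext, h, h']

/-- The form is half the standard dot product of the successive differences, written with one
summation by parts. -/
lemma two_mul_form {p k : ℕ} (h2 : (2 : ZMod p) * 2⁻¹ = 1)
    (x y : Fin (k + 0 + 0 + 1) → ZMod p) :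
    2 * form p k 0 0 x y =
      ∑ j ∈ Finset.range (k + 1), (diffCoord x j - diffCoord x (j + 1)) * extCoord y j := by
  rw [form_eq_sum_single, Finset.mul_sum, Finset.sum_range]
  exact Finset.sum_congr rfl fun j _ => by
    rw [← mul_assoc, two_mul_form_single h2, ← extCoord_val y j]

/-- A vector of nonzero square norm whose first difference is not the negative of any of its
differences gives a reflection outside the group generated by the `r i`. -/
lemma closure_ne_O1_of_diffCoord {p k : ℕ} [Fact p.Prime] (h2 : (2 : ZMod p) * 2⁻¹ = 1)
    {r : Fin (k + 0 + 0 + 1) → GLV p k 0 0} (hr : ReflHyp p k 0 0 r)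
    (a : Fin (k + 0 + 0 + 1) → ZMod p) (t : ZMod p) (ht : t ≠ 0)
    (hat : form p k 0 0 a a = t ^ 2) (hd : ∀ j, -diffCoord a 0 ≠ diffCoord a j) :
    Subgroup.closure (Set.range r) ≠ O1 p k 0 0 := by
  intro heq
  have ha : form p k 0 0 a a ≠ 0 := by rw [hat]; exact pow_ne_zero 2 ht
  obtain ⟨g, hg⟩ := exists_reflection (k := k) (l := 0) (m := 0) a ha
  have hmem : g ∈ O1 p k 0 0 := Subgroup.subset_closure ⟨a, ⟨t, ht, hat⟩, hg⟩
  rw [← heq] at hmem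
  obtain ⟨σ, hσ⟩ := exists_perm_of_mem_closure h2 hr hmem
  have hga : g.1 a = -a := by
    rw [hg, mul_assoc, mul_inv_cancel₀ ha]
    module
  have h := hσ a 0
  rw [hga, diffCoord_neg] at h
  exact hd _ h

lemma closure_le_O1 {p k l m : ℕ} [Fact p.Prime] {r : Fin (k + l + m + 1) → GLV p k l m}
    (hr : ReflHyp p k l m r) : Subgroup.closure (Set.range r) ≤ O1 p k l m := by
  rw [Subgroup.closure_le]
  rintro _ ⟨i, rfl⟩
  have h1 : form p k l m (Pi.single i 1) (Pi.single i 1) = 1 := by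
    simp only [form, Pi.single_apply, ite_mul, mul_ite, one_mul, zero_mul, mul_one, mul_zero,
      Finset.sum_ite_eq', Finset.mem_univ, if_true]
    simp [gram]
  exact Subgroup.subset_closure ⟨Pi.single i 1, ⟨1, one_ne_zero, by rw [h1, one_pow]⟩,
    fun x => by rw [hr, h1, inv_one, mul_one]⟩

lemma eq_zero_of_form_eq_zero {p k : ℕ} [Fact p.Prime] (h2 : (2 : ZMod p) * 2⁻¹ = 1)
    (hnd : ¬ p ∣ (k + 2)) (x : Fin (k + 0 + 0 + 1) → ZMod p)
    (hx : ∀ y, form p k 0 0 x y = 0) : x = 0 := by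
  have hstep : ∀ i, i < k + 1 → diffCoord x (i + 1) = diffCoord x i := fun i hi => by
    have h := two_mul_form_single h2 x ⟨i, hi⟩
    rw [hx, mul_zero] at h
    exact (sub_eq_zero.1 h.symm).symm
  have hconst : ∀ j, j ≤ k + 1 → diffCoord x j = extCoord x 0 := by
    intro j
    induction j with
    | zero => intro _; rfl
    | succ j ih => intro hj; rw [hstep j (by omega), ih (by omega)]
  have hlin : ∀ j, j ≤ k + 1 → extCoord x j = ((j + 1 : ℕ) : ZMod p) * extCoord x 0 := by
    intro j
    induction j with
    | zero => intro _; simp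
    | succ j ih =>
      intro hj
      have h := hconst (j + 1) hj
      rw [diffCoord, ih (by omega)] at h
      push_cast at h ⊢
      linear_combination h
  have h0 : extCoord x 0 = 0 := by
    have h := hlin (k + 1) le_rfl
    rw [extCoord_of_le x le_rfl] at h
    refine (mul_eq_zero.1 h.symm).resolve_left fun h' => hnd ?_
    exact (ZMod.natCast_eq_zero_iff _ _).1 h'
  funext i
  rw [← extCoord_val x i, hlin i (by omega), h0, mul_zero]
  rfl

lemma closure_ne_O1_of_eleven_le {p k : ℕ} [Fact p.Prime] (h2 : (2 : ZMod p) * 2⁻¹ = 1)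
    (hp11 : 11 ≤ p) (hk : 1 ≤ k) {r : Fin (k + 0 + 0 + 1) → GLV p k 0 0}
    (hr : ReflHyp p k 0 0 r) : Subgroup.closure (Set.range r) ≠ O1 p k 0 0 := by
  obtain ⟨k, rfl⟩ := Nat.exists_eq_add_of_le' hk
  have hsmall : ∀ n : ℕ, 0 < n → n < 11 → ((n : ℕ) : ZMod p) ≠ 0 := fun n h0 h11 h =>
    absurd (Nat.le_of_dvd h0 ((ZMod.natCast_eq_zero_iff _ _).1 h)) (by omega)
  have h3 := hsmall 3 (by norm_num) (by norm_num)
  have h5 := hsmall 5 (by norm_num) (by norm_num)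
  have h6 := hsmall 6 (by norm_num) (by norm_num)
  have h7 := hsmall 7 (by norm_num) (by norm_num)
  have h8 := hsmall 8 (by norm_num) (by norm_num)
  push_cast at h3 h5 h6 h7 h8
  let a : Fin (k + 1 + 0 + 0 + 1) → ZMod p := fun j =>
    if (j : ℕ) = 0 then 3 else if (j : ℕ) = 1 then 8 else 0
  have ha : ∀ j, extCoord a j = if j = 0 then 3 else if j = 1 then 8 else 0 := fun j => by
    by_cases hj : j < k + 1 + 0 + 0 + 1
    · simp [extCoord, a, hj]
    · rw [extCoord_of_le a (by omega), if_neg (by omega), if_neg (by omega)]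
  refine closure_ne_O1_of_diffCoord h2 hr a 7 h7 ?_ ?_
  · have h2' : (2 : ZMod p) ≠ 0 := left_ne_zero_of_mul_eq_one h2
    apply mul_left_cancel₀ h2'
    rw [two_mul_form h2, Finset.sum_range_succ', Finset.sum_range_succ', Finset.sum_eq_zero]
    · simp [diffCoord, ha]
      norm_num
    · intro i _
      simp [ha]
  · rintro (_ | _ | _ | j) <;> simp [diffCoord, ha]
    · intro h; apply h6; linear_combination -h
    · intro h; apply h8; linear_combination -h
    · intro h; apply h5; linear_combination -h
    · exact h3

lemma eleven_eq_sq_and_neg_one_ne {p : ℕ} (hp57 : p = 5 ∨ p = 7) :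
    (∃ t : ZMod p, t ≠ 0 ∧ 11 = t ^ 2) ∧
      (-1 : ZMod p) ≠ 1 ∧ (-1 : ZMod p) ≠ 3 - 1 ∧ (1 : ZMod p) ≠ 4 := by
  rcases hp57 with rfl | rfl
  · exact ⟨⟨1, by decide, by decide⟩, by decide⟩
  · exact ⟨⟨2, by decide, by decide⟩, by decide⟩

lemma closure_ne_O1_of_two_le {p k : ℕ} [Fact p.Prime] (h2 : (2 : ZMod p) * 2⁻¹ = 1)
    (hp57 : p = 5 ∨ p = 7) (hk : 2 ≤ k) {r : Fin (k + 0 + 0 + 1) → GLV p k 0 0}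
    (hr : ReflHyp p k 0 0 r) : Subgroup.closure (Set.range r) ≠ O1 p k 0 0 := by
  obtain ⟨k, rfl⟩ := Nat.exists_eq_add_of_le' hk
  let a : Fin (k + 2 + 0 + 0 + 1) → ZMod p := fun j =>
    if (j : ℕ) = 0 then 1 else if (j : ℕ) = 1 then 3 else if (j : ℕ) = 2 then 4 else 0
  have ha : ∀ j, extCoord a j =
      if j = 0 then 1 else if j = 1 then 3 else if j = 2 then 4 else 0 := fun j => by
    by_cases hj : j < k + 2 + 0 + 0 + 1
    · simp [extCoord, a, hj]
    · rw [extCoord_of_le a (by omega), if_neg (by omega), if_neg (by omega), if_neg (by omega)]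
  have hform : form p (k + 2) 0 0 a a = 11 := by
    have h2' : (2 : ZMod p) ≠ 0 := left_ne_zero_of_mul_eq_one h2
    apply mul_left_cancel₀ h2'
    rw [two_mul_form h2, Finset.sum_range_succ', Finset.sum_range_succ', Finset.sum_range_succ',
      Finset.sum_eq_zero]
    · simp [diffCoord, ha]
      norm_num
    · intro i _
      simp [ha]
  obtain ⟨⟨t, ht, htt⟩, hd1, hd2, hd3⟩ := eleven_eq_sq_and_neg_one_ne hp57
  refine closure_ne_O1_of_diffCoord h2 hr a t ht (hform.trans htt) ?_
  rintro (_ | _ | _ | _ | j) <;> simp only [diffCoord, ha]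
  · simpa using hd1
  · simpa using hd2
  · norm_num; exact hd1
  · simpa using hd3
  · simp

lemma root_of_norm_eq_sq {p : ℕ} (hp57 : p = 5 ∨ p = 7) :
    ∀ x y t : ZMod p, t ≠ 0 → x ^ 2 - x * y + y ^ 2 = t ^ 2 → y = 0 ∨ x = 0 ∨ x = y := by
  rcases hp57 with rfl | rfl <;> decide

lemma O1_le_closure_of_rank_two {p : ℕ} [Fact p.Prime] (h2 : (2 : ZMod p) * 2⁻¹ = 1)
    (hp57 : p = 5 ∨ p = 7) {r : Fin (1 + 0 + 0 + 1) → GLV p 1 0 0}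
    (hr : ReflHyp p 1 0 0 r) : O1 p 1 0 0 ≤ Subgroup.closure (Set.range r) := by
  have h2' : (2 : ZMod p) ≠ 0 := left_ne_zero_of_mul_eq_one h2
  have hform : ∀ x y : Fin (1 + 0 + 0 + 1) → ZMod p,
      2 * form p 1 0 0 x y = 2 * (x 0 * y 0 + x 1 * y 1) - x 0 * y 1 - x 1 * y 0 := fun x y => by
    have hs : form p 1 0 0 x y = form p 1 0 0 x (Pi.single 0 1) * y 0
        + form p 1 0 0 x (Pi.single 1 1) * y 1 := by
      rw [form_eq_sum_single]; exact Fin.sum_univ_two _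
    have e0 := two_mul_form_single h2 x 0
    have e1 := two_mul_form_single h2 x 1
    simp [diffCoord, extCoord] at e0 e1
    rw [hs]
    linear_combination y 0 * e0 + y 1 * e1
  have hr0 : ∀ x, (r 0).1 x = ![x 1 - x 0, x 1] := fun x => by
    rw [hr, hform]
    funext i
    fin_cases i <;> simp <;> ring
  have hr1 : ∀ x, (r 1).1 x = ![x 0, x 0 - x 1] := fun x => by
    rw [hr, hform]
    funext i
    fin_cases i <;> simp <;> ring
  have hmem : ∀ i, r i ∈ Subgroup.closure (Set.range r) := fun i =>
    Subgroup.subset_closure ⟨i, rfl⟩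
  refine (Subgroup.closure_le _).2 ?_
  rintro g ⟨a, ⟨t, ht, hat⟩, hg⟩
  have hnorm : a 0 ^ 2 - a 0 * a 1 + a 1 ^ 2 = t ^ 2 := by
    apply mul_left_cancel₀ h2'
    rw [← hat, hform]
    ring
  have hga : ∀ x, g.1 x = x - ((2 * (x 0 * a 0 + x 1 * a 1) - x 0 * a 1 - x 1 * a 0)
      * (a 0 ^ 2 - a 0 * a 1 + a 1 ^ 2)⁻¹) • a := fun x => by
    rw [hg, hform, hat, hnorm]
  have hne : a 0 ^ 2 - a 0 * a 1 + a 1 ^ 2 ≠ 0 := by rw [hnorm]; exact pow_ne_zero 2 ht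
  rcases root_of_norm_eq_sq hp57 _ _ t ht hnorm with h | h | h
  · have hg0 : g = r 0 := by
      refine Units.ext (LinearMap.ext fun x => ?_)
      rw [hga, hr0]
      rw [h] at hne ⊢
      have h0 : a 0 ≠ 0 := by rintro h'; simp [h'] at hne
      funext i
      fin_cases i <;> simp [h]
      field_simp
      ring
    rw [hg0]; exact hmem 0
  · have hg1 : g = r 1 := by
      refine Units.ext (LinearMap.ext fun x => ?_)
      rw [hga, hr1]
      rw [h] at hne ⊢
      have h0 : a 1 ≠ 0 := by rintro h'; simp [h'] at hne
      funext i
      fin_cases i <;> simp [h]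
      field_simp
      ring
    rw [hg1]; exact hmem 1
  · have hg01 : g = r 0 * r 1 * r 0 := by
      refine Units.ext (LinearMap.ext fun x => ?_)
      change g.1 x = (r 0).1 ((r 1).1 ((r 0).1 x))
      rw [hga, hr0 x, hr1, hr0]
      rw [h] at hne ⊢
      have h0 : a 1 ≠ 0 := by rintro h'; simp [h'] at hne
      have hsq : a 1 ^ 2 - a 1 * a 1 + a 1 ^ 2 = a 1 ^ 2 := by ring
      rw [hsq]
      funext i
      fin_cases i <;> (simp [h]; field_simp; ring)
    rw [hg01]
    exact mul_mem (mul_mem (hmem 0) (hmem 1)) (hmem 0)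

/-- for `G = [3^k]` on `V = (ZMod p)^{k+1}` with `p ≥ 5` and `p ∤ (k+2)`,
the form is nondegenerate, `Gᵖ ≤ O₁(V)`, with equality iff `k = 1` and `p ∈ {5, 7}`. -/
theorem statement12 (p k : ℕ) (hp : p.Prime) (hp5 : 5 ≤ p) (hk : 1 ≤ k)
    (hnd : ¬ p ∣ (k + 2))
    (r : Fin (k + 0 + 0 + 1) → GLV p k 0 0) (hr : ReflHyp p k 0 0 r) :
    (∀ x : Fin (k + 0 + 0 + 1) → ZMod p, (∀ y, form p k 0 0 x y = 0) → x = 0) ∧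
    Subgroup.closure (Set.range r) ≤ O1 p k 0 0 ∧
    (Subgroup.closure (Set.range r) = O1 p k 0 0 ↔ k = 1 ∧ (p = 5 ∨ p = 7)) := by
  have : Fact p.Prime := ⟨hp⟩
  have h2' : (2 : ZMod p) ≠ 0 := fun h =>
    absurd (Nat.le_of_dvd two_pos ((ZMod.natCast_eq_zero_iff 2 p).1 (by exact_mod_cast h)))
      (by omega)
  have h2 : (2 : ZMod p) * 2⁻¹ = 1 := mul_inv_cancel₀ h2'
  refine ⟨eq_zero_of_form_eq_zero h2 hnd, closure_le_O1 hr, fun heq => ?_, ?_⟩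
  · have hp57 : p = 5 ∨ p = 7 := by
      by_contra h
      refine closure_ne_O1_of_eleven_le h2 ?_ hk hr heq
      by_contra hlt
      interval_cases p <;> first | omega | exact absurd hp (by norm_num)
    refine ⟨?_, hp57⟩
    by_contra hk1
    exact closure_ne_O1_of_two_le h2 hp57 (by omega) hr heq
  · rintro ⟨rfl, hp57⟩
    exact le_antisymm (closure_le_O1 hr) (O1_le_closure_of_rank_two h2 hp57 hr)

end Statement12
end

section
/- Let k ≥ 1 and let p ≥ 5 be prime. If it is not the case that k = 1 and p ∈ {5, 7}, then the group G^p = [∞, 3^k, ∞]^p is not a string C-group, i.e., the intersection property fails for its generating reflections r_0,…,r_{n−1}. -/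
/- Setup: the reduction mod a prime `p ≥ 5` of the Coxeter group `[∞, 3^k, ∞]`,
acting on `V = (ZMod p)^n` with `n = k + 3`. -/

namespace Statement14

/-- The Gram matrix of the basic system for `[∞, 3^k, ∞]`, reduced mod `p`:
diagonal entries `1`; the entries for the first and last branches (labelled `∞`) are `−1`,
those for the `k` middle branches (labelled `3`) are `−2⁻¹`; all other entries `0`. -/
def gram (p k : ℕ) : Matrix (Fin (k + 3)) (Fin (k + 3)) (ZMod p) :=
  fun i j =>
    if i = j then 1
    else if (j : ℕ) = (i : ℕ) + 1 then
      (if (j : ℕ) = 1 ∨ (j : ℕ) = k + 2 then -1 else -(2⁻¹ : ZMod p))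
    else if (i : ℕ) = (j : ℕ) + 1 then
      (if (i : ℕ) = 1 ∨ (i : ℕ) = k + 2 then -1 else -(2⁻¹ : ZMod p))
    else 0

/-- The corresponding symmetric bilinear form `x·y` on `V`. -/
def form (p k : ℕ) (x y : Fin (k + 3) → ZMod p) : ZMod p :=
  ∑ i, ∑ j, x i * gram p k i j * y j

/-- The general linear group of `V`. -/
abbrev GLV (p k : ℕ) := (Module.End (ZMod p) (Fin (k + 3) → ZMod p))ˣ

/-- `r i` is the generating reflection `r_i : x ↦ x − 2(x·b_i) b_i`. -/
def ReflHyp (p k : ℕ) (r : Fin (k + 3) → GLV p k) : Prop :=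
  ∀ i x, (r i).1 x =
    x - (2 * form p k x (Pi.single i 1)) • (Pi.single i 1 : Fin (k + 3) → ZMod p)

/-- The intersection property (string C-group condition). -/
def IsStringC (p k : ℕ) (r : Fin (k + 3) → GLV p k) : Prop :=
  ∀ I J : Set (Fin (k + 3)),
    Subgroup.closure (r '' I) ⊓ Subgroup.closure (r '' J) = Subgroup.closure (r '' (I ∩ J))

section Reflection

variable {F V : Type*} [Field F] [AddCommGroup V] [Module F V]

/-- `v` is a unit vector of the form `B` whose reflection lies in the group `K`. -/
def IsUnitRoot (B : LinearMap.BilinForm F V) (K : Subgroup (Module.End F V)ˣ) (v : V) : Prop :=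
  B v v = 1 ∧ ∃ g ∈ K, ∀ x, g.1 x = x - (2 * B x v) • v

variable {B : LinearMap.BilinForm F V} {K : Subgroup (Module.End F V)ˣ}

theorem IsUnitRoot.neg {v : V} (hv : IsUnitRoot B K v) : IsUnitRoot B K (-v) := by
  obtain ⟨h1, g, hg, h⟩ := hv
  refine ⟨by simpa using h1, g, hg, fun x => ?_⟩
  rw [h x]
  simp

theorem IsUnitRoot.reflect (hB : ∀ x y, B x y = B y x) {v w : V} (hv : IsUnitRoot B K v)
    (hw : IsUnitRoot B K w) : IsUnitRoot B K (w - (2 * B w v) • v) := by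
  obtain ⟨h1, g, hg, h⟩ := hv
  obtain ⟨h1', g', hg', h'⟩ := hw
  refine ⟨?_, g * g' * g, K.mul_mem (K.mul_mem hg hg') hg, fun x => ?_⟩
  · simp only [map_sub, map_smul, LinearMap.sub_apply, LinearMap.smul_apply, smul_eq_mul, h1, h1',
      hB v w]
    ring
  · simp only [Units.val_mul, Module.End.mul_apply, h, h', map_sub, map_smul, LinearMap.sub_apply,
      LinearMap.smul_apply, smul_eq_mul, h1, hB v w]
    module

theorem IsUnitRoot.sub_smul_add (hB : ∀ x y, B x y = B y x) {v w : V} (hv : IsUnitRoot B K v)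
    (hw : IsUnitRoot B K w) (hvw : B v w = -1) (n : ℕ) :
    IsUnitRoot B K (w - (2 * n : F) • (v + w)) := by
  have hwv : B w v = -1 := by rw [hB, hvw]
  induction n with
  | zero => simpa using hw
  | succ n ih =>
    have h := (hv.reflect hB (hw.reflect hB ih).neg).neg
    convert h using 1
    simp only [map_sub, map_smul, map_add, map_neg, LinearMap.sub_apply, LinearMap.smul_apply,
      LinearMap.add_apply, LinearMap.neg_apply, smul_eq_mul, hv.1, hw.1, hvw, hwv]
    push_cast
    module

end Reflection

section Pencil

variable {p : ℕ} [Fact p.Prime] {V : Type*} [AddCommGroup V] [Module (ZMod p) V]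
  {B : LinearMap.BilinForm (ZMod p) V} {K : Subgroup (Module.End (ZMod p) V)ˣ}

/-- Two unit roots at angle zero generate a whole affine line of unit roots. -/
theorem IsUnitRoot.add_smul_add (hB : ∀ x y, B x y = B y x) (h2 : (2 : ZMod p) ≠ 0) {v w : V}
    (hv : IsUnitRoot B K v) (hw : IsUnitRoot B K w) (hvw : B v w = -1) (t : ZMod p) :
    IsUnitRoot B K (w + t • (v + w)) := by
  obtain ⟨n, hn⟩ := ZMod.natCast_zmod_surjective (-t / 2)
  convert hv.sub_smul_add hB hw hvw n using 1
  rw [hn, mul_div_cancel₀ _ h2]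
  module

theorem isUnitRoot_of_seven_ne_zero (hB : ∀ x y, B x y = B y x) (h2 : (2 : ZMod p) ≠ 0)
    (h7 : (7 : ZMod p) ≠ 0) {a₀ a₁ a₂ : V} (h₀ : IsUnitRoot B K a₀) (h₁ : IsUnitRoot B K a₁)
    (h₂ : IsUnitRoot B K a₂) (h01 : B a₀ a₁ = -1) (h12 : B a₁ a₂ = -2⁻¹) (h02 : B a₀ a₂ = 0) :
    IsUnitRoot B K ((8 / 7 : ZMod p) • a₁ + (5 / 7 : ZMod p) • a₂) := by
  have h10 := hB a₁ a₀
  have h21 := hB a₂ a₁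
  have h20 := hB a₂ a₀
  rw [h01] at h10
  rw [h12] at h21
  rw [h02] at h20
  have h := (h₀.add_smul_add hB h2 h₁ h01 2).reflect hB
    (h₂.reflect hB (h₀.add_smul_add hB h2 h₁ h01 (-2 / 7)))
  convert h using 1
  simp only [map_sub, map_smul, map_add, LinearMap.sub_apply, LinearMap.smul_apply,
    LinearMap.add_apply, smul_eq_mul, h₀.1, h₁.1, h01, h12, h02, h10, h20, h21]
  match_scalars <;> field_simp <;> ring

/-- Four roots forming the diagram `[∞, 3, 3]`. -/
structure IsDiagram (B : LinearMap.BilinForm (ZMod p) V) (K : Subgroup (Module.End (ZMod p) V)ˣ)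
    (a₀ a₁ a₂ a₃ : V) : Prop where
  symm : ∀ x y, B x y = B y x
  root₀ : IsUnitRoot B K a₀
  root₁ : IsUnitRoot B K a₁
  root₂ : IsUnitRoot B K a₂
  root₃ : IsUnitRoot B K a₃
  form01 : B a₀ a₁ = -1
  form02 : B a₀ a₂ = 0
  form03 : B a₀ a₃ = 0
  form12 : B a₁ a₂ = -2⁻¹
  form13 : B a₁ a₃ = 0
  form23 : B a₂ a₃ = -2⁻¹

variable {a₀ a₁ a₂ a₃ : V}

theorem IsDiagram.reflect₂ (h2 : (2 : ZMod p) ≠ 0) (h : IsDiagram B K a₀ a₁ a₂ a₃)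
    {x₀ x₁ x₂ x₃ : ZMod p} (hx : IsUnitRoot B K (x₀ • a₀ + x₁ • a₁ + x₂ • a₂ + x₃ • a₃))
    (y₂ : ZMod p) (hy : y₂ = x₁ + x₃ - x₂) :
    IsUnitRoot B K (x₀ • a₀ + x₁ • a₁ + y₂ • a₂ + x₃ • a₃) := by
  convert h.root₂.reflect h.symm hx using 1
  simp only [map_smul, map_add, LinearMap.smul_apply, LinearMap.add_apply, smul_eq_mul,
    h.root₂.1, h.form02, h.form12, h.symm a₃ a₂, h.form23, hy]
  match_scalars <;> field_simp; ring

theorem IsDiagram.reflect₃ (h2 : (2 : ZMod p) ≠ 0) (h : IsDiagram B K a₀ a₁ a₂ a₃)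
    {x₀ x₁ x₂ x₃ : ZMod p} (hx : IsUnitRoot B K (x₀ • a₀ + x₁ • a₁ + x₂ • a₂ + x₃ • a₃))
    (y₃ : ZMod p) (hy : y₃ = x₂ - x₃) :
    IsUnitRoot B K (x₀ • a₀ + x₁ • a₁ + x₂ • a₂ + y₃ • a₃) := by
  convert h.root₃.reflect h.symm hx using 1
  simp only [map_smul, map_add, LinearMap.smul_apply, LinearMap.add_apply, smul_eq_mul,
    h.root₃.1, h.form03, h.form13, h.form23, hy]
  match_scalars <;> field_simp; ring

theorem IsDiagram.reflect_line (h2 : (2 : ZMod p) ≠ 0) (h : IsDiagram B K a₀ a₁ a₂ a₃)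
    {x₀ x₁ x₂ x₃ : ZMod p} (hx : IsUnitRoot B K (x₀ • a₀ + x₁ • a₁ + x₂ • a₂ + x₃ • a₃))
    (t y₀ y₁ : ZMod p) (hy₀ : y₀ = x₀ - (2 * (x₁ - x₀) - x₂ - t * x₂) * t)
    (hy₁ : y₁ = x₁ - (2 * (x₁ - x₀) - x₂ - t * x₂) * (1 + t)) :
    IsUnitRoot B K (y₀ • a₀ + y₁ • a₁ + x₂ • a₂ + x₃ • a₃) := by
  convert (h.root₀.add_smul_add h.symm h2 h.root₁ h.form01 t).reflect h.symm hx using 1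
  simp only [map_smul, map_add, LinearMap.smul_apply, LinearMap.add_apply, smul_eq_mul,
    h.root₀.1, h.root₁.1, h.form01, h.symm a₁ a₀, h.symm a₂ a₀, h.symm a₂ a₁, h.symm a₃ a₀,
    h.symm a₃ a₁, h.form02, h.form12, h.form03, h.form13, hy₀, hy₁]
  match_scalars <;> field_simp <;> ring

end Pencil

instance fact_prime_five : Fact (Nat.Prime 5) := ⟨by norm_num⟩

instance fact_prime_seven : Fact (Nat.Prime 7) := ⟨by norm_num⟩

theorem IsDiagram.isUnitRoot_five {V : Type*} [AddCommGroup V]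
    [Module (ZMod 5) V] {B : LinearMap.BilinForm (ZMod 5) V}
    {K : Subgroup (Module.End (ZMod 5) V)ˣ} {a₀ a₁ a₂ a₃ : V} (h : IsDiagram B K a₀ a₁ a₂ a₃) :
    IsUnitRoot B K ((2 : ZMod 5) • a₁ + (3 : ZMod 5) • a₂ + (4 : ZMod 5) • a₃) := by
  have h2 : (2 : ZMod 5) ≠ 0 := by decide
  have s : IsUnitRoot B K
      ((0 : ZMod 5) • a₀ + (0 : ZMod 5) • a₁ + (1 : ZMod 5) • a₂ + (0 : ZMod 5) • a₃) := by
    simpa using h.root₂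
  replace s := h.reflect₃ h2 s 1 (by decide)
  replace s := h.reflect_line h2 s 1 2 4 (by decide) (by decide)
  replace s := h.reflect₂ h2 s 4 (by decide)
  replace s := h.reflect₃ h2 s 3 (by decide)
  replace s := h.reflect_line h2 s 2 3 3 (by decide) (by decide)
  replace s := h.reflect₂ h2 s 2 (by decide)
  replace s := h.reflect₃ h2 s 4 (by decide)
  replace s := h.reflect_line h2 s 1 2 1 (by decide) (by decide)
  replace s := h.reflect₂ h2 s 3 (by decide)
  replace s := h.reflect_line h2 s 1 0 2 (by decide) (by decide)
  simpa using s

theorem IsDiagram.isUnitRoot_seven {V : Type*} [AddCommGroup V]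
    [Module (ZMod 7) V] {B : LinearMap.BilinForm (ZMod 7) V}
    {K : Subgroup (Module.End (ZMod 7) V)ˣ} {a₀ a₁ a₂ a₃ : V} (h : IsDiagram B K a₀ a₁ a₂ a₃) :
    IsUnitRoot B K ((4 : ZMod 7) • a₁ + (5 : ZMod 7) • a₂ + (3 : ZMod 7) • a₃) := by
  have h2 : (2 : ZMod 7) ≠ 0 := by decide
  have s : IsUnitRoot B K
      ((0 : ZMod 7) • a₀ + (0 : ZMod 7) • a₁ + (1 : ZMod 7) • a₂ + (0 : ZMod 7) • a₃) := by
    simpa using h.root₂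
  replace s := h.reflect_line h2 s 1 2 4 (by decide) (by decide)
  replace s := h.reflect₂ h2 s 3 (by decide)
  replace s := h.reflect₃ h2 s 3 (by decide)
  replace s := h.reflect_line h2 s 2 5 5 (by decide) (by decide)
  replace s := h.reflect₂ h2 s 5 (by decide)
  replace s := h.reflect_line h2 s 4 0 4 (by decide) (by decide)
  simpa using s

/-- The standard basis vector `b_i` (zero if `i` is out of range). -/
def basisVec (p k i : ℕ) : Fin (k + 3) → ZMod p := fun j => if (j : ℕ) = i then 1 else 0

theorem basisVec_eq_single (p k : ℕ) (i : Fin (k + 3)) :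
    basisVec p k i = Pi.single i 1 := by
  ext j
  simp [basisVec, Pi.single_apply, Fin.ext_iff]

/-- The form of the Gram matrix as a bilinear map. -/
noncomputable def bilin (p k : ℕ) : LinearMap.BilinForm (ZMod p) (Fin (k + 3) → ZMod p) :=
  Matrix.toBilin' (gram p k)

theorem bilin_apply (p k : ℕ) (x y : Fin (k + 3) → ZMod p) : bilin p k x y = form p k x y :=
  Matrix.toBilin'_apply _ _ _

theorem gram_symm (p k : ℕ) (i j : Fin (k + 3)) : gram p k i j = gram p k j i := by
  unfold gram
  simp only [Fin.ext_iff]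
  grind

theorem bilin_symm (p k : ℕ) (x y : Fin (k + 3) → ZMod p) :
    bilin p k x y = bilin p k y x := by
  rw [bilin_apply, bilin_apply, form, form, Finset.sum_comm]
  refine Finset.sum_congr rfl fun i _ => Finset.sum_congr rfl fun j _ => ?_
  rw [gram_symm]
  ring

theorem bilin_basisVec (p k i j : ℕ) (hi : i < k + 3) (hj : j < k + 3) :
    bilin p k (basisVec p k i) (basisVec p k j) =
      if i = j then 1
      else if j = i + 1 then (if j = 1 ∨ j = k + 2 then -1 else -(2⁻¹ : ZMod p))
      else if i = j + 1 then (if i = 1 ∨ i = k + 2 then -1 else -(2⁻¹ : ZMod p))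
      else 0 := by
  have h1 := basisVec_eq_single p k ⟨i, hi⟩
  have h2 := basisVec_eq_single p k ⟨j, hj⟩
  simp only at h1 h2
  rw [h1, h2, bilin, Matrix.toBilin'_single]
  simp [gram, Fin.ext_iff]

/-- The orbit of `b_0` under the reflections of the inner nodes: `b_0 + 2 (b_1 + ⋯ + b_m)`. -/
def orbitVec (p k : ℕ) : ℕ → Fin (k + 3) → ZMod p
  | 0 => basisVec p k 0
  | m + 1 => orbitVec p k m + (2 : ZMod p) • basisVec p k (m + 1)

theorem orbitVec_apply_one (p k m : ℕ) :
    orbitVec p k m 1 = if m = 0 then 0 else 2 := by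
  induction m with
  | zero => simp [orbitVec, basisVec]
  | succ m ih =>
    simp only [orbitVec, Pi.add_apply, ih, Pi.smul_apply, basisVec, smul_eq_mul]
    rcases m with _ | m <;> simp

theorem bilin_orbitVec (p k : ℕ) (h2 : (2 : ZMod p) * 2⁻¹ = 1) (m : ℕ) (hm : m ≤ k + 1) (i : ℕ)
    (hi : 1 ≤ i) (hi' : i ≤ k + 1) :
    bilin p k (orbitVec p k m) (basisVec p k i) =
      if i = m then 1 else if i = m + 1 then -1 else 0 := by
  induction m with
  | zero =>
    rw [orbitVec, bilin_basisVec _ _ _ _ (by omega) (by omega)]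
    split_ifs <;> first | omega | rfl | tauto
  | succ m ih =>
    rw [orbitVec, map_add, map_smul, LinearMap.add_apply, LinearMap.smul_apply, ih (by omega),
      bilin_basisVec _ _ _ _ (by omega) (by omega), smul_eq_mul]
    split_ifs <;> first | omega | norm_num [h2]

section Main

variable {p k : ℕ} [Fact p.Prime] {r : Fin (k + 3) → GLV p k}

theorem isUnitRoot_basisVec (hr : ReflHyp p k r) (I : Set (Fin (k + 3))) (i : Fin (k + 3))
    (hi : i ∈ I) :
    IsUnitRoot (bilin p k) (Subgroup.closure (r '' I)) (basisVec p k i) := by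
  refine ⟨by simp [bilin_basisVec], r i, Subgroup.subset_closure ⟨i, hi, rfl⟩, fun x => ?_⟩
  rw [hr i x, basisVec_eq_single, bilin_apply]

theorem mem_orbit_of_mem_closure (hr : ReflHyp p k r) (h2 : (2 : ZMod p) * 2⁻¹ = 1)
    (I : Set (Fin (k + 3))) (hI : ∀ i ∈ I, 1 ≤ (i : ℕ) ∧ (i : ℕ) ≤ k + 1) (g : GLV p k)
    (hg : g ∈ Subgroup.closure (r '' I)) (x : Fin (k + 3) → ZMod p) :
    (∃ m ≤ k + 1, x = orbitVec p k m) ↔ ∃ m ≤ k + 1, g.1 x = orbitVec p k m := by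
  induction hg using Subgroup.closure_induction generalizing x with
  | mem g hg =>
    obtain ⟨i, hi, rfl⟩ := hg
    obtain ⟨h1, h1'⟩ := hI i hi
    have hri : ∀ x, (r i).1 x = x - (2 * bilin p k x (basisVec p k i)) • basisVec p k i := by
      intro x
      rw [hr i x, basisVec_eq_single, bilin_apply]
    have hmap : ∀ x, (∃ m ≤ k + 1, x = orbitVec p k m) →
        ∃ m ≤ k + 1, (r i).1 x = orbitVec p k m := by
      rintro _ ⟨m, hm, rfl⟩
      rw [hri, bilin_orbitVec p k h2 m hm i h1 h1']
      by_cases him : (i : ℕ) = m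
      · obtain ⟨m, rfl⟩ : ∃ l, m = l + 1 := ⟨m - 1, by omega⟩
        refine ⟨m, by omega, ?_⟩
        rw [if_pos him, him, orbitVec]
        module
      · by_cases him' : (i : ℕ) = m + 1
        · refine ⟨m + 1, by omega, ?_⟩
          rw [if_neg him, if_pos him', him', orbitVec]
          module
        · exact ⟨m, hm, by simp [him, him']⟩
    have hinv : (r i).1 ((r i).1 x) = x := by
      have h : bilin p k (basisVec p k i) (basisVec p k i) = 1 := by simp [bilin_basisVec]
      rw [hri ((r i).1 x), hri x]
      simp only [map_sub, map_smul, LinearMap.sub_apply, LinearMap.smul_apply, smul_eq_mul, h]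
      module
    refine ⟨hmap x, fun h => ?_⟩
    have := hmap _ h
    rwa [hinv] at this
  | one => simp
  | mul g g' _ _ ih ih' =>
    rw [ih' x, ih]
    simp
  | inv g _ ih =>
    rw [ih (g⁻¹.1 x), ← Module.End.mul_apply, ← Units.val_mul]
    simp

/-- In the group generated by all reflections but the first one there is a root whose inner
products with the inner basis vectors agree with those of `b_0`. -/
theorem exists_isUnitRoot_opposite (hr : ReflHyp p k r) (h2 : (2 : ZMod p) * 2⁻¹ = 1)
    (j : ℕ) (hj : j ≤ k + 1) :
    ∃ d, IsUnitRoot (bilin p k) (Subgroup.closure (r '' {i | 1 ≤ (i : ℕ)})) d ∧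
      ∀ i, 1 ≤ i → i ≤ k + 1 → bilin p k d (basisVec p k i) =
        if i + j = k + 1 then -1 else if i + j = k + 2 then 1 else 0 := by
  induction j with
  | zero =>
    refine ⟨basisVec p k (k + 2), isUnitRoot_basisVec hr _ ⟨k + 2, by omega⟩ (by simp), ?_⟩
    intro i hi hi'
    rw [bilin_basisVec _ _ _ _ (by omega) (by omega)]
    split_ifs <;> first | omega | rfl
  | succ j ih =>
    obtain ⟨d, hd, h⟩ := ih (by omega)
    obtain ⟨l, hl⟩ : ∃ l, l + j = k + 1 := ⟨k + 1 - j, by omega⟩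
    refine ⟨_, (isUnitRoot_basisVec hr {i | 1 ≤ (i : ℕ)} ⟨l, by omega⟩
      (by simp; omega)).reflect (bilin_symm p k) hd, ?_⟩
    intro i hi hi'
    simp only [map_sub, map_smul, LinearMap.sub_apply, LinearMap.smul_apply, smul_eq_mul]
    rw [h i hi hi', h l (by omega) (by omega), bilin_basisVec _ _ _ _ (by omega) (by omega)]
    split_ifs <;> first | omega | norm_num [h2]

/-- A common root of the two facet groups that is not a root of the inner group. -/
theorem not_isStringC_of_isUnitRoot (hr : ReflHyp p k r) (h2 : (2 : ZMod p) * 2⁻¹ = 1)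
    (c : Fin (k + 3) → ZMod p)
    (hI : IsUnitRoot (bilin p k) (Subgroup.closure (r '' {i | (i : ℕ) ≤ k + 1})) c)
    (hJ : IsUnitRoot (bilin p k) (Subgroup.closure (r '' {i | 1 ≤ (i : ℕ)})) c)
    (h0 : bilin p k (basisVec p k 0) c = -c 1) (hc : c 1 * c 1 ≠ 0) (hc' : c 1 * c 1 ≠ 1) :
    ¬ IsStringC p k r := by
  intro hS
  obtain ⟨-, g, hg, hgx⟩ := hI
  obtain ⟨-, g', hg', hgx'⟩ := hJ
  obtain rfl : g = g' := Units.ext (LinearMap.ext fun x => by rw [hgx, hgx'])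
  have hmem : g ∈ Subgroup.closure (r '' ({i | (i : ℕ) ≤ k + 1} ∩ {i | 1 ≤ (i : ℕ)})) := by
    rw [← hS]
    exact ⟨hg, hg'⟩
  obtain ⟨m, -, hm⟩ := (mem_orbit_of_mem_closure hr h2 _ (fun i hi => ⟨hi.2, hi.1⟩) g hmem
    (basisVec p k 0)).1 ⟨0, by omega, rfl⟩
  have h := congrFun hm 1
  rw [hgx, orbitVec_apply_one, h0] at h
  have hb : basisVec p k 0 1 = 0 := by simp [basisVec]
  simp only [Pi.sub_apply, Pi.smul_apply, smul_eq_mul, hb] at h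
  split_ifs at h
  · exact hc (by linear_combination 2⁻¹ * h - c 1 * c 1 * h2)
  · exact hc' (by linear_combination 2⁻¹ * h + (1 - c 1 * c 1) * h2)

end Main

/-- for `k ≥ 1` and a prime `p ≥ 5`, except possibly when `k = 1` and
`p ∈ {5, 7}`, the group `[∞, 3^k, ∞]ᵖ` is not a string C-group. -/
theorem statement14 (p k : ℕ) (hp : p.Prime) (hp5 : 5 ≤ p) (hk : 1 ≤ k)
    (hexc : ¬ (k = 1 ∧ (p = 5 ∨ p = 7)))
    (r : Fin (k + 3) → GLV p k) (hr : ReflHyp p k r) :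
    ¬ IsStringC p k r := by
  have h5sq : (2 : ZMod 5) * 2 ≠ 0 ∧ (2 : ZMod 5) * 2 ≠ 1 := by decide
  have h7sq : (4 : ZMod 7) * 4 ≠ 0 ∧ (4 : ZMod 7) * 4 ≠ 1 := by decide
  have := Fact.mk hp
  have h2 : (2 : ZMod p) ≠ 0 := by
    intro h
    have : p ∣ 2 := (ZMod.natCast_eq_zero_iff 2 p).1 (by exact_mod_cast h)
    have := Nat.le_of_dvd (by norm_num) this
    omega
  have h2' : (2 : ZMod p) * 2⁻¹ = 1 := mul_inv_cancel₀ h2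
  have hB := bilin_symm p k
  obtain ⟨d, hd, hdi⟩ := exists_isUnitRoot_opposite hr h2' (k + 1) le_rfl
  replace hd := hd.neg
  have hrI : ∀ i ≤ k + 1, IsUnitRoot (bilin p k)
      (Subgroup.closure (r '' {i | (i : ℕ) ≤ k + 1})) (basisVec p k i) := fun i hi =>
    isUnitRoot_basisVec hr _ ⟨i, by omega⟩ hi
  have hrJ : ∀ i, 1 ≤ i → i ≤ k + 1 → IsUnitRoot (bilin p k)
      (Subgroup.closure (r '' {i | 1 ≤ (i : ℕ)})) (basisVec p k i) := fun i hi hi' =>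
    isUnitRoot_basisVec hr _ ⟨i, by omega⟩ hi
  have b01 : bilin p k (basisVec p k 0) (basisVec p k 1) = -1 := by
    simp [bilin_basisVec]
  have b02 : bilin p k (basisVec p k 0) (basisVec p k 2) = 0 := by
    simp [bilin_basisVec]
  have b12 : bilin p k (basisVec p k 1) (basisVec p k 2) = -2⁻¹ := by
    rw [bilin_basisVec _ _ _ _ (by omega) (by omega)]
    simp
    omega
  have d1 : bilin p k (-d) (basisVec p k 1) = -1 := by
    rw [map_neg, LinearMap.neg_apply, hdi 1 (by omega) (by omega), if_neg (by omega),
      if_pos (by omega)]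
  have d2 : bilin p k (-d) (basisVec p k 2) = 0 := by
    rw [map_neg, LinearMap.neg_apply, hdi 2 (by omega) (by omega), if_neg (by omega),
      if_neg (by omega), neg_zero]
  by_cases h57 : p = 5 ∨ p = 7
  · have hk2 : 2 ≤ k := by omega
    have b03 : bilin p k (basisVec p k 0) (basisVec p k 3) = 0 := by
      rw [bilin_basisVec _ _ _ _ (by omega) (by omega)]
      simp
    have b13 : bilin p k (basisVec p k 1) (basisVec p k 3) = 0 := by
      rw [bilin_basisVec _ _ _ _ (by omega) (by omega)]
      simp
    have b23 : bilin p k (basisVec p k 2) (basisVec p k 3) = -2⁻¹ := by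
      rw [bilin_basisVec _ _ _ _ (by omega) (by omega)]
      simp
      omega
    have d3 : bilin p k (-d) (basisVec p k 3) = 0 := by
      rw [map_neg, LinearMap.neg_apply, hdi 3 (by omega) (by omega), if_neg (by omega),
      if_neg (by omega), neg_zero]
    have hI : IsDiagram (bilin p k) (Subgroup.closure (r '' {i | (i : ℕ) ≤ k + 1}))
        (basisVec p k 0) (basisVec p k 1) (basisVec p k 2) (basisVec p k 3) :=
      ⟨hB, hrI 0 (by omega), hrI 1 (by omega), hrI 2 (by omega), hrI 3 (by omega), b01, b02, b03,
        b12, b13, b23⟩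
    have hJ : IsDiagram (bilin p k) (Subgroup.closure (r '' {i | 1 ≤ (i : ℕ)}))
        (-d) (basisVec p k 1) (basisVec p k 2) (basisVec p k 3) :=
      ⟨hB, hd, hrJ 1 (by omega) (by omega), hrJ 2 (by omega) (by omega),
        hrJ 3 (by omega) (by omega), d1, d2, d3, b12, b13, b23⟩
    have hc : ∀ x y z : ZMod p,
        (x • basisVec p k 1 + y • basisVec p k 2 + z • basisVec p k 3) 1 = x := by
      simp [basisVec]
    rcases h57 with rfl | rfl
    · refine not_isStringC_of_isUnitRoot hr h2' _ hI.isUnitRoot_five hJ.isUnitRoot_five ?_ ?_ ?_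
      · rw [hc]
        simp [b01, b02, b03]
      · rw [hc]
        exact h5sq.1
      · rw [hc]
        exact h5sq.2
    · refine not_isStringC_of_isUnitRoot hr h2' _ hI.isUnitRoot_seven hJ.isUnitRoot_seven ?_ ?_ ?_
      · rw [hc]
        simp [b01, b02, b03]
      · rw [hc]
        exact h7sq.1
      · rw [hc]
        exact h7sq.2
  · have hne : ∀ q : ℕ, q.Prime → q ≠ p → (q : ZMod p) ≠ 0 := fun q hq hqp h =>
      hqp ((Nat.prime_dvd_prime_iff_eq hp hq).1 ((ZMod.natCast_eq_zero_iff q p).1 h)).symm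
    have h3 : (3 : ZMod p) ≠ 0 := by exact_mod_cast hne 3 (by norm_num) (by omega)
    have h5 : (5 : ZMod p) ≠ 0 := by exact_mod_cast hne 5 (by norm_num) (by omega)
    have h7 : (7 : ZMod p) ≠ 0 := by exact_mod_cast hne 7 (by norm_num) (by omega)
    have hc : ∀ x y : ZMod p, (x • basisVec p k 1 + y • basisVec p k 2) 1 = x := by
      simp [basisVec]
    refine not_isStringC_of_isUnitRoot hr h2' _
      (isUnitRoot_of_seven_ne_zero hB h2 h7 (hrI 0 (by omega)) (hrI 1 (by omega))
        (hrI 2 (by omega)) b01 b12 b02)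
      (isUnitRoot_of_seven_ne_zero hB h2 h7 hd (hrJ 1 (by omega) (by omega))
        (hrJ 2 (by omega) (by omega)) d1 b12 d2) ?_ ?_ ?_
    · rw [hc]
      simp [b01, b02]
    · rw [hc, show (8 : ZMod p) = 2 * 2 * 2 by norm_num]
      positivity
    · rw [hc]
      intro h
      field_simp at h
      have : (3 : ZMod p) * 5 = 0 := by linear_combination h
      simp [h3, h5] at this

end Statement14
end
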